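/- Fix positive real numbers α and β. The following are equivalent: (i) αβ ≤ 1; (ii) every f ∈ L¹(ℝ, ℂ) satisfying ∫_ℝ e^{iπαmt} f(t) dt = 0 and ∫_ℝ e^{−iπβn/t} f(t) dt = 0 for all integers m, n ≥ 0 also satisfies ∫_ℝ e^{iyt} f(t) dt = 0 for every real y ≥ 0. -/

import Mathlib

open MeasureTheory Real

namespace KleinGordon

open Set Filter Topology FourierTransform

/-- The nonzero integers, which index the inverse branches of the Gauss-type map. -/
abbrev NZ : Type := {j : ℤ // j ≠ 0}

lemma hasSum_nonzero {f : ℤ → ℂ} {a : ℂ} (h : HasSum f a) :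
    HasSum (fun j : NZ => f j) (a - f 0) := by
  have := (Finset.hasSum_compl_iff (f := f) (a := a - f 0) {0}).2 (by simpa using h)
  have h2 := (Equiv.subtypeEquivRight (p := fun j : ℤ => j ≠ 0)
    (q := fun j : ℤ => j ∉ ({0} : Finset ℤ)) (by simp)).hasSum_iff.2 this
  exact h2

lemma summable_inv_sq_nonzero : Summable (fun j : NZ => 1 / ((j : ℤ) : ℝ) ^ 2) := by
  have : Summable (fun j : ℤ => 1 / (j : ℝ) ^ 2) := by
    simpa using (Real.summable_one_div_int_pow (p := 2)).2 (by norm_num)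
  exact this.subtype _

/-- `(π / 2) cot (π w / 2)`, written with exponentials decaying in the lower half-plane. -/
noncomputable def halfCot (w : ℂ) : ℂ :=
  Complex.I * π / 2 * ((1 + Complex.exp (-(Complex.I * π * w))) /
    (1 - Complex.exp (-(Complex.I * π * w))))

lemma halfCot_eq_cot (w : ℂ) : halfCot w = π / 2 * Complex.cot (π * (w / 2)) := by
  rw [Complex.cot_pi_eq_exp_ratio, halfCot, Complex.exp_neg]
  have h : 2 * (π : ℂ) * Complex.I * (w / 2) = Complex.I * π * w := by ring
  rw [h]
  have h0 := Complex.exp_ne_zero (Complex.I * π * w)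
  set E := Complex.exp (Complex.I * π * w)
  by_cases h1 : E = 1
  · simp [h1]
  have h2 : 1 - E ≠ 0 := fun h => h1 (by linear_combination -h)
  have h3 : E - 1 ≠ 0 := fun h => h1 (by linear_combination h)
  have h4 : 1 - E⁻¹ ≠ 0 := by
    intro h; apply h3; field_simp at h; simpa using h
  field_simp
  rw [Complex.I_sq]
  ring_nf

lemma halfCot_add_int (w : ℂ) (n : ℤ) : halfCot (w + 2 * n) = halfCot w := by
  have : Complex.exp (-(Complex.I * π * (w + 2 * n))) = Complex.exp (-(Complex.I * π * w)) := by
    rw [Complex.exp_eq_exp_iff_exists_int]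
    exact ⟨-n, by push_cast; ring⟩
  rw [halfCot, halfCot, this]

lemma norm_exp_neg_I_pi (w : ℂ) :
    ‖Complex.exp (-(Complex.I * π * w))‖ = Real.exp (π * w.im) := by
  rw [Complex.norm_exp]; congr 1; simp

lemma norm_exp_neg_I_pi_lt_one {w : ℂ} (hw : w.im < 0) :
    ‖Complex.exp (-(Complex.I * π * w))‖ < 1 := by
  rw [norm_exp_neg_I_pi, Real.exp_lt_one_iff]
  exact mul_neg_of_pos_of_neg Real.pi_pos hw

lemma norm_halfCot_le {w : ℂ} {η : ℝ} (hη : η < 0) (hw : w.im ≤ η) :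
    ‖halfCot w‖ ≤ π / (1 - Real.exp (π * η)) := by
  have h1 : Real.exp (π * w.im) ≤ Real.exp (π * η) := by
    gcongr
  have h2 : Real.exp (π * η) < 1 := by
    rw [Real.exp_lt_one_iff]; exact mul_neg_of_pos_of_neg Real.pi_pos hη
  rw [halfCot, norm_mul, norm_div (1 + _)]
  set q := Complex.exp (-(Complex.I * π * w)) with hq
  have h3 : ‖q‖ = Real.exp (π * w.im) := norm_exp_neg_I_pi w
  have h4 : ‖1 + q‖ ≤ 2 := by
    calc ‖1 + q‖ ≤ ‖(1 : ℂ)‖ + ‖q‖ := norm_add_le _ _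
      _ ≤ 2 := by rw [norm_one]; linarith
  have h5 : 1 - Real.exp (π * η) ≤ ‖1 - q‖ := by
    calc 1 - Real.exp (π * η) ≤ ‖(1 : ℂ)‖ - ‖q‖ := by rw [norm_one]; linarith
      _ ≤ _ := norm_sub_norm_le _ _
  have h6 : ‖Complex.I * π / 2‖ = π / 2 := by
    simp [abs_of_pos Real.pi_pos]
  rw [h6]
  calc π / 2 * (‖1 + q‖ / ‖1 - q‖) ≤ π / 2 * (2 / (1 - Real.exp (π * η))) := by
        have : 0 < 1 - Real.exp (π * η) := by linarith
        gcongr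
    _ = _ := by ring

lemma hasSum_halfCot {w : ℂ} (hw : w.im < 0) :
    HasSum (fun n : ℕ => Complex.I * π * Complex.exp (-(Complex.I * π * w)) ^ (n + 1))
      (halfCot w - Complex.I * π / 2) := by
  have h := norm_exp_neg_I_pi_lt_one hw
  rw [halfCot]
  set q := Complex.exp (-(Complex.I * π * w))
  have h1 : 1 - q ≠ 0 := by
    intro h0
    have : q = 1 := by linear_combination -h0
    rw [this] at h; simp at h
  have := (hasSum_geometric_of_norm_lt_one h).mul_left (Complex.I * π * q)
  have e1 : Complex.I * π / 2 * ((1 + q) / (1 - q)) - Complex.I * π / 2 =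
      Complex.I * π * q * (1 - q)⁻¹ := by
    field_simp
    ring
  rw [e1]
  refine this.congr_fun fun n => ?_
  ring

lemma mem_integerComplement_of_im {x : ℂ} (hx : x.im ≠ 0) : x ∈ Complex.integerComplement := by
  rw [Complex.mem_integerComplement_iff]
  rintro ⟨n, rfl⟩
  simp at hx

lemma summable_inv_sub_inv (x y : ℂ) (hx : x.im ≠ 0) (hy : y.im ≠ 0) :
    Summable (fun j : ℤ => 1 / (x + j) - 1 / (y + j)) := by
  have h := (EisensteinSeries.linear_inv_isBigO_right 1 x).mul
    (EisensteinSeries.linear_inv_isBigO_right 1 y)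
  have h2 : Summable (fun j : ℤ => ((j : ℝ))⁻¹ * ((j : ℝ))⁻¹) := by
    have : Summable (fun j : ℤ => 1 / (j : ℝ) ^ 2) := by
      simpa using (Real.summable_one_div_int_pow (p := 2)).2 (by norm_num)
    convert this using 2
    rw [pow_two, one_div, mul_inv]
  have h3 := (summable_of_isBigO h2 h).mul_left (y - x)
  refine h3.congr fun j => ?_
  have hj : ∀ v : ℂ, v.im ≠ 0 → v + j ≠ 0 := by
    intro v hv h0
    apply hv
    have := congrArg Complex.im h0
    simpa using this
  have := hj x hx
  have := hj y hy
  simp only [Int.cast_one, one_mul]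
  field_simp
  ring

lemma hasSum_cot_sub (x y : ℂ) (hx : x.im ≠ 0) (hy : y.im ≠ 0) :
    HasSum (fun j : ℤ => 1 / (x + j) - 1 / (y + j))
      (π * Complex.cot (π * x) - π * Complex.cot (π * y)) := by
  have hs := (summable_inv_sub_inv x y hx hy).hasSum
  set f : ℤ → ℂ := fun j => 1 / (x + j) - 1 / (y + j) with hf
  set a := ∑' j, f j with ha
  have h1 := hs.nat_add_neg
  have h2 := (hasSum_nat_add_iff' 1).2 h1
  have ex := cot_series_rep' (mem_integerComplement_of_im hx)
  have ey := cot_series_rep' (mem_integerComplement_of_im hy)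
  have sum' : ∀ {v : ℂ}, v.im ≠ 0 →
      Summable (fun n : ℕ => 1 / (v - (n + 1)) + 1 / (v + (n + 1))) :=
    fun hv => summable_cotTerm (mem_integerComplement_of_im hv)
  have h3 := (sum' hx).hasSum.sub (sum' hy).hasSum
  rw [← ex, ← ey] at h3
  have h4 := h2.unique (by
    convert h3 using 2 with n
    simp only [hf]; push_cast; ring)
  convert hs using 1
  simp [hf] at h4
  linear_combination -h4

lemma hasSum_halfCot_sub {w v : ℂ} (hw : w.im < 0) (hv : v.im < 0) :
    HasSum (fun j : NZ => 1 / (w + 2 * (j : ℤ)) - 1 / (v + 2 * (j : ℤ)))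
      (halfCot w - halfCot v - (1 / w - 1 / v)) := by
  have h := (hasSum_cot_sub (w / 2) (v / 2) (by simpa using hw.ne) (by simpa using hv.ne)).mul_left
    (1 / 2)
  have h2 : ∀ (u : ℂ) (j : ℤ), 1 / 2 * (1 / (u / 2 + j)) = 1 / (u + 2 * j) := by
    intro u j
    rw [show u + 2 * (j : ℂ) = 2 * (u / 2 + j) by ring, one_div_mul_one_div]
  simp only [mul_sub, h2] at h
  have h3 := hasSum_nonzero h
  convert h3 using 1
  rw [halfCot_eq_cot, halfCot_eq_cot]
  push_cast
  ring

section ChangeOfVariables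

variable {E : Type*} [NormedAddCommGroup E] [NormedSpace ℝ E] {β : ℝ}

lemma image_neg_div (hβ : 0 < β) : (fun s : ℝ => -β / s) '' {0}ᶜ = {0}ᶜ := by
  ext t
  constructor
  · rintro ⟨s, hs, rfl⟩
    have : s ≠ 0 := hs
    simp only [mem_compl_iff, mem_singleton_iff]
    exact div_ne_zero (neg_ne_zero.2 hβ.ne') this
  · intro ht
    have ht : t ≠ 0 := ht
    refine ⟨-β / t, div_ne_zero (neg_ne_zero.2 hβ.ne') ht, ?_⟩
    field_simp

lemma injOn_neg_div (hβ : 0 < β) : InjOn (fun s : ℝ => -β / s) {0}ᶜ := by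
  intro s hs t ht h
  have hs : s ≠ 0 := hs
  have ht : t ≠ 0 := ht
  simp only at h
  field_simp at h
  linarith

lemma hasDerivWithinAt_neg_div (s : ℝ) (hs : s ∈ ({0}ᶜ : Set ℝ)) :
    HasDerivWithinAt (fun s : ℝ => -β / s) (β / s ^ 2) {0}ᶜ s := by
  have h0 : s ≠ 0 := hs
  have := (hasDerivAt_inv h0).const_mul (-β)
  refine (this.congr_deriv ?_).hasDerivWithinAt
  ring

lemma abs_deriv_neg_div (hβ : 0 < β) (s : ℝ) : |β / s ^ 2| = β / s ^ 2 :=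
  abs_of_nonneg (by positivity)

lemma restrict_compl_zero : (volume : Measure ℝ).restrict {0}ᶜ = volume :=
  Measure.restrict_eq_self_of_ae_mem (by
    have : volume ({0} : Set ℝ) = 0 := by simp
    exact compl_mem_ae_iff.2 this)

/-- The change of variables `t = -β / s` on the real line. -/
lemma integral_neg_div (hβ : 0 < β) (φ : ℝ → E) :
    ∫ t, φ t = ∫ s, (β / s ^ 2) • φ (-β / s) := by
  have := integral_image_eq_integral_abs_deriv_smul (measurableSet_singleton (0 : ℝ)).compl
    hasDerivWithinAt_neg_div (injOn_neg_div hβ) φ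
  rw [image_neg_div hβ, restrict_compl_zero] at this
  rw [this]
  simp only [abs_deriv_neg_div hβ]

lemma integrable_neg_div (hβ : 0 < β) (φ : ℝ → E) :
    Integrable φ ↔ Integrable (fun s => (β / s ^ 2) • φ (-β / s)) := by
  have := integrableOn_image_iff_integrableOn_abs_deriv_smul
    (measurableSet_singleton (0 : ℝ)).compl
    hasDerivWithinAt_neg_div (injOn_neg_div hβ) φ
  rw [image_neg_div hβ, IntegrableOn, IntegrableOn, restrict_compl_zero] at this
  rw [this]
  simp only [abs_deriv_neg_div hβ]

lemma iUnion_Ico_nonzero :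
    ⋃ j : NZ, Ico (-1 + 2 * ((j : ℤ) : ℝ)) (1 + 2 * ((j : ℤ) : ℝ)) = (Ico (-1 : ℝ) 1)ᶜ := by
  ext u
  simp only [mem_iUnion, mem_Ico, mem_compl_iff]
  constructor
  · rintro ⟨⟨j, hj⟩, h1, h2⟩ ⟨h3, h4⟩
    simp only at h1 h2
    have a1 : (j : ℝ) < 1 := by linarith
    have a2 : (-1 : ℝ) < j := by linarith
    have a1 : j < 1 := by exact_mod_cast a1
    have a2 : -1 < j := by exact_mod_cast a2
    omega
  · intro h
    refine ⟨⟨⌊(u + 1) / 2⌋, ?_⟩, ?_, ?_⟩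
    · intro h0
      rw [Int.floor_eq_iff] at h0
      apply h
      push_cast at h0
      constructor <;> linarith [h0.1, h0.2]
    · have := Int.floor_le ((u + 1) / 2)
      simp only; linarith
    · have := Int.lt_floor_add_one ((u + 1) / 2)
      simp only; linarith

lemma pairwise_disjoint_Ico_nonzero :
    Pairwise (Function.onFun Disjoint
      (fun j : NZ => Ico (-1 + 2 * ((j : ℤ) : ℝ)) (1 + 2 * ((j : ℤ) : ℝ)))) := by
  intro i j hij
  rw [Function.onFun, Set.disjoint_left]
  rintro u ⟨h1, h2⟩ ⟨h3, h4⟩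
  apply hij
  have a1 : ((i : ℤ) : ℝ) < (j : ℤ) + 1 := by linarith
  have a2 : ((j : ℤ) : ℝ) < (i : ℤ) + 1 := by linarith
  have a1 : (i : ℤ) < (j : ℤ) + 1 := by exact_mod_cast a1
  have a2 : (j : ℤ) < (i : ℤ) + 1 := by exact_mod_cast a2
  exact Subtype.ext (by omega)

lemma hasSum_integral_Ico {φ : ℝ → E} (h : IntegrableOn φ (Ico (-1 : ℝ) 1)ᶜ) :
    HasSum (fun j : NZ => ∫ x in Ico (-1 : ℝ) 1, φ (x + 2 * (j : ℤ)))
      (∫ x in (Ico (-1 : ℝ) 1)ᶜ, φ x) := by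
  rw [← iUnion_Ico_nonzero] at h ⊢
  refine (hasSum_integral_iUnion (fun j => measurableSet_Ico) pairwise_disjoint_Ico_nonzero
    h).congr_fun fun j => ?_
  have hm := measurePreserving_add_right (volume : Measure ℝ) (2 * ((j : ℤ) : ℝ))
  have := hm.setIntegral_preimage_emb (measurableEmbedding_addRight _) φ
    (Ico (-1 + 2 * ((j : ℤ) : ℝ)) (1 + 2 * ((j : ℤ) : ℝ)))
  rw [← this]
  simp

lemma indicator_neg_div_ae (hβ : 0 < β) (φ : ℝ → E) :
    (fun s => (β / s ^ 2) • (Ioo (-β) β).indicator φ (-β / s)) =ᵐ[volume]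
      (Ico (-1 : ℝ) 1)ᶜ.indicator (fun s => (β / s ^ 2) • φ (-β / s)) := by
  have h1 : ∀ᵐ s : ℝ, s ≠ 1 := by
    have : volume ({1} : Set ℝ) = 0 := by simp
    exact compl_mem_ae_iff.2 this
  filter_upwards [h1] with s hs
  by_cases h0 : s = 0
  · subst h0; simp
  have key : -β / s ∈ Ioo (-β) β ↔ s ∈ (Ico (-1 : ℝ) 1)ᶜ := by
    rw [mem_Ioo, ← abs_lt, abs_div, abs_neg, abs_of_pos hβ, div_lt_iff₀ (abs_pos.2 h0)]
    have : β < β * |s| ↔ 1 < |s| := by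
      constructor <;> intro h <;> nlinarith
    rw [this, lt_abs, mem_compl_iff, mem_Ico, not_and_or, not_le, not_lt]
    constructor
    · rintro (h | h)
      · right; linarith
      · left; linarith
    · rintro (h | h)
      · right; linarith
      · rcases h.lt_or_eq with h | h
        · left; exact h
        · exact absurd h.symm hs
  by_cases h : s ∈ (Ico (-1 : ℝ) 1)ᶜ
  · rw [indicator_of_mem h, indicator_of_mem (key.2 h)]
  · rw [indicator_of_notMem h, indicator_of_notMem (fun h' => h (key.1 h')), smul_zero]

/-- Unfolding of an integral over `(-β, β)` along the branches `x ↦ -β / (x + 2 j)`. -/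
lemma hasSum_integral_branches (hβ : 0 < β) {φ : ℝ → E} (h : IntegrableOn φ (Ioo (-β) β)) :
    HasSum (fun j : NZ => ∫ x in Ico (-1 : ℝ) 1,
        (β / (x + 2 * (j : ℤ)) ^ 2) • φ (-β / (x + 2 * (j : ℤ))))
      (∫ v in Ioo (-β) β, φ v) := by
  have h2 : IntegrableOn (fun s => (β / s ^ 2) • φ (-β / s)) (Ico (-1 : ℝ) 1)ᶜ := by
    rw [← integrable_indicator_iff measurableSet_Ico.compl]
    rw [← integrable_indicator_iff measurableSet_Ioo, integrable_neg_div hβ] at h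
    exact h.congr (indicator_neg_div_ae hβ φ)
  have h3 := hasSum_integral_Ico h2
  convert h3 using 1
  rw [← integral_indicator measurableSet_Ioo, ← integral_indicator measurableSet_Ico.compl,
    integral_neg_div hβ]
  exact integral_congr_ae (indicator_neg_div_ae hβ φ)

end ChangeOfVariables

/-- Reduction of a real number modulo `2` to `[-1, 1)`. -/
noncomputable def red (x : ℝ) : ℝ := x - 2 * ⌊(x + 1) / 2⌋

/-- The Gauss-type map `t ↦ -β / t` modulo `2`. -/
noncomputable def tau (β t : ℝ) : ℝ := red (-β / t)

/-- The inverse branches of the Gauss-type map. -/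
noncomputable def branch (β : ℝ) (j : NZ) (z : ℂ) : ℂ := -β / (z + 2 * (j : ℤ))

/-- The transfer operator of the Gauss-type map, on functions on the unit disc. -/
noncomputable def transfer (β : ℝ) (h : ℂ → ℂ) (z : ℂ) : ℂ :=
  ∑' j : NZ, β / (z + 2 * (j : ℤ)) ^ 2 * h (branch β j z)

/-- The signed indicator function of the interval between `0` and `t`. -/
noncomputable def seg (t y : ℝ) : ℝ := (if y < t then 1 else 0) - (if y < 0 then 1 else 0)

/-- The holomorphic function on the unit disc with density `θ` on `(-β, β)`. -/
noncomputable def disk (β : ℝ) (θ : ℝ → ℂ) (z : ℂ) : ℂ :=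
  ∫ y in Ioo (-β) β, θ y * (β / (β + y * z) ^ 2)

/-- Composition with the Gauss-type map, cut off to `(-β, β)`. -/
noncomputable def koop (β : ℝ) (θ : ℝ → ℂ) (y : ℝ) : ℂ :=
  if |tau β y| < β then θ (tau β y) else 0

@[fun_prop]
lemma measurable_red : Measurable red := by
  unfold red
  fun_prop

@[fun_prop]
lemma measurable_tau (β : ℝ) : Measurable (tau β) := by
  unfold tau
  exact measurable_red.comp (by fun_prop)

lemma red_mem (x : ℝ) : red x ∈ Ico (-1 : ℝ) 1 := by
  have h1 := Int.floor_le ((x + 1) / 2)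
  have h2 := Int.lt_floor_add_one ((x + 1) / 2)
  constructor <;> unfold red <;> linarith

lemma tau_mem (β t : ℝ) : tau β t ∈ Ico (-1 : ℝ) 1 := red_mem _

lemma red_add_two_mul {x : ℝ} (hx : x ∈ Ico (-1 : ℝ) 1) (j : ℤ) : red (x + 2 * j) = x := by
  have : ⌊(x + 2 * j + 1) / 2⌋ = j := by
    rw [Int.floor_eq_iff]
    constructor <;> linarith [hx.1, hx.2]
  unfold red
  rw [this]; ring

lemma add_two_mul_ne_zero {x : ℝ} (hx : x ∈ Ico (-1 : ℝ) 1) (j : NZ) :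
    x + 2 * ((j : ℤ) : ℝ) ≠ 0 := by
  intro h
  have a1 : (((j : ℤ)) : ℝ) < 1 := by linarith [hx.1, hx.2]
  have a2 : (-1 : ℝ) < (j : ℤ) := by linarith [hx.1, hx.2]
  have a1 : (j : ℤ) < 1 := by exact_mod_cast a1
  have a2 : -1 < (j : ℤ) := by exact_mod_cast a2
  exact j.2 (by omega)

lemma tau_branch {β : ℝ} (hβ : 0 < β) {x : ℝ} (hx : x ∈ Ico (-1 : ℝ) 1) (j : NZ) :
    tau β (-β / (x + 2 * (j : ℤ))) = x := by
  have h := add_two_mul_ne_zero hx j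
  have : -β / (-β / (x + 2 * ((j : ℤ) : ℝ))) = x + 2 * (j : ℤ) := by field_simp
  rw [tau, this, red_add_two_mul hx]

lemma one_le_abs (j : NZ) : (1 : ℝ) ≤ |((j : ℤ) : ℝ)| := by
  have := Int.one_le_abs j.2
  exact_mod_cast this

lemma norm_add_two_mul_ge (z : ℂ) (j : NZ) :
    (2 - ‖z‖) * |((j : ℤ) : ℝ)| ≤ ‖z + 2 * ((j : ℤ) : ℂ)‖ := by
  have h1 := one_le_abs j
  have h2 : ‖(2 : ℂ) * ((j : ℤ) : ℂ)‖ = 2 * |((j : ℤ) : ℝ)| := by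
    rw [norm_mul]; simp
  have h3 := norm_sub_norm_le (2 * ((j : ℤ) : ℂ)) (-z)
  rw [sub_neg_eq_add, norm_neg, h2, add_comm] at h3
  nlinarith [norm_nonneg z]

lemma abs_le_norm_add_two_mul (z : ℂ) (hz : ‖z‖ < 1) (j : NZ) :
    |((j : ℤ) : ℝ)| ≤ ‖z + 2 * ((j : ℤ) : ℂ)‖ := by
  have h := norm_add_two_mul_ge z j
  have h1 := one_le_abs j
  nlinarith

lemma add_two_mul_ne_zero' {z : ℂ} (hz : ‖z‖ < 1) (j : NZ) : z + 2 * ((j : ℤ) : ℂ) ≠ 0 := by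
  have h := abs_le_norm_add_two_mul z hz j
  have h1 := one_le_abs j
  rw [← norm_pos_iff]; linarith

lemma norm_branch_le {β : ℝ} (hβ : 0 < β) (hβ1 : β ≤ 1) {z : ℂ} (hz : ‖z‖ < 1) (j : NZ) :
    ‖branch β j z‖ ≤ 1 / (2 - ‖z‖) := by
  have h := norm_add_two_mul_ge z j
  have h1 := one_le_abs j
  have h2 : 0 < 2 - ‖z‖ := by linarith
  rw [branch, norm_div, norm_neg, Complex.norm_real, Real.norm_eq_abs, abs_of_pos hβ]
  have h3 : 2 - ‖z‖ ≤ ‖z + 2 * ((j : ℤ) : ℂ)‖ := by nlinarith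
  gcongr

lemma norm_branch_lt {β : ℝ} (hβ : 0 < β) (hβ1 : β ≤ 1) {z : ℂ} (hz : ‖z‖ < 1) (j : NZ) :
    ‖branch β j z‖ < 1 := by
  refine (norm_branch_le hβ hβ1 hz j).trans_lt ?_
  rw [div_lt_one] <;> linarith

lemma branch_im {β : ℝ} (z : ℂ) (j : NZ) :
    (branch β j z).im = β * z.im / Complex.normSq (z + 2 * (j : ℤ)) := by
  rw [branch, Complex.div_im]
  simp
  ring

lemma branch_im_neg {β : ℝ} (hβ : 0 < β) {z : ℂ} (hz : ‖z‖ < 1) (hi : z.im < 0) (j : NZ) :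
    (branch β j z).im < 0 := by
  rw [branch_im]
  apply div_neg_of_neg_of_pos (mul_neg_of_pos_of_neg hβ hi)
  exact Complex.normSq_pos.2 (add_two_mul_ne_zero' hz j)

lemma norm_weight_le {β : ℝ} (hβ : 0 < β) (hβ1 : β ≤ 1) {z : ℂ} (hz : ‖z‖ < 1) (j : NZ) :
    ‖(β : ℂ) / (z + 2 * (j : ℤ)) ^ 2‖ ≤ 1 / ((j : ℤ) : ℝ) ^ 2 := by
  have h := abs_le_norm_add_two_mul z hz j
  have h1 := one_le_abs j
  rw [norm_div, norm_pow, Complex.norm_real, Real.norm_eq_abs, abs_of_pos hβ,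
    ← sq_abs ((j : ℤ) : ℝ)]
  gcongr

lemma norm_beta_add_ge {β : ℝ} (hβ : 0 < β) {y : ℝ} (hy : |y| ≤ β) (z : ℂ) :
    β * (1 - ‖z‖) ≤ ‖(β : ℂ) + y * z‖ := by
  have h := norm_sub_norm_le (β : ℂ) (-(y * z))
  rw [sub_neg_eq_add, norm_neg, norm_mul, Complex.norm_real, Complex.norm_real,
    Real.norm_eq_abs, Real.norm_eq_abs, abs_of_pos hβ] at h
  nlinarith [norm_nonneg z]

lemma beta_add_ne_zero {β : ℝ} (hβ : 0 < β) {y : ℝ} (hy : |y| ≤ β) {z : ℂ} (hz : ‖z‖ < 1) :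
    (β : ℂ) + y * z ≠ 0 := by
  have := norm_beta_add_ge hβ hy z
  rw [← norm_pos_iff]
  have h2 : 0 < β * (1 - ‖z‖) := mul_pos hβ (by linarith)
  linarith

lemma norm_kernel_le {β : ℝ} (hβ : 0 < β) {y : ℝ} (hy : |y| ≤ β) {z : ℂ} (hz : ‖z‖ < 1) :
    ‖(β : ℂ) / (β + y * z) ^ 2‖ ≤ 1 / (β * (1 - ‖z‖) ^ 2) := by
  have h := norm_beta_add_ge hβ hy z
  have h2 : 0 < 1 - ‖z‖ := by linarith
  rw [norm_div, norm_pow, Complex.norm_real, Real.norm_eq_abs, abs_of_pos hβ]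
  calc β / ‖(β : ℂ) + y * z‖ ^ 2 ≤ β / (β * (1 - ‖z‖)) ^ 2 := by gcongr
    _ = _ := by field_simp

lemma integrableOn_bounded {θ : ℝ → ℂ} (hm : Measurable θ) {R : ℝ} {s : Set ℝ}
    (hs : MeasurableSet s) (hsf : volume s < ⊤) (hR : ∀ y ∈ s, ‖θ y‖ ≤ R) :
    IntegrableOn θ s :=
  Measure.integrableOn_of_bounded hsf.ne hm.aestronglyMeasurable
    (M := R) (by
      rw [ae_restrict_iff' hs]
      exact Eventually.of_forall hR)

lemma mem_Ioo_abs {β y : ℝ} (hy : y ∈ Ioo (-β) β) : |y| ≤ β := (abs_lt.2 hy).le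

lemma integrableOn_disk {β : ℝ} (hβ : 0 < β) {θ : ℝ → ℂ} (hm : Measurable θ) {R : ℝ}
    (hR : ∀ y, ‖θ y‖ ≤ R) {z : ℂ} (hz : ‖z‖ < 1) :
    IntegrableOn (fun y : ℝ => θ y * (β / (β + y * z) ^ 2)) (Ioo (-β) β) := by
  refine integrableOn_bounded (by fun_prop) measurableSet_Ioo (by simp)
    (R := R * (1 / (β * (1 - ‖z‖) ^ 2))) fun y hy => ?_
  rw [norm_mul]
  exact mul_le_mul (hR y) (norm_kernel_le hβ (mem_Ioo_abs hy) hz) (norm_nonneg _)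
    ((norm_nonneg _).trans (hR 0))

lemma hasSum_disk_tau {β : ℝ} (hβ : 0 < β) {ψ : ℝ → ℂ} (hm : Measurable ψ)
    {R : ℝ} (hR : ∀ y, ‖ψ y‖ ≤ R) {z : ℂ} (hz : ‖z‖ < 1) :
    HasSum (fun j : NZ => ∫ x in Ico (-1 : ℝ) 1, ψ x / (x + 2 * (j : ℤ) - z) ^ 2)
      (disk β (fun y => ψ (tau β y)) z) := by
  have h := hasSum_integral_branches hβ (integrableOn_disk hβ
    (hm.comp (measurable_tau β)) (fun y => hR (tau β y)) hz)
  refine h.congr_fun fun j => ?_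
  refine setIntegral_congr_fun measurableSet_Ico fun x hx => ?_
  have h0 := add_two_mul_ne_zero hx j
  have h1 : ((x : ℂ) + 2 * (j : ℤ)) ≠ 0 := by exact_mod_cast h0
  simp only [Function.comp, tau_branch hβ hx]
  rw [Complex.real_smul]
  push_cast
  by_cases h3 : (x : ℂ) + 2 * (j : ℤ) - z = 0
  · have h4 : (β : ℂ) + -β / (x + 2 * (j : ℤ)) * z = 0 := by
      rw [← sub_eq_zero.1 h3]; field_simp; ring
    rw [h3, h4]; simp
  · have hb : (β : ℂ) ≠ 0 := by exact_mod_cast hβ.ne'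
    have h4 : (β : ℂ) + -β / (x + 2 * (j : ℤ)) * z =
        β * (x + 2 * (j : ℤ) - z) / (x + 2 * (j : ℤ)) := by
      field_simp; ring
    rw [h4]
    field_simp

lemma measurable_koop {β : ℝ} {θ : ℝ → ℂ} (hm : Measurable θ) : Measurable (koop β θ) := by
  unfold koop
  refine Measurable.ite ?_ (hm.comp (measurable_tau β)) measurable_const
  exact measurableSet_lt (by fun_prop) measurable_const

lemma norm_koop_le {β : ℝ} {θ : ℝ → ℂ} {R : ℝ} (hR : ∀ y, ‖θ y‖ ≤ R) (y : ℝ) :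
    ‖koop β θ y‖ ≤ R := by
  unfold koop
  split_ifs
  · exact hR _
  · simpa using (norm_nonneg _).trans (hR 0)

/-- Negation of nonzero integers. -/
def negNZ : NZ ≃ NZ where
  toFun j := ⟨-j, neg_ne_zero.2 j.2⟩
  invFun j := ⟨-j, neg_ne_zero.2 j.2⟩
  left_inv j := by simp
  right_inv j := by simp

lemma coe_negNZ (j : NZ) : (negNZ j : ℤ) = -(j : ℤ) := rfl

lemma hasSum_transfer_disk {β : ℝ} (hβ : 0 < β) (hβ1 : β ≤ 1) {θ : ℝ → ℂ} (hm : Measurable θ)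
    {R : ℝ} (hR : ∀ y, ‖θ y‖ ≤ R) {z : ℂ} (hz : ‖z‖ < 1) :
    HasSum (fun j : NZ => β / (z + 2 * (j : ℤ)) ^ 2 * disk β θ (branch β j z))
      (disk β (koop β θ) z) := by
  have hR0 : 0 ≤ R := (norm_nonneg _).trans (hR 0)
  have h := hasSum_disk_tau hβ (ψ := fun x => if |x| < β then θ x else 0)
    (Measurable.ite (measurableSet_lt (by fun_prop) measurable_const) hm measurable_const)
    (R := R) (fun y => by split_ifs; exacts [hR y, by simpa using hR0]) hz
  have h2 := negNZ.hasSum_iff.2 h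
  refine h2.congr_fun fun j => ?_
  have e1 : ∫ x in Ico (-1 : ℝ) 1, (if |x| < β then θ x else 0) /
        ((x : ℂ) + 2 * ((negNZ j : ℤ) : ℂ) - z) ^ 2 =
      ∫ x in Ioo (-β) β, θ x / ((x : ℂ) + 2 * ((negNZ j : ℤ) : ℂ) - z) ^ 2 := by
    have hsub : Ioo (-β) β ⊆ Ico (-1 : ℝ) 1 :=
      fun x hx => ⟨by linarith [hx.1], by linarith [hx.2]⟩
    rw [← integral_indicator measurableSet_Ico, ← integral_indicator measurableSet_Ioo]
    congr 1
    ext x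
    by_cases hx : x ∈ Ioo (-β) β
    · rw [indicator_of_mem hx, indicator_of_mem (hsub hx), if_pos (abs_lt.2 hx)]
    · rw [indicator_of_notMem hx]
      have : ¬ |x| < β := fun h' => hx (abs_lt.1 h')
      simp [indicator, this]
  simp only [Function.comp]
  rw [e1, disk, ← integral_const_mul]
  refine setIntegral_congr_fun measurableSet_Ioo fun y hy => ?_
  have h0 := add_two_mul_ne_zero' hz j
  have hb : (β : ℂ) ≠ 0 := by exact_mod_cast hβ.ne'
  have h4 : (β : ℂ) + y * branch β j z = β * (z + 2 * (j : ℤ) - y) / (z + 2 * (j : ℤ)) := by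
    unfold branch; field_simp; ring
  have h5 : (β : ℂ) + y * branch β j z ≠ 0 :=
    beta_add_ne_zero hβ (mem_Ioo_abs hy) (norm_branch_lt hβ hβ1 hz j)
  have h6 : z + 2 * (j : ℤ) - (y : ℂ) ≠ 0 := by
    intro h; rw [h4, h] at h5; simp at h5
  have h7 : ((y : ℂ) + 2 * ((negNZ j : ℤ) : ℂ) - z) = -(z + 2 * (j : ℤ) - y) := by
    rw [coe_negNZ]; push_cast; ring
  rw [h4, h7, neg_sq]
  field_simp

lemma transfer_disk {β : ℝ} (hβ : 0 < β) (hβ1 : β ≤ 1) {θ : ℝ → ℂ} (hm : Measurable θ)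
    {R : ℝ} (hR : ∀ y, ‖θ y‖ ≤ R) {z : ℂ} (hz : ‖z‖ < 1) :
    transfer β (disk β θ) z = disk β (koop β θ) z :=
  (hasSum_transfer_disk hβ hβ1 hm hR hz).tsum_eq

/-- The sum over `j ≠ 0` of `1 / (z + 2 j) - 1 / (z + 2 j - s)`, in closed form. -/
noncomputable def polar (s z : ℂ) : ℂ :=
  halfCot z - halfCot (z - s) - (1 / z - 1 / (z - s))

lemma hasSum_polar {s z : ℂ} (hz : z.im < 0) (hs : 0 ≤ s.im) :
    HasSum (fun j : NZ => 1 / (z + 2 * (j : ℤ)) - 1 / (z - s + 2 * (j : ℤ))) (polar s z) :=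
  hasSum_halfCot_sub hz (by rw [Complex.sub_im]; linarith)

lemma ne_zero_of_im_neg {z : ℂ} (hz : z.im < 0) : z ≠ 0 := by
  rintro rfl; simp at hz

lemma neg_div_im_nonneg {β : ℝ} (hβ : 0 < β) {t : ℂ} (ht : 0 ≤ t.im) :
    0 ≤ (-β / t : ℂ).im := by
  rw [Complex.div_im]
  simp only [Complex.neg_im, Complex.ofReal_im, neg_zero, zero_mul, zero_div, Complex.neg_re,
    Complex.ofReal_re, zero_sub, neg_mul, neg_div, neg_neg]
  exact div_nonneg (mul_nonneg hβ.le ht) (Complex.normSq_nonneg _)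

lemma hasSum_transfer_inv {β : ℝ} (hβ : 0 < β) {t z : ℂ} (ht0 : t ≠ 0) (ht : 0 ≤ t.im)
    (hz : ‖z‖ < 1) (hi : z.im < 0) :
    HasSum (fun j : NZ => β / (z + 2 * (j : ℤ)) ^ 2 * (1 / (t - branch β j z)))
      (polar (-β / t) z) := by
  refine (hasSum_polar hi (neg_div_im_nonneg hβ ht)).congr_fun fun j => ?_
  have h0 := add_two_mul_ne_zero' hz j
  have h1 : t - branch β j z ≠ 0 := by
    intro h
    have h2 := congrArg Complex.im h
    have h3 := branch_im_neg hβ hz hi j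
    simp at h2
    linarith
  have h3 : z - -β / t + 2 * ((j : ℤ) : ℂ) = z + 2 * ((j : ℤ) : ℂ) + β / t := by ring
  rw [h3]
  unfold branch at h1 ⊢
  generalize z + 2 * ((j : ℤ) : ℂ) = A at h0 h1
  have h4 : t - -β / A = (A * t + β) / A := by field_simp; ring
  have h5 : A * t + β ≠ 0 := by
    intro h; rw [h4, h] at h1; simp at h1
  have h6 : A + β / t = (A * t + β) / t := by field_simp
  rw [h4, h6]
  field_simp
  ring

@[fun_prop]
lemma measurable_seg (t : ℝ) : Measurable (seg t) := by
  unfold seg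
  exact (Measurable.ite measurableSet_Iio measurable_const measurable_const).sub
    (Measurable.ite measurableSet_Iio measurable_const measurable_const)

lemma abs_seg_le (t y : ℝ) : |seg t y| ≤ 1 := by
  unfold seg
  split_ifs <;> simp

lemma norm_seg_le (t y : ℝ) : ‖((seg t y : ℝ) : ℂ)‖ ≤ 1 := by
  rw [Complex.norm_real]; exact abs_seg_le t y

lemma integral_seg {s : Set ℝ} (hs : MeasurableSet s) {t : ℝ} (h1 : Ico 0 t ⊆ s)
    (h2 : Ico t 0 ⊆ s) (φ : ℝ → ℂ) :
    ∫ y in s, ((seg t y : ℝ) : ℂ) * φ y = ∫ y in (0 : ℝ)..t, φ y := by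
  rw [← integral_indicator hs]
  rcases le_total 0 t with h | h
  · rw [intervalIntegral.integral_of_le h, ← integral_Ico_eq_integral_Ioc,
      ← integral_indicator measurableSet_Ico]
    congr 1
    ext y
    by_cases hy : y ∈ Ico 0 t
    · rw [indicator_of_mem hy, indicator_of_mem (h1 hy), seg, if_pos hy.2, if_neg (not_lt.2 hy.1)]
      simp
    · rw [indicator_of_notMem hy]
      have : seg t y = 0 := by
        unfold seg
        rw [mem_Ico, not_and_or, not_le, not_lt] at hy
        split_ifs <;> first | (exfalso; rcases hy with hy | hy <;> linarith) | norm_num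
      simp [indicator, this]
  · rw [intervalIntegral.integral_of_ge h, ← integral_Ico_eq_integral_Ioc, ← integral_neg,
      ← integral_indicator measurableSet_Ico]
    congr 1
    ext y
    by_cases hy : y ∈ Ico t 0
    · rw [indicator_of_mem hy, indicator_of_mem (h2 hy), seg, if_pos hy.2, if_neg (not_lt.2 hy.1)]
      simp
    · rw [indicator_of_notMem hy]
      have : seg t y = 0 := by
        unfold seg
        rw [mem_Ico, not_and_or, not_le, not_lt] at hy
        split_ifs <;> first | (exfalso; rcases hy with hy | hy <;> linarith) | norm_num
      simp [indicator, this]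

lemma disk_seg {β : ℝ} (hβ : 0 < β) {t : ℝ} (ht : |t| ≤ β) {z : ℂ} (hz : ‖z‖ < 1) :
    disk β (fun y => (seg t y : ℝ)) z = t / (β + t * z) := by
  have ht' := abs_le.1 ht
  have hIoo : ∫ y in Ioo (-β) β, ((seg t y : ℝ) : ℂ) * (β / (β + y * z) ^ 2) =
      ∫ y in Ico (-β) β, ((seg t y : ℝ) : ℂ) * (β / (β + y * z) ^ 2) :=
    (setIntegral_congr_set Ioo_ae_eq_Ico)
  rw [disk, hIoo, integral_seg measurableSet_Ico (Ico_subset_Ico (by linarith) ht'.2)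
    (Ico_subset_Ico ht'.1 hβ.le)]
  have hne : ∀ y ∈ uIcc 0 t, (β : ℂ) + y * z ≠ 0 := by
    intro y hy
    refine beta_add_ne_zero hβ ?_ hz
    rcases le_total 0 t with h | h
    · rw [uIcc_of_le h] at hy; rw [abs_le]; constructor <;> linarith [hy.1, hy.2]
    · rw [uIcc_of_ge h] at hy; rw [abs_le]; constructor <;> linarith [hy.1, hy.2]
  rw [intervalIntegral.integral_eq_sub_of_hasDerivAt
    (f := fun y : ℝ => (y : ℂ) / (β + y * z))]
  · simp
  · intro y hy
    have h0 := hne y hy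
    have h1 : HasDerivAt (fun y : ℝ => (y : ℂ)) 1 y := Complex.ofRealCLM.hasDerivAt
    have h2 : HasDerivAt (fun y : ℝ => (β : ℂ) + y * z) (1 * z) y := (h1.mul_const z).const_add _
    refine (h1.div h2 h0).congr_deriv ?_
    ring
  · apply ContinuousOn.intervalIntegrable
    apply ContinuousOn.div continuousOn_const (by fun_prop)
    intro y hy
    exact pow_ne_zero 2 (hne y hy)

lemma disk_seg_tau {β : ℝ} (hβ : 0 < β) {u : ℝ} (hu : u ∈ Ico (-1 : ℝ) 1) {z : ℂ} (hz : ‖z‖ < 1)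
    (hi : z.im < 0) :
    disk β (fun y => (seg u (tau β y) : ℝ)) z = -polar u z := by
  have h := hasSum_disk_tau hβ (ψ := fun y => ((seg u y : ℝ) : ℂ))
    (Complex.measurable_ofReal.comp (measurable_seg u)) (norm_seg_le u) hz
  have h2 := negNZ.hasSum_iff.2 h
  have h3 := (hasSum_polar (s := u) hi (by simp)).neg
  refine h2.unique (h3.congr_fun fun j => ?_)
  simp only [Function.comp, coe_negNZ, div_eq_mul_inv]
  rw [integral_seg measurableSet_Ico (Ico_subset_Ico (by norm_num) hu.2.le)
    (Ico_subset_Ico hu.1 (by norm_num))]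
  have hne : ∀ y : ℝ, (y : ℂ) + 2 * ((-(j : ℤ) : ℤ) : ℂ) - z ≠ 0 := by
    intro y h0
    have := congrArg Complex.im h0
    simp at this
    linarith
  rw [intervalIntegral.integral_eq_sub_of_hasDerivAt
    (f := fun y : ℝ => -((y : ℂ) + 2 * ((-(j : ℤ) : ℤ) : ℂ) - z)⁻¹)]
  · have e1 : z + 2 * ((j : ℤ) : ℂ) = -(((0 : ℝ) : ℂ) + 2 * ((-(j : ℤ) : ℤ) : ℂ) - z) := by
      push_cast; ring
    have e2 : z - u + 2 * ((j : ℤ) : ℂ) = -((u : ℂ) + 2 * ((-(j : ℤ) : ℤ) : ℂ) - z) := by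
      push_cast; ring
    rw [e1, e2, inv_neg, inv_neg]
    ring
  · intro y hy
    have h1 : HasDerivAt (fun y : ℝ => (y : ℂ)) 1 y := Complex.ofRealCLM.hasDerivAt
    have h2 := (((h1.add_const (2 * ((-(j : ℤ) : ℤ) : ℂ))).sub_const z).inv (hne y)).neg
    refine h2.congr_deriv ?_
    ring
  · apply Continuous.intervalIntegrable
    apply Continuous.inv₀ (by fun_prop)
    intro y
    exact pow_ne_zero 2 (hne y)

/-- The correction density produced by one application of the transfer operator to `1 / (t - z)`. -/
noncomputable def corr (β t y : ℝ) : ℝ :=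
  (if |t| < β then seg t y else 0) - seg (tau β t) (tau β y)

lemma polar_eq_add_disk {β : ℝ} (hβ : 0 < β) {t : ℝ} (ht0 : t ≠ 0) (htβ : |t| ≠ β)
    {z : ℂ} (hz : ‖z‖ < 1) (hi : z.im < 0) :
    polar ((-β / t : ℝ) : ℂ) z =
      (if |t| < β then 1 / ((tau β t : ℝ) - z) else 0) +
        disk β (fun y => (corr β t y : ℝ)) z := by
  have hu := tau_mem β t
  have e1 : disk β (fun y => (corr β t y : ℝ)) z =
      (if |t| < β then disk β (fun y => (seg t y : ℝ)) z else 0) -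
        disk β (fun y => (seg (tau β t) (tau β y) : ℝ)) z := by
    have i1 := integrableOn_disk hβ (θ := fun y => ((seg t y : ℝ) : ℂ)) (by fun_prop)
      (norm_seg_le t) hz
    have i2 := integrableOn_disk hβ (θ := fun y => ((seg (tau β t) (tau β y) : ℝ) : ℂ))
      (Complex.measurable_ofReal.comp ((measurable_seg _).comp (measurable_tau β)))
      (fun y => norm_seg_le _ _) hz
    split_ifs with h
    · unfold disk
      rw [← integral_sub i1 i2]
      simp only [corr, if_pos h]
      push_cast
      simp only [sub_mul]
    · unfold disk
      rw [zero_sub, ← integral_neg]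
      simp only [corr, if_neg h]
      push_cast
      simp only [zero_sub, neg_mul]
  rw [e1, disk_seg_tau hβ hu hz hi]
  split_ifs with h
  · rw [disk_seg hβ h.le hz]
    have h1 : halfCot (z - ((-β / t : ℝ) : ℂ)) = halfCot (z - (tau β t : ℝ)) := by
      rw [← halfCot_add_int (z - ((-β / t : ℝ) : ℂ)) ⌊(-β / t + 1) / 2⌋]
      congr 1
      unfold tau red
      push_cast
      ring
    have h2 := beta_add_ne_zero hβ h.le hz
    have ht : (t : ℂ) ≠ 0 := by exact_mod_cast ht0
    have h3 : 1 / (z - ((-β / t : ℝ) : ℂ)) = t / (β + t * z) := by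
      push_cast
      have : z - -(β : ℂ) / t = (β + t * z) / t := by field_simp; ring
      rw [this]
      field_simp
    have h4 : 1 / (((tau β t : ℝ) : ℂ) - z) = - (1 / (z - (tau β t : ℝ))) := by
      rw [← neg_sub z, one_div, one_div, inv_neg]
    rw [polar, polar, h1, h3, h4]
    ring
  · have h1 : tau β t = -β / t := by
      have h2 : |(-β / t)| < 1 := by
        rw [abs_div, abs_neg, abs_of_pos hβ, div_lt_one (abs_pos.2 ht0)]
        exact lt_of_le_of_ne (not_lt.1 h) htβ.symm
      rw [abs_lt] at h2
      have := red_add_two_mul (x := -β / t) ⟨h2.1.le, h2.2⟩ 0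
      simpa [tau] using this
    rw [h1]
    ring

@[fun_prop]
lemma measurable_halfCot : Measurable halfCot := by
  unfold halfCot
  fun_prop

@[fun_prop]
lemma measurable_polar (z : ℂ) : Measurable (fun s => polar s z) := by
  unfold polar
  exact ((measurable_const.sub (measurable_halfCot.comp (by fun_prop)))).sub (by fun_prop)

lemma continuousAt_halfCot {w : ℂ} (hw : w.im < 0) : ContinuousAt halfCot w := by
  unfold halfCot
  have h := norm_exp_neg_I_pi_lt_one hw
  refine ContinuousAt.mul continuousAt_const (ContinuousAt.div (by fun_prop) (by fun_prop) ?_)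
  intro h0
  rw [← sub_eq_zero.1 h0] at h
  simp at h

lemma continuousAt_polar {s z : ℂ} (hz : z.im < 0) (hs : 0 ≤ s.im) :
    ContinuousAt (fun s => polar s z) s := by
  unfold polar
  have h : (z - s).im < 0 := by rw [Complex.sub_im]; linarith
  have h1 : ContinuousAt (fun s => halfCot (z - s)) s :=
    ContinuousAt.comp' (f := fun s => z - s) (g := halfCot) (continuousAt_halfCot h) (by fun_prop)
  have h2 : ContinuousAt (fun s => 1 / (z - s)) s :=
    continuousAt_const.div (by fun_prop) (ne_zero_of_im_neg h)
  exact (continuousAt_const.sub h1).sub (continuousAt_const.sub h2)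

lemma norm_one_div_le_of_im {w : ℂ} {η : ℝ} (hη : 0 < η) (hw : w.im ≤ -η) : ‖1 / w‖ ≤ 1 / η := by
  rw [norm_div, norm_one]
  have : η ≤ ‖w‖ := by
    have := Complex.abs_im_le_norm w
    have h2 := neg_le_abs w.im
    linarith
  gcongr

lemma norm_one_div_sub_le (t : ℝ) {w : ℂ} {η : ℝ} (hη : 0 < η) (hw : w.im ≤ -η) :
    ‖1 / ((t : ℂ) - w)‖ ≤ 1 / η := by
  rw [← neg_sub w, one_div, inv_neg, norm_neg, ← one_div]
  refine norm_one_div_le_of_im hη ?_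
  simpa using hw

lemma exists_norm_polar_le {z : ℂ} (hz : z.im < 0) :
    ∃ B : ℝ, ∀ s : ℂ, 0 ≤ s.im → ‖polar s z‖ ≤ B := by
  refine ⟨‖halfCot z‖ + π / (1 - Real.exp (π * z.im)) + (‖1 / z‖ + 1 / (-z.im)), fun s hs => ?_⟩
  unfold polar
  have h : (z - s).im ≤ z.im := by rw [Complex.sub_im]; linarith
  refine (norm_sub_le _ _).trans (add_le_add ((norm_sub_le _ _).trans ?_)
    ((norm_sub_le _ _).trans ?_))
  · gcongr
    exact norm_halfCot_le hz h
  · gcongr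
    exact norm_one_div_le_of_im (by linarith) (by linarith)

lemma integrable_mul_bounded {g φ : ℝ → ℂ} (hg : Integrable g) (hφ : Measurable φ) {B : ℝ}
    (hB : ∀ t, ‖φ t‖ ≤ B) : Integrable (fun t => g t * φ t) :=
  hg.mul_bdd hφ.aestronglyMeasurable (Eventually.of_forall hB)

lemma norm_integral_mul_le {g φ : ℝ → ℂ} (hg : Integrable g) {B : ℝ}
    (hB : ∀ t, ‖φ t‖ ≤ B) : ‖∫ t, g t * φ t‖ ≤ B * ∫ t, ‖g t‖ := by
  rw [← integral_const_mul]
  refine norm_integral_le_of_norm_le (hg.norm.const_mul B) (Eventually.of_forall fun t => ?_)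
  rw [norm_mul, mul_comm]
  gcongr
  exact hB t

/-- The Cauchy transform of `g` along `p`. -/
noncomputable def cauchy (g : ℝ → ℂ) (p : ℝ → ℝ) (z : ℂ) : ℂ := ∫ t, g t * (1 / ((p t : ℂ) - z))

lemma transfer_cauchy_shift {β : ℝ} (hβ : 0 < β) (hβ1 : β ≤ 1) {g : ℝ → ℂ} (hg : Integrable g)
    {p : ℝ → ℝ} (hp : Measurable p) {z : ℂ} (hz : ‖z‖ < 1) (hi : z.im < 0) {ε : ℝ} (hε : 0 < ε) :
    ∑' j : NZ, β / (z + 2 * (j : ℤ)) ^ 2 * cauchy g p (branch β j z - ε * Complex.I) =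
      ∫ t, g t * polar (-β / (p t + ε * Complex.I)) z := by
  have him : ∀ j : NZ, (branch β j z - ε * Complex.I).im ≤ -ε := by
    intro j
    have := branch_im_neg hβ hz hi j
    simp
    linarith
  have hbd : ∀ (j : NZ) (t : ℝ), ‖1 / ((p t : ℂ) - (branch β j z - ε * Complex.I))‖ ≤ 1 / ε :=
    fun j t => norm_one_div_sub_le _ hε (him j)
  have h_int : ∀ j : NZ, Integrable (fun t => β / (z + 2 * (j : ℤ)) ^ 2 *
      (g t * (1 / ((p t : ℂ) - (branch β j z - ε * Complex.I))))) := fun j =>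
    (integrable_mul_bounded hg (by fun_prop) (hbd j)).const_mul _
  have hsum : Summable (fun j : NZ => ∫ t, ‖β / (z + 2 * (j : ℤ)) ^ 2 *
      (g t * (1 / ((p t : ℂ) - (branch β j z - ε * Complex.I))))‖) := by
    refine Summable.of_nonneg_of_le (fun j => integral_nonneg fun t => norm_nonneg _)
      (fun j => ?_) (summable_inv_sq_nonzero.mul_right ((1 / ε) * ∫ t, ‖g t‖))
    simp_rw [norm_mul]
    rw [integral_const_mul]
    refine mul_le_mul ?_ ?_ (integral_nonneg fun t => by positivity) (by positivity)
    · simpa using norm_weight_le hβ hβ1 hz j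
    · rw [← integral_const_mul]
      refine integral_mono_of_nonneg (Eventually.of_forall fun t => by positivity)
        (hg.norm.const_mul _) (Eventually.of_forall fun t => ?_)
      simp only
      rw [mul_comm]
      gcongr
      exact hbd j t
  have h := (hasSum_integral_of_summable_integral_norm h_int hsum).tsum_eq
  simp_rw [integral_const_mul] at h
  unfold cauchy
  rw [h]
  congr 1
  ext t
  have ht : ((p t : ℂ) + ε * Complex.I).im = ε := by simp
  have h2 := hasSum_transfer_inv hβ (t := p t + ε * Complex.I)
    (by intro h0; rw [h0] at ht; simp at ht; exact hε.ne ht) (by rw [ht]; exact hε.le) hz hi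
  rw [← h2.tsum_eq, ← tsum_mul_left]
  congr 1
  ext j
  rw [show (p t : ℂ) - (branch β j z - ε * Complex.I) = p t + ε * Complex.I - branch β j z by ring]
  ring

lemma tendsto_transfer_cauchy {β : ℝ} (hβ : 0 < β) (hβ1 : β ≤ 1) {g : ℝ → ℂ} (hg : Integrable g)
    {p : ℝ → ℝ} (hp : Measurable p) (hp0 : ∀ᵐ t, g t = 0 ∨ p t ≠ 0)
    {z : ℂ} (hz : ‖z‖ < 1) (hi : z.im < 0) :
    Tendsto (fun ε : ℝ => ∑' j : NZ, β / (z + 2 * (j : ℤ)) ^ 2 *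
        cauchy g p (branch β j z - ε * Complex.I)) (𝓝[>] 0)
      (𝓝 (∫ t, g t * polar ((-β / p t : ℝ) : ℂ) z)) := by
  obtain ⟨B, hB⟩ := exists_norm_polar_le hi
  have hpol : ∀ (ε : ℝ) (_ : 0 ≤ ε) (t : ℝ), 0 ≤ (-β / (p t + ε * Complex.I) : ℂ).im :=
    fun ε hε t => neg_div_im_nonneg hβ (by simpa using hε)
  have h : Tendsto (fun ε : ℝ => ∫ t, g t * polar (-β / (p t + ε * Complex.I)) z) (𝓝[>] 0)
      (𝓝 (∫ t, g t * polar ((-β / p t : ℝ) : ℂ) z)) := by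
    refine tendsto_integral_filter_of_dominated_convergence (fun t => ‖g t‖ * B) ?_ ?_
      (hg.norm.mul_const B) ?_
    · refine Eventually.of_forall fun ε => hg.aestronglyMeasurable.mul ?_
      refine Measurable.aestronglyMeasurable ?_
      exact (measurable_polar z).comp (by fun_prop)
    · filter_upwards [self_mem_nhdsWithin] with ε hε
      refine Eventually.of_forall fun t => ?_
      rw [norm_mul]
      gcongr
      exact hB _ (hpol ε (le_of_lt hε) t)
    · filter_upwards [hp0] with t ht
      rcases ht with ht | ht
      · simp [ht]
      refine Tendsto.const_mul _ ?_
      have hc : ContinuousAt (fun ε : ℝ => polar (-β / (p t + ε * Complex.I)) z) 0 := by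
        refine ContinuousAt.comp' (f := fun ε : ℝ => (-β / (p t + ε * Complex.I) : ℂ))
          (g := fun s => polar s z) (continuousAt_polar hi (hpol 0 le_rfl t)) ?_
        refine continuousAt_const.div (by fun_prop) ?_
        simpa using ht
      have := hc.tendsto
      simp only [Complex.ofReal_zero, zero_mul, add_zero] at this
      push_cast
      exact this.mono_left nhdsWithin_le_nhds
  refine h.congr' ?_
  filter_upwards [self_mem_nhdsWithin] with ε hε
  exact (transfer_cauchy_shift hβ hβ1 hg hp hz hi hε).symm

lemma integral_mul_polar {g : ℝ → ℂ} (hg : Integrable g) {s : ℝ → ℝ} (hs : Measurable s)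
    (hF : ∀ n : ℕ, ∫ t, g t * Complex.exp (Complex.I * π * n * s t) = 0) {z : ℂ} (hi : z.im < 0) :
    ∫ t, g t * polar (s t) z = -cauchy g s z := by
  have hq : ∀ t, ‖Complex.exp (-(Complex.I * π * (z - s t)))‖ = Real.exp (π * z.im) := by
    intro t; rw [norm_exp_neg_I_pi]; simp
  have hq1 : Real.exp (π * z.im) < 1 := by
    rw [Real.exp_lt_one_iff]; exact mul_neg_of_pos_of_neg Real.pi_pos hi
  have hterm : ∀ n : ℕ, ∫ t, g t * (Complex.I * π *
      Complex.exp (-(Complex.I * π * (z - s t))) ^ (n + 1)) = 0 := by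
    intro n
    have := congrArg (fun x => (Complex.I * π * Complex.exp (-(Complex.I * π * (n + 1 : ℕ) * z))) * x)
      (hF (n + 1))
    simp only [mul_zero] at this
    rw [← integral_const_mul] at this
    rw [← this]
    congr 1
    ext t
    rw [← Complex.exp_nat_mul]
    have : ((n + 1 : ℕ) : ℂ) * -(Complex.I * π * (z - s t)) =
        -(Complex.I * π * (n + 1 : ℕ) * z) + Complex.I * π * (n + 1 : ℕ) * s t := by ring
    rw [this, Complex.exp_add]
    ring
  have h_int : ∀ n : ℕ, Integrable (fun t => g t * (Complex.I * π *
      Complex.exp (-(Complex.I * π * (z - s t))) ^ (n + 1))) := by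
    intro n
    refine integrable_mul_bounded hg (by fun_prop) (B := ‖Complex.I * π‖) fun t => ?_
    rw [norm_mul, norm_pow, hq]
    exact mul_le_of_le_one_right (norm_nonneg _) (pow_le_one₀ (Real.exp_pos _).le hq1.le)
  have hsum : Summable (fun n : ℕ => ∫ t, ‖g t * (Complex.I * π *
      Complex.exp (-(Complex.I * π * (z - s t))) ^ (n + 1))‖) := by
    simp_rw [norm_mul, norm_pow, hq, integral_mul_const]
    refine Summable.mul_left _ (Summable.mul_left _ ?_)
    exact (summable_nat_add_iff 1).2 (summable_geometric_of_lt_one (Real.exp_pos _).le hq1)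
  have h := (hasSum_integral_of_summable_integral_norm h_int hsum).tsum_eq
  simp_rw [hterm] at h
  rw [tsum_zero] at h
  have h2 : ∫ t, g t * (halfCot (z - s t) - Complex.I * π / 2) = 0 := by
    rw [h]
    congr 1
    ext t
    rw [← (hasSum_halfCot (w := z - s t) (by simpa using hi)).tsum_eq, ← tsum_mul_left]
  have h0 : ∫ t, g t = 0 := by simpa using hF 0
  have i1 : Integrable (fun t => g t * (halfCot (z - s t) - Complex.I * π / 2)) := by
    refine integrable_mul_bounded hg ?_
      (B := π / (1 - Real.exp (π * z.im)) + ‖Complex.I * π / 2‖) fun t => ?_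
    · exact (measurable_halfCot.comp (by fun_prop)).sub_const _
    · refine (norm_sub_le _ _).trans ?_
      gcongr
      exact norm_halfCot_le hi (by simp)
  have i2 : Integrable (fun t => g t * (1 / ((s t : ℂ) - z))) :=
    integrable_mul_bounded hg (by fun_prop) (B := 1 / (-z.im)) fun t =>
      norm_one_div_sub_le _ (by linarith) (by linarith)
  have e : ∀ t, g t * polar (s t) z = g t * (halfCot z - Complex.I * π / 2 - 1 / z) -
      g t * (halfCot (z - s t) - Complex.I * π / 2) - g t * (1 / ((s t : ℂ) - z)) := by
    intro t
    unfold polar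
    rw [← neg_sub z (s t : ℂ), one_div (-(z - (s t : ℂ))), inv_neg]
    ring
  have i3 : Integrable (fun t => g t * (halfCot z - Complex.I * π / 2 - 1 / z) -
      g t * (halfCot (z - s t) - Complex.I * π / 2)) := (hg.mul_const _).sub i1
  simp_rw [e]
  rw [integral_sub i3 i2, integral_sub (hg.mul_const _) i1, h2, integral_mul_const, h0]
  simp [cauchy]

/-- The sum of the power series with coefficients `a`. -/
noncomputable def psum (a : ℕ → ℂ) (z : ℂ) : ℂ := ∑' k, a k * z ^ k

lemma summable_succ_mul_pow {r : ℝ} (h0 : 0 ≤ r) (h1 : r < 1) (C : ℝ) :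
    Summable (fun k : ℕ => C * (k + 1) * r ^ k) := by
  have h := summable_pow_mul_geometric_of_norm_lt_one 1 (r := r)
    (by rwa [Real.norm_of_nonneg h0])
  have h2 := summable_geometric_of_lt_one h0 h1
  refine ((h.add h2).mul_left C).congr fun k => ?_
  ring

lemma norm_coeff_mul_pow_le {a : ℕ → ℂ} {C r : ℝ} (hC : ∀ k : ℕ, ‖a k‖ ≤ C * (k + 1)) {z : ℂ}
    (hz : ‖z‖ ≤ r) (k : ℕ) : ‖a k * z ^ k‖ ≤ C * (k + 1) * r ^ k := by
  rw [norm_mul, norm_pow]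
  exact mul_le_mul (hC k) (pow_le_pow_left₀ (norm_nonneg _) hz _) (by positivity)
    ((norm_nonneg _).trans (hC k))

lemma differentiableOn_psum {a : ℕ → ℂ} {C : ℝ} (hC : ∀ k : ℕ, ‖a k‖ ≤ C * (k + 1)) :
    DifferentiableOn ℂ (psum a) (Metric.ball 0 1) := by
  intro z hz
  rw [mem_ball_zero_iff] at hz
  obtain ⟨r, hzr, hr⟩ := exists_between hz
  have h := Complex.differentiableOn_tsum_of_summable_norm
    (summable_succ_mul_pow ((norm_nonneg z).trans hzr.le) hr C)
    (F := fun k z => a k * z ^ k) (U := Metric.ball 0 r) (fun k => by fun_prop) Metric.isOpen_ball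
    (fun k w hw => norm_coeff_mul_pow_le hC (by simpa using (mem_ball_zero_iff.1 hw).le) k)
  exact (h.differentiableAt (Metric.isOpen_ball.mem_nhds (by simpa using hzr))).differentiableWithinAt

lemma tendsto_psum {a : ℕ → ℕ → ℂ} {b : ℕ → ℂ} {C : ℝ} (hC : ∀ n k : ℕ, ‖a n k‖ ≤ C * (k + 1))
    (h : ∀ k, Tendsto (fun n => a n k) atTop (𝓝 (b k))) {z : ℂ} (hz : ‖z‖ < 1) :
    Tendsto (fun n => psum (a n) z) atTop (𝓝 (psum b z)) :=
  tendsto_tsum_of_dominated_convergence (summable_succ_mul_pow (norm_nonneg z) hz C)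
    (fun k => (h k).mul_const _)
    (Eventually.of_forall fun n k => norm_coeff_mul_pow_le (hC n) le_rfl k)

/-- The Taylor coefficients of `disk β θ` at the origin. -/
noncomputable def coeff (β : ℝ) (θ : ℝ → ℂ) (k : ℕ) : ℂ :=
  ∫ y in Ioo (-β) β, θ y * ((k + 1) * (-(y / β : ℝ) : ℂ) ^ k / β)

lemma hasSum_succ_mul_pow {x : ℂ} (hx : ‖x‖ < 1) :
    HasSum (fun k : ℕ => (k + 1) * x ^ k) (1 / (1 - x) ^ 2) := by
  have h1 := hasSum_coe_mul_geometric_of_norm_lt_one hx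
  have h2 := hasSum_geometric_of_norm_lt_one hx
  have h0 : 1 - x ≠ 0 := by
    intro h; rw [← sub_eq_zero.1 h] at hx; simp at hx
  have e : 1 / (1 - x) ^ 2 = x / (1 - x) ^ 2 + (1 - x)⁻¹ := by field_simp; ring
  rw [e]
  refine (h1.add h2).congr_fun fun k => ?_
  ring

lemma norm_coeff_integrand_le {β : ℝ} (hβ : 0 < β) {θ : ℝ → ℂ} {R : ℝ} (hR : ∀ y, ‖θ y‖ ≤ R)
    (k : ℕ) {y : ℝ} (hy : y ∈ Ioo (-β) β) :
    ‖θ y * ((k + 1) * (-(y / β : ℝ) : ℂ) ^ k / β)‖ ≤ R * ((k + 1) / β) := by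
  have hR0 : 0 ≤ R := (norm_nonneg _).trans (hR 0)
  have h1 : |y / β| ≤ 1 := by
    rw [abs_div, abs_of_pos hβ, div_le_one hβ]; exact mem_Ioo_abs hy
  have h2 : ‖((k : ℂ) + 1)‖ = k + 1 := by
    have : ((k : ℂ) + 1) = ((k + 1 : ℝ) : ℂ) := by push_cast; ring
    rw [this, Complex.norm_real, Real.norm_of_nonneg (by positivity)]
  rw [norm_mul, norm_div, norm_mul, norm_pow, norm_neg, Complex.norm_real, Complex.norm_real,
    Real.norm_eq_abs, Real.norm_eq_abs, abs_of_pos hβ, h2]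
  refine mul_le_mul (hR y) ?_ (by positivity) hR0
  gcongr
  exact mul_le_of_le_one_right (by positivity) (pow_le_one₀ (abs_nonneg _) h1)

lemma norm_coeff_le {β : ℝ} (hβ : 0 < β) {θ : ℝ → ℂ} {R : ℝ} (hR : ∀ y, ‖θ y‖ ≤ R) (k : ℕ) :
    ‖coeff β θ k‖ ≤ 2 * R * (k + 1) := by
  have h := norm_setIntegral_le_of_norm_le_const (μ := volume) (s := Ioo (-β) β)
    (by simp) (fun y hy => norm_coeff_integrand_le hβ hR k hy)
  refine h.trans (le_of_eq ?_)
  rw [Measure.real, Real.volume_Ioo, ENNReal.toReal_ofReal (by linarith)]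
  field_simp
  ring

lemma disk_eq_psum {β : ℝ} (hβ : 0 < β) {θ : ℝ → ℂ} (hm : Measurable θ) {R : ℝ}
    (hR : ∀ y, ‖θ y‖ ≤ R) {z : ℂ} (hz : ‖z‖ < 1) : disk β θ z = psum (coeff β θ) z := by
  have hR0 : 0 ≤ R := (norm_nonneg _).trans (hR 0)
  have h_int : ∀ k : ℕ, IntegrableOn (fun y : ℝ => θ y * ((k + 1) * (-(y / β : ℝ) : ℂ) ^ k / β))
      (Ioo (-β) β) := fun k =>
    integrableOn_bounded (by fun_prop) measurableSet_Ioo (by simp)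
      fun y hy => norm_coeff_integrand_le hβ hR k hy
  have h_int2 : ∀ k : ℕ, IntegrableOn
      (fun y : ℝ => θ y * ((k + 1) * (-(y / β : ℝ) : ℂ) ^ k / β) * z ^ k)
      (Ioo (-β) β) := fun k => (h_int k).mul_const _
  have hsum : Summable (fun k : ℕ => ∫ y in Ioo (-β) β,
      ‖θ y * ((k + 1) * (-(y / β : ℝ) : ℂ) ^ k / β) * z ^ k‖) := by
    refine Summable.of_nonneg_of_le (fun k => integral_nonneg fun y => norm_nonneg _)
      (fun k => ?_) (summable_succ_mul_pow (norm_nonneg z) hz (2 * R))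
    have hb : ∀ y ∈ Ioo (-β) β, ‖θ y * ((k + 1) * (-(y / β : ℝ) : ℂ) ^ k / β) * z ^ k‖ ≤
        R * ((k + 1) / β) * ‖z‖ ^ k := by
      intro y hy
      rw [norm_mul, norm_pow]
      gcongr
      exact norm_coeff_integrand_le hβ hR k hy
    have := setIntegral_mono_on (h_int2 k).norm (integrable_const (R * ((k + 1) / β) * ‖z‖ ^ k))
      measurableSet_Ioo hb
    refine this.trans (le_of_eq ?_)
    rw [setIntegral_const, Measure.real, Real.volume_Ioo, ENNReal.toReal_ofReal (by linarith),
      smul_eq_mul]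
    field_simp
    ring
  have h := (hasSum_integral_of_summable_integral_norm h_int2 hsum).tsum_eq
  simp_rw [integral_mul_const] at h
  unfold psum coeff disk
  rw [h]
  refine setIntegral_congr_fun measurableSet_Ioo fun y hy => ?_
  have hb : (β : ℂ) ≠ 0 := by exact_mod_cast hβ.ne'
  have hx : ‖(-(y / β : ℝ) : ℂ) * z‖ < 1 := by
    rw [norm_mul, norm_neg, Complex.norm_real, Real.norm_eq_abs]
    have h1 : |y / β| ≤ 1 := by
      rw [abs_div, abs_of_pos hβ, div_le_one hβ]; exact mem_Ioo_abs hy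
    calc |y / β| * ‖z‖ ≤ 1 * ‖z‖ := by gcongr
      _ < 1 := by linarith
  have h3 := ((hasSum_succ_mul_pow hx).mul_left (θ y / β)).tsum_eq
  have h4 : (β : ℂ) + y * z = β * (1 - (-(y / β : ℝ) : ℂ) * z) := by
    push_cast; field_simp; ring
  have h5 : (1 - (-(y / β : ℝ) : ℂ) * z) ≠ 0 := by
    have := beta_add_ne_zero hβ (mem_Ioo_abs hy) hz
    rw [h4] at this
    exact right_ne_zero_of_mul this
  have h6 : θ y * (β / (β + y * z) ^ 2) =
      θ y / β * (1 / (1 - (-(y / β : ℝ) : ℂ) * z) ^ 2) := by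
    rw [h4]; field_simp
  rw [h6, ← h3]
  congr 1
  ext k
  rw [mul_pow]
  ring

lemma differentiableOn_disk {β : ℝ} (hβ : 0 < β) {θ : ℝ → ℂ} (hm : Measurable θ) {R : ℝ}
    (hR : ∀ y, ‖θ y‖ ≤ R) : DifferentiableOn ℂ (disk β θ) (Metric.ball 0 1) :=
  (differentiableOn_psum (norm_coeff_le hβ hR)).congr fun _ hz =>
    disk_eq_psum hβ hm hR (mem_ball_zero_iff.1 hz)

/-- Bounded densities yield sequentially precompact families of holomorphic functions. -/
lemma exists_subseq_disk {β : ℝ} (hβ : 0 < β) {θ : ℕ → ℝ → ℂ} (hm : ∀ n, Measurable (θ n)) {R : ℝ}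
    (hR : ∀ n y, ‖θ n y‖ ≤ R) :
    ∃ (h : ℂ → ℂ) (φ : ℕ → ℕ), StrictMono φ ∧ DifferentiableOn ℂ h (Metric.ball 0 1) ∧
      ∀ z : ℂ, ‖z‖ < 1 → Tendsto (fun n => disk β (θ (φ n)) z) atTop (𝓝 (h z)) := by
  have hc : IsCompact (Set.pi univ fun k : ℕ => Metric.closedBall (0 : ℂ) (2 * R * (k + 1))) :=
    isCompact_univ_pi fun k => isCompact_closedBall _ _
  obtain ⟨a, ha, φ, hφ, hlim⟩ := hc.tendsto_subseq (x := fun n => coeff β (θ n))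
    (fun n k _ => by simpa using norm_coeff_le hβ (hR n) k)
  refine ⟨psum a, φ, hφ, differentiableOn_psum (C := 2 * R) fun k => by
    simpa using ha k (mem_univ k), fun z hz => ?_⟩
  have := tendsto_psum (a := fun n => coeff β (θ (φ n))) (b := a) (C := 2 * R)
    (fun n k => norm_coeff_le hβ (hR _) k) (fun k => (tendsto_pi_nhds.1 hlim) k) hz
  refine this.congr fun n => ?_
  rw [disk_eq_psum hβ (hm _) (hR _) hz]

lemma tendsto_transfer {β : ℝ} (hβ : 0 < β) (hβ1 : β ≤ 1) {h : ℂ → ℂ}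
    (hc : ContinuousOn h (Metric.ball 0 1)) {ι : Type*} {l : Filter ι} {u δ : ι → ℂ} {x : ℂ}
    (hx : ‖x‖ < 1) (hu : Tendsto u l (𝓝 x)) (hδ : Tendsto δ l (𝓝 0)) :
    Tendsto (fun i => ∑' j : NZ, β / (u i + 2 * (j : ℤ)) ^ 2 * h (branch β j (u i) - δ i)) l
      (𝓝 (transfer β h x)) := by
  obtain ⟨r, hxr, hr⟩ := exists_between hx
  have hr2 : 1 / (2 - r) < 1 := by rw [div_lt_one] <;> linarith
  obtain ⟨s, hrs, hs⟩ := exists_between hr2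
  obtain ⟨M, hM⟩ := (isCompact_closedBall (0 : ℂ) s).exists_bound_of_continuousOn
    (hc.mono (Metric.closedBall_subset_ball hs))
  have hu' : ∀ᶠ i in l, ‖u i‖ < r := hu.norm.eventually_lt_const hxr
  have hδ' : ∀ᶠ i in l, ‖δ i‖ < s - 1 / (2 - r) := by
    refine hδ.norm.eventually_lt_const ?_
    rw [norm_zero]; linarith
  refine tendsto_tsum_of_dominated_convergence (summable_inv_sq_nonzero.mul_right M) ?_ ?_
  · intro j
    have h0 := add_two_mul_ne_zero' hx j
    have h1 : Tendsto (fun i => (β : ℂ) / (u i + 2 * (j : ℤ)) ^ 2) l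
        (𝓝 (β / (x + 2 * (j : ℤ)) ^ 2)) :=
      tendsto_const_nhds.div ((hu.add_const _).pow 2) (pow_ne_zero 2 h0)
    have h2 : Tendsto (fun i => branch β j (u i) - δ i) l (𝓝 (branch β j x)) := by
      have : Tendsto (fun i => branch β j (u i)) l (𝓝 (branch β j x)) :=
        tendsto_const_nhds.div (hu.add_const _) h0
      simpa using this.sub hδ
    have h3 : ContinuousAt h (branch β j x) := hc.continuousAt
      (Metric.isOpen_ball.mem_nhds (by simpa using norm_branch_lt hβ hβ1 hx j))
    exact h1.mul (h3.tendsto.comp h2)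
  · filter_upwards [hu', hδ'] with i hi hi' j
    have hi1 : ‖u i‖ < 1 := by linarith
    rw [norm_mul]
    have h1 : ‖branch β j (u i) - δ i‖ ≤ s := by
      have a1 := norm_branch_le hβ hβ1 hi1 j
      have a2 : 1 / (2 - ‖u i‖) ≤ 1 / (2 - r) := by
        apply one_div_le_one_div_of_le <;> linarith
      have := norm_sub_le (branch β j (u i)) (δ i)
      linarith
    exact mul_le_mul (norm_weight_le hβ hβ1 hi1 j) (hM _ (by simpa using h1)) (norm_nonneg _)
      (by positivity)

lemma continuousAt_transfer {β : ℝ} (hβ : 0 < β) (hβ1 : β ≤ 1) {h : ℂ → ℂ}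
    (hc : ContinuousOn h (Metric.ball 0 1)) {x : ℂ} (hx : ‖x‖ < 1) :
    ContinuousAt (transfer β h) x := by
  have := tendsto_transfer hβ hβ1 hc (l := 𝓝 x) (u := id) (δ := fun _ => 0) hx tendsto_id
    tendsto_const_nhds
  refine this.congr fun z => ?_
  simp [transfer]

/-- The invariant density `2 / (1 - x²)`. -/
noncomputable def rho (x : ℝ) : ℝ := 2 / (1 - x ^ 2)

/-- The branch weights, normalized by the invariant density. -/
noncomputable def wt (β : ℝ) (j : NZ) (x : ℝ) : ℝ :=
  β * (1 - x ^ 2) / ((x + 2 * (j : ℤ)) ^ 2 - β ^ 2)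

/-- The inverse branches on the real line. -/
noncomputable def rbranch (β : ℝ) (j : NZ) (x : ℝ) : ℝ := -β / (x + 2 * (j : ℤ))

lemma branch_ofReal (β : ℝ) (j : NZ) (x : ℝ) : branch β j x = (rbranch β j x : ℝ) := by
  unfold branch rbranch; push_cast; rfl

lemma norm_ofReal_lt {x : ℝ} (hx : |x| < 1) : ‖(x : ℂ)‖ < 1 := by
  rwa [Complex.norm_real]

lemma abs_rbranch_lt {β : ℝ} (hβ : 0 < β) (hβ1 : β ≤ 1) {x : ℝ} (hx : |x| < 1) (j : NZ) :
    |rbranch β j x| < 1 := by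
  have := norm_branch_lt hβ hβ1 (norm_ofReal_lt hx) j
  rwa [branch_ofReal, Complex.norm_real] at this

lemma one_sub_sq_pos {x : ℝ} (hx : |x| < 1) : 0 < 1 - x ^ 2 := by
  have := (sq_lt_one_iff_abs_lt_one x).2 hx
  linarith

lemma rho_pos {x : ℝ} (hx : |x| < 1) : 0 < rho x := div_pos two_pos (one_sub_sq_pos hx)

lemma one_lt_sq_add {x : ℝ} (hx : |x| < 1) (j : NZ) : 1 < (x + 2 * ((j : ℤ) : ℝ)) ^ 2 := by
  have h := norm_add_two_mul_ge (x : ℂ) j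
  have e : (x : ℂ) + 2 * ((j : ℤ) : ℂ) = ((x + 2 * (j : ℤ) : ℝ) : ℂ) := by push_cast; rfl
  rw [e, Complex.norm_real, Complex.norm_real, Real.norm_eq_abs, Real.norm_eq_abs] at h
  have h1 := one_le_abs j
  rw [one_lt_sq_iff_one_lt_abs]
  nlinarith

lemma wt_den_pos {β : ℝ} (hβ : 0 < β) (hβ1 : β ≤ 1) {x : ℝ} (hx : |x| < 1) (j : NZ) :
    0 < (x + 2 * ((j : ℤ) : ℝ)) ^ 2 - β ^ 2 := by
  have := one_lt_sq_add hx j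
  nlinarith

lemma wt_pos {β : ℝ} (hβ : 0 < β) (hβ1 : β ≤ 1) {x : ℝ} (hx : |x| < 1) (j : NZ) :
    0 < wt β j x :=
  div_pos (mul_pos hβ (one_sub_sq_pos hx)) (wt_den_pos hβ hβ1 hx j)

lemma weight_mul_rho {β : ℝ} (hβ : 0 < β) (hβ1 : β ≤ 1) {x : ℝ} (hx : |x| < 1) (j : NZ) :
    β / (x + 2 * (j : ℤ)) ^ 2 * rho (rbranch β j x) = wt β j x * rho x := by
  have h1 := (wt_den_pos hβ hβ1 hx j).ne'
  have h2 := (one_sub_sq_pos hx).ne'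
  have h3 : x + 2 * ((j : ℤ) : ℝ) ≠ 0 := by
    intro h
    have := one_lt_sq_add hx j
    rw [h] at this; norm_num at this
  have h4 := (one_sub_sq_pos (abs_rbranch_lt hβ hβ1 hx j)).ne'
  unfold rho wt
  unfold rbranch at h4 ⊢
  have h5 : 1 - (-β / (x + 2 * ((j : ℤ) : ℝ))) ^ 2 =
      ((x + 2 * ((j : ℤ) : ℝ)) ^ 2 - β ^ 2) / (x + 2 * ((j : ℤ) : ℝ)) ^ 2 := by
    field_simp
  rw [h5]
  field_simp

lemma integral_kernel {β : ℝ} (hβ : 0 < β) {z : ℂ} (hz : ‖z‖ < 1) :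
    disk β (fun _ => 1) z = 2 / (1 - z ^ 2) := by
  have h1 := disk_seg hβ (t := β) (abs_of_pos hβ).le hz
  have h2 := disk_seg hβ (t := -β) (by rw [abs_neg, abs_of_pos hβ]) hz
  have i : ∀ t : ℝ, IntegrableOn (fun y : ℝ => ((seg t y : ℝ) : ℂ) * (β / (β + y * z) ^ 2))
      (Ioo (-β) β) := fun t => integrableOn_disk hβ
    (Complex.measurable_ofReal.comp (measurable_seg t)) (norm_seg_le t) hz
  have h3 : disk β (fun _ => 1) z =
      disk β (fun y => (seg β y : ℝ)) z - disk β (fun y => (seg (-β) y : ℝ)) z := by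
    unfold disk
    rw [← integral_sub (i β) (i (-β))]
    refine setIntegral_congr_fun measurableSet_Ioo fun y hy => ?_
    have : seg β y - seg (-β) y = 1 := by
      unfold seg
      rw [if_pos hy.2, if_neg (not_lt.2 hy.1.le)]
      ring
    have h4 : ((seg β y : ℝ) : ℂ) - ((seg (-β) y : ℝ) : ℂ) = 1 := by exact_mod_cast this
    simp only
    rw [← sub_mul, h4]
  have hb : (β : ℂ) ≠ 0 := by exact_mod_cast hβ.ne'
  have a1 : 1 + z ≠ 0 := by
    intro h; rw [show z = -1 by linear_combination h] at hz; simp at hz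
  have a2 : 1 - z ≠ 0 := by
    intro h; rw [show z = 1 by linear_combination -h] at hz; simp at hz
  rw [h3, h1, h2]
  push_cast
  rw [show (β : ℂ) + β * z = β * (1 + z) by ring, show (β : ℂ) + -β * z = β * (1 - z) by ring,
    show (1 : ℂ) - z ^ 2 = (1 + z) * (1 - z) by ring]
  field_simp
  ring

lemma integral_kernel_real {β : ℝ} (hβ : 0 < β) {x : ℝ} (hx : |x| < 1) :
    ∫ y in Ioo (-β) β, β / (β + y * x) ^ 2 = rho x := by
  have h := integral_kernel hβ (norm_ofReal_lt hx)
  unfold disk at h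
  apply Complex.ofReal_injective
  rw [← integral_complex_ofReal]
  unfold rho
  push_cast
  rw [← h]
  simp

lemma norm_disk_le {β : ℝ} (hβ : 0 < β) {θ : ℝ → ℂ} {R : ℝ} (hR : ∀ y, ‖θ y‖ ≤ R)
    {x : ℝ} (hx : |x| < 1) : ‖disk β θ x‖ ≤ R * rho x := by
  rw [← integral_kernel_real hβ hx, ← integral_const_mul]
  unfold disk
  have hi : IntegrableOn (fun y : ℝ => (β / (β + y * x) ^ 2 : ℝ)) (Ioo (-β) β) := by
    have := (integrableOn_disk hβ (θ := fun _ => 1) measurable_const (R := 1) (by simp)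
      (norm_ofReal_lt hx)).re
    refine this.congr (Eventually.of_forall fun y => ?_)
    have e : (1 : ℂ) * (β / (β + y * x) ^ 2) = ((β / (β + y * x) ^ 2 : ℝ) : ℂ) := by
      push_cast; ring
    simp only
    rw [e]; exact Complex.ofReal_re _
  refine norm_integral_le_of_norm_le (hi.const_mul R) (Eventually.of_forall fun y => ?_)
  have e : ((β : ℂ) / (β + y * x) ^ 2) = ((β / (β + y * x) ^ 2 : ℝ) : ℂ) := by push_cast; rfl
  rw [norm_mul, e, Complex.norm_real, Real.norm_of_nonneg (by positivity)]
  gcongr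
  exact hR y

lemma wt_one_hasSum {x : ℝ} (hx : |x| < 1) :
    Summable (fun j : NZ => wt 1 j x) ∧ ∑' j : NZ, wt 1 j x ≤ 1 := by
  have hz := norm_ofReal_lt hx
  have h := hasSum_transfer_disk one_pos le_rfl (θ := fun _ => 1) measurable_const (R := 1)
    (by simp) hz
  have e : ∀ j : NZ, ((1 : ℝ) : ℂ) / ((x : ℂ) + 2 * (j : ℤ)) ^ 2 *
      disk 1 (fun _ => 1) (branch 1 j x) = ((wt 1 j x * rho x : ℝ) : ℂ) := by
    intro j
    rw [integral_kernel one_pos (norm_branch_lt one_pos le_rfl hz j),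
      ← weight_mul_rho one_pos le_rfl hx j, branch_ofReal]
    unfold rho
    push_cast
    rfl
  simp_rw [e] at h
  have hs : Summable (fun j : NZ => wt 1 j x * rho x) := Complex.summable_ofReal.1 h.summable
  have hr := rho_pos hx
  have h2 : Summable (fun j : NZ => wt 1 j x) := by
    refine (hs.mul_right (rho x)⁻¹).congr fun j => ?_
    field_simp
  refine ⟨h2, ?_⟩
  have h3 := h.tsum_eq
  rw [← Complex.ofReal_tsum, tsum_mul_right] at h3
  have h4 := norm_disk_le one_pos (norm_koop_le (β := 1) (θ := fun _ => 1) (R := 1) (by simp)) hx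
  rw [← h3, Complex.norm_real, Real.norm_eq_abs] at h4
  have h5 := (le_abs_self _).trans h4
  nlinarith

lemma wt_le {β : ℝ} (hβ : 0 < β) (hβ1 : β ≤ 1) {x : ℝ} (hx : |x| < 1) (j : NZ) :
    wt β j x ≤ β * wt 1 j x := by
  unfold wt
  have h1 := wt_den_pos one_pos le_rfl hx j
  have h2 := one_sub_sq_pos hx
  rw [← mul_div_assoc, one_mul]
  gcongr

lemma wt_hasSum {β : ℝ} (hβ : 0 < β) (hβ1 : β ≤ 1) {x : ℝ} (hx : |x| < 1) :
    Summable (fun j : NZ => wt β j x) ∧ ∑' j : NZ, wt β j x ≤ β := by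
  obtain ⟨h1, h2⟩ := wt_one_hasSum hx
  have h3 : Summable (fun j : NZ => wt β j x) :=
    Summable.of_nonneg_of_le (fun j => (wt_pos hβ hβ1 hx j).le) (fun j => wt_le hβ hβ1 hx j)
      (h1.mul_left β)
  refine ⟨h3, ?_⟩
  have := h3.tsum_le_tsum (fun j => wt_le hβ hβ1 hx j) (h1.mul_left β)
  rw [tsum_mul_left] at this
  nlinarith

/-- The quotient of a function on the disc by the invariant density, on the real diameter. -/
noncomputable def ratio (h : ℂ → ℂ) (x : ℝ) : ℂ := h x / (rho x : ℝ)

lemma eq_ratio_mul (h : ℂ → ℂ) {x : ℝ} (hx : |x| < 1) : h x = ratio h x * (rho x : ℝ) := by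
  have : ((rho x : ℝ) : ℂ) ≠ 0 := by exact_mod_cast (rho_pos hx).ne'
  unfold ratio
  field_simp

lemma norm_ratio_le {h : ℂ → ℂ} {x C : ℝ} (hx : |x| < 1) (hC : ‖h x‖ ≤ C * rho x) :
    ‖ratio h x‖ ≤ C := by
  have := rho_pos hx
  rw [ratio, norm_div, Complex.norm_real, Real.norm_of_nonneg this.le, div_le_iff₀ this]
  exact hC

lemma ratio_transfer {β : ℝ} (hβ : 0 < β) (hβ1 : β ≤ 1) (h : ℂ → ℂ) {x : ℝ} (hx : |x| < 1) :
    ratio (transfer β h) x = ∑' j : NZ, (wt β j x : ℂ) * ratio h (rbranch β j x) := by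
  have : ((rho x : ℝ) : ℂ) ≠ 0 := by exact_mod_cast (rho_pos hx).ne'
  rw [ratio, div_eq_iff this, transfer, ← tsum_mul_right]
  refine tsum_congr fun j => ?_
  rw [branch_ofReal, eq_ratio_mul h (abs_rbranch_lt hβ hβ1 hx j)]
  have e := weight_mul_rho hβ hβ1 hx j
  have e' : (β : ℂ) / (x + 2 * (j : ℤ)) ^ 2 * (rho (rbranch β j x) : ℝ) =
      wt β j x * (rho x : ℝ) := by exact_mod_cast e
  linear_combination ratio h (rbranch β j x) * e'

lemma norm_ratio_transfer_le {β : ℝ} (hβ : 0 < β) (hβ1 : β ≤ 1) {h : ℂ → ℂ} {C : ℝ}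
    (hC : ∀ x : ℝ, |x| < 1 → ‖h x‖ ≤ C * rho x) {x : ℝ} (hx : |x| < 1) :
    Summable (fun j : NZ => wt β j x * ‖ratio h (rbranch β j x)‖) ∧
    ‖ratio (transfer β h) x‖ ≤ ∑' j : NZ, wt β j x * ‖ratio h (rbranch β j x)‖ := by
  have hs : Summable (fun j : NZ => wt β j x * ‖ratio h (rbranch β j x)‖) := by
    refine Summable.of_nonneg_of_le
      (fun j => mul_nonneg (wt_pos hβ hβ1 hx j).le (norm_nonneg _)) (fun j => ?_)
      ((wt_hasSum hβ hβ1 hx).1.mul_right C)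
    have := abs_rbranch_lt hβ hβ1 hx j
    exact mul_le_mul_of_nonneg_left (norm_ratio_le this (hC _ this)) (wt_pos hβ hβ1 hx j).le
  refine ⟨hs, ?_⟩
  rw [ratio_transfer hβ hβ1 h hx]
  refine tsum_of_norm_bounded hs.hasSum fun j => ?_
  rw [norm_mul, Complex.norm_real, Real.norm_of_nonneg (wt_pos hβ hβ1 hx j).le]

lemma ratio_eq_of_max {β : ℝ} (hβ : 0 < β) (hβ1 : β ≤ 1) {h : ℂ → ℂ} {c : ℂ}
    (hc : ∀ x : ℝ, |x| < 1 → ‖h x‖ ≤ ‖c‖ * rho x) {x : ℝ} (hx : |x| < 1)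
    (heq : ratio (transfer β h) x = c) (j : NZ) : ratio h (rbranch β j x) = c := by
  set q : NZ → ℂ := fun j => ratio h (rbranch β j x) with hq
  have hq1 : ∀ j, ‖q j‖ ≤ ‖c‖ := fun j =>
    norm_ratio_le (abs_rbranch_lt hβ hβ1 hx j) (hc _ (abs_rbranch_lt hβ hβ1 hx j))
  obtain ⟨hw, hw1⟩ := wt_hasSum hβ hβ1 hx
  have hs : Summable (fun j : NZ => (wt β j x : ℂ) * q j) := by
    refine Summable.of_norm_bounded (hw.mul_right ‖c‖) fun j => ?_
    rw [norm_mul, Complex.norm_real, Real.norm_of_nonneg (wt_pos hβ hβ1 hx j).le]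
    exact mul_le_mul_of_nonneg_left (hq1 j) (wt_pos hβ hβ1 hx j).le
  have h1 : HasSum (fun j : NZ => (wt β j x : ℂ) * q j) c := by
    rw [← heq, ratio_transfer hβ hβ1 h hx]; exact hs.hasSum
  have h2 := Complex.hasSum_re (h1.mul_right ((starRingEnd ℂ) c))
  have h3 : HasSum (fun j : NZ => wt β j x * (‖c‖ ^ 2 - (q j * (starRingEnd ℂ) c).re))
      (‖c‖ ^ 2 * (∑' j, wt β j x) - ‖c‖ ^ 2) := by
    have e : (c * (starRingEnd ℂ) c).re = ‖c‖ ^ 2 := by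
      rw [Complex.mul_conj, Complex.ofReal_re, Complex.normSq_eq_norm_sq]
    rw [e] at h2
    refine ((hw.hasSum.mul_left (‖c‖ ^ 2)).sub h2).congr_fun fun j => ?_
    rw [mul_assoc, Complex.re_ofReal_mul]; ring
  have hle : ∀ j, (q j * (starRingEnd ℂ) c).re ≤ ‖c‖ ^ 2 := fun j => by
    refine (Complex.re_le_norm _).trans ?_
    rw [norm_mul, RCLike.norm_conj, sq]
    exact mul_le_mul_of_nonneg_right (hq1 j) (norm_nonneg _)
  have h4 : ∀ j : NZ, 0 ≤ wt β j x * (‖c‖ ^ 2 - (q j * (starRingEnd ℂ) c).re) := fun j =>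
    mul_nonneg (wt_pos hβ hβ1 hx j).le (sub_nonneg.2 (hle j))
  have h5 : wt β j x * (‖c‖ ^ 2 - (q j * (starRingEnd ℂ) c).re) ≤ 0 := by
    refine (le_hasSum h3 j fun i _ => h4 i).trans ?_
    nlinarith [sq_nonneg ‖c‖]
  have h6 : ‖c‖ ^ 2 - (q j * (starRingEnd ℂ) c).re ≤ 0 :=
    nonpos_of_mul_nonpos_right h5 (wt_pos hβ hβ1 hx j)
  have h7 : ‖q j - c‖ ^ 2 ≤ 0 := by
    have e1 := Complex.normSq_sub (q j) c
    simp only [Complex.normSq_eq_norm_sq] at e1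
    have := hq1 j
    have e2 : ‖q j‖ ^ 2 ≤ ‖c‖ ^ 2 := by gcongr
    linarith
  have h8 : ‖q j - c‖ = 0 := by
    have := sq_nonneg ‖q j - c‖
    exact pow_eq_zero_iff two_ne_zero |>.1 (le_antisymm h7 this)
  exact sub_eq_zero.1 (norm_eq_zero.1 h8)

lemma one_sub_sq_ne_zero {z : ℂ} (hz : ‖z‖ < 1) : 1 - z ^ 2 ≠ 0 := by
  intro h
  have : ‖z ^ 2‖ = 1 := by rw [← sub_eq_zero.1 h]; simp
  rw [norm_pow] at this
  nlinarith [norm_nonneg z]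

lemma eq_density_of_max {β : ℝ} (hβ : 0 < β) (hβ1 : β ≤ 1) {h : ℂ → ℂ}
    (hd : DifferentiableOn ℂ h (Metric.ball 0 1)) {c : ℂ}
    (hc : ∀ x : ℝ, |x| < 1 → ‖h x‖ ≤ ‖c‖ * rho x) {x : ℝ} (hx : |x| < 1)
    (heq : ratio (transfer β h) x = c) {z : ℂ} (hz : ‖z‖ < 1) : h z = c * (2 / (1 - z ^ 2)) := by
  have hd2 : DifferentiableOn ℂ (fun z : ℂ => c * (2 / (1 - z ^ 2))) (Metric.ball 0 1) := by
    intro z hz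
    have := one_sub_sq_ne_zero (mem_ball_zero_iff.1 hz)
    fun_prop (disch := assumption)
  have key := (hd.analyticOnNhd Metric.isOpen_ball).eqOn_of_preconnected_of_frequently_eq
    (hd2.analyticOnNhd Metric.isOpen_ball) (convex_ball (0 : ℂ) 1).isPreconnected
    (z₀ := 0) (by simp) ?_
  · exact key (mem_ball_zero_iff.2 hz)
  let J : ℕ → NZ := fun n => ⟨(n : ℤ) + 1, by omega⟩
  have hJ : Tendsto (fun n : ℕ => ((rbranch β (J n) x : ℝ) : ℂ)) atTop (𝓝[≠] 0) := by
    refine tendsto_nhdsWithin_iff.2 ⟨?_, Eventually.of_forall fun n => ?_⟩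
    · rw [show (0 : ℂ) = ((0 : ℝ) : ℂ) by simp]
      refine (Complex.continuous_ofReal.tendsto 0).comp ?_
      simp only [rbranch]
      refine tendsto_const_nhds.div_atTop ?_
      refine tendsto_atTop_add_const_left _ _ ?_
      refine Tendsto.const_mul_atTop two_pos ?_
      have : Tendsto (fun n : ℕ => (n : ℝ) + 1) atTop atTop :=
        tendsto_atTop_add_const_right _ _ tendsto_natCast_atTop_atTop
      refine this.congr fun n => ?_
      simp [J]
    · have h0 := one_lt_sq_add hx (J n)
      have h1 : x + 2 * (((J n) : ℤ) : ℝ) ≠ 0 := by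
        intro h; rw [h] at h0; norm_num at h0
      have : rbranch β (J n) x ≠ 0 := div_ne_zero (neg_ne_zero.2 hβ.ne') h1
      simpa using this
  refine hJ.frequently (Frequently.of_forall fun n => ?_)
  have hb := abs_rbranch_lt hβ hβ1 hx (J n)
  rw [eq_ratio_mul h hb, ratio_eq_of_max hβ hβ1 hc hx heq (J n), rho]
  push_cast
  rfl

lemma exists_main_branch {x : ℝ} (hx : |x| < 1) : ∃ j₀ : NZ,
    |rbranch 1 j₀ x| = 1 / (2 - |x|) ∧ wt 1 j₀ x = (1 + |x|) / (3 - |x|) ∧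
    ∀ j : NZ, j ≠ j₀ → |rbranch 1 j x| ≤ 1 / 2 := by
  have hsplit : ∀ j : NZ, (j : ℤ) ≤ -1 ∨ 1 ≤ (j : ℤ) := fun j => by have := j.2; omega
  have hbound : ∀ j : NZ, 2 ≤ |x + 2 * ((j : ℤ) : ℝ)| → |rbranch 1 j x| ≤ 1 / 2 := by
    intro j h
    rw [rbranch, abs_div, abs_neg, abs_one]
    exact one_div_le_one_div_of_le two_pos h
  rcases le_total 0 x with h | h
  · rw [abs_of_nonneg h] at hx ⊢
    refine ⟨⟨-1, by norm_num⟩, ?_, ?_, ?_⟩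
    · rw [rbranch, abs_div, abs_neg, abs_one]
      push_cast
      rw [abs_of_nonpos (by linarith)]
      congr 1; ring
    · rw [wt]
      push_cast
      rw [show (x + 2 * -1) ^ 2 - 1 ^ 2 = (3 - x) * (1 - x) by ring]
      have h1 : 3 - x ≠ 0 := by linarith
      have h2 : 1 - x ≠ 0 := by linarith
      field_simp
      ring
    · intro j hj
      apply hbound
      rcases hsplit j with h1 | h1
      · have h2 : (j : ℤ) ≠ -1 := fun e => hj (Subtype.ext e)
        have h3 : (j : ℤ) ≤ -2 := by omega
        have h4 : ((j : ℤ) : ℝ) ≤ -2 := by exact_mod_cast h3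
        rw [le_abs]; right; linarith
      · have h4 : (1 : ℝ) ≤ ((j : ℤ) : ℝ) := by exact_mod_cast h1
        rw [le_abs]; left; linarith
  · rw [abs_of_nonpos h] at hx ⊢
    refine ⟨⟨1, by norm_num⟩, ?_, ?_, ?_⟩
    · rw [rbranch, abs_div, abs_neg, abs_one]
      push_cast
      rw [abs_of_nonneg (by linarith)]
      congr 1; ring
    · rw [wt]
      push_cast
      rw [show (x + 2 * 1) ^ 2 - 1 ^ 2 = (3 - -x) * (1 + x) by ring]
      have h1 : 3 - -x ≠ 0 := by linarith
      have h2 : 1 + x ≠ 0 := by linarith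
      rw [div_eq_div_iff (mul_ne_zero h1 h2) h1]
      ring
    · intro j hj
      apply hbound
      rcases hsplit j with h1 | h1
      · have h4 : ((j : ℤ) : ℝ) ≤ -1 := by exact_mod_cast h1
        rw [le_abs]; right; linarith
      · have h2 : (j : ℤ) ≠ 1 := fun e => hj (Subtype.ext e)
        have h3 : 2 ≤ (j : ℤ) := by omega
        have h4 : (2 : ℝ) ≤ ((j : ℤ) : ℝ) := by exact_mod_cast h3
        rw [le_abs]; left; linarith

lemma tsum_le_step {r : ℝ → ℝ} {C M : ℝ} (hM : 0 ≤ M)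
    (hr : ∀ x, |x| ≤ 1 / 2 → r x ≤ M) {n : ℕ}
    (hn : ∀ x, |x| < 1 → r x ≤ M + C * ((1 + |x|) / ((1 + |x|) + 2 * n * (1 - |x|))))
    {x : ℝ} (hx : |x| < 1) (hs : Summable (fun j : NZ => wt 1 j x * r (rbranch 1 j x))) :
    ∑' j : NZ, wt 1 j x * r (rbranch 1 j x) ≤
      M + C * ((1 + |x|) / ((1 + |x|) + 2 * (n + 1 : ℕ) * (1 - |x|))) := by
  obtain ⟨j₀, h1, h2, h3⟩ := exists_main_branch hx
  obtain ⟨hw, hw1⟩ := wt_hasSum one_pos le_rfl hx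
  set D : ℝ := C * ((1 + |x|) / ((1 + |x|) + 2 * (n + 1 : ℕ) * (1 - |x|))) with hD
  have hx0 := abs_nonneg x
  have hsum : HasSum (fun j : NZ => wt 1 j x * M + if j = j₀ then D else 0)
      ((∑' j : NZ, wt 1 j x) * M + D) := (hw.hasSum.mul_right M).add (hasSum_ite_eq j₀ D)
  have hle := hasSum_le (fun j => ?_) hs.hasSum hsum
  · refine hle.trans ?_
    nlinarith
  have hp := (wt_pos one_pos le_rfl hx j).le
  by_cases hj : j = j₀
  · subst hj
    rw [if_pos rfl]
    have hb := hn _ (abs_rbranch_lt one_pos le_rfl hx j)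
    have e : wt 1 j x * (C * ((1 + |rbranch 1 j x|) /
        ((1 + |rbranch 1 j x|) + 2 * n * (1 - |rbranch 1 j x|)))) = D := by
      rw [h1, h2, hD]
      have a1 : 2 - |x| ≠ 0 := by linarith
      have a2 : 3 - |x| ≠ 0 := by linarith
      have a3 : (1 : ℝ) + |x| + 2 * ((n + 1 : ℕ) : ℝ) * (1 - |x|) ≠ 0 := by
        have : 0 ≤ 2 * ((n + 1 : ℕ) : ℝ) * (1 - |x|) := by
          have : 0 ≤ 1 - |x| := by linarith
          positivity
        linarith
      have e1 : (1 : ℝ) + 1 / (2 - |x|) = (3 - |x|) / (2 - |x|) := by field_simp; ring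
      have e2 : (1 : ℝ) + 1 / (2 - |x|) + 2 * n * (1 - 1 / (2 - |x|)) =
          (1 + |x| + 2 * ((n + 1 : ℕ) : ℝ) * (1 - |x|)) / (2 - |x|) := by
        push_cast
        field_simp; ring
      rw [e2, e1]
      field_simp
    rw [← e, ← mul_add]
    exact mul_le_mul_of_nonneg_left hb hp
  · rw [if_neg hj, add_zero]
    exact mul_le_mul_of_nonneg_left (hr _ (h3 j hj)) hp

lemma le_of_le_half {r s : ℝ → ℝ} {C M : ℝ} (hM : 0 ≤ M)
    (hrC : ∀ x, |x| < 1 → r x ≤ C) (hsC : ∀ x, |x| < 1 → s x ≤ C)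
    (hrM : ∀ x, |x| ≤ 1 / 2 → r x ≤ M) (hsM : ∀ x, |x| ≤ 1 / 2 → s x ≤ M)
    (hr : ∀ x, |x| < 1 → Summable (fun j : NZ => wt 1 j x * s (rbranch 1 j x)) ∧
      r x ≤ ∑' j : NZ, wt 1 j x * s (rbranch 1 j x))
    (hs : ∀ x, |x| < 1 → Summable (fun j : NZ => wt 1 j x * r (rbranch 1 j x)) ∧
      s x ≤ ∑' j : NZ, wt 1 j x * r (rbranch 1 j x)) {x : ℝ} (hx : |x| < 1) :
    r x ≤ M ∧ s x ≤ M := by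
  have key : ∀ n : ℕ, ∀ x, |x| < 1 →
      r x ≤ M + C * ((1 + |x|) / ((1 + |x|) + 2 * n * (1 - |x|))) ∧
      s x ≤ M + C * ((1 + |x|) / ((1 + |x|) + 2 * n * (1 - |x|))) := by
    intro n
    induction n with
    | zero =>
      intro x hx
      have : (1 : ℝ) + |x| ≠ 0 := by positivity
      simp only [Nat.cast_zero, mul_zero, zero_mul, add_zero, div_self this, mul_one]
      exact ⟨by linarith [hrC x hx], by linarith [hsC x hx]⟩
    | succ n ih =>
      intro x hx
      exact ⟨(hr x hx).2.trans (tsum_le_step hM hsM (fun y hy => (ih y hy).2) hx (hr x hx).1),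
        (hs x hx).2.trans (tsum_le_step hM hrM (fun y hy => (ih y hy).1) hx (hs x hx).1)⟩
  have hlim : Tendsto (fun n : ℕ => M + C * ((1 + |x|) / ((1 + |x|) + 2 * n * (1 - |x|)))) atTop
      (𝓝 (M + C * 0)) := by
    refine tendsto_const_nhds.add (tendsto_const_nhds.mul ?_)
    refine tendsto_const_nhds.div_atTop ?_
    refine tendsto_atTop_add_const_left _ _ ?_
    exact (tendsto_natCast_atTop_atTop.const_mul_atTop two_pos).atTop_mul_const (by linarith)
  rw [mul_zero, add_zero] at hlim
  exact ⟨ge_of_tendsto' hlim fun n => (key n x hx).1, ge_of_tendsto' hlim fun n => (key n x hx).2⟩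

lemma continuousOn_norm_ratio {h : ℂ → ℂ} (hd : DifferentiableOn ℂ h (Metric.ball 0 1)) {a : ℝ}
    (ha : a < 1) : ContinuousOn (fun x => ‖ratio h x‖) (Icc (-a) a) := by
  refine ContinuousOn.norm ?_
  unfold ratio
  have hlt : ∀ x ∈ Icc (-a) a, |x| < 1 := fun x hx => (abs_le.2 hx).trans_lt ha
  refine ContinuousOn.div ?_ ?_ ?_
  · refine hd.continuousOn.comp Complex.continuous_ofReal.continuousOn fun x hx => ?_
    exact mem_ball_zero_iff.2 (norm_ofReal_lt (hlt x hx))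
  · refine Complex.continuous_ofReal.comp_continuousOn ?_
    unfold rho
    refine ContinuousOn.div (by fun_prop) (by fun_prop) fun x hx => ?_
    exact (one_sub_sq_pos (hlt x hx)).ne'
  · intro x hx
    exact_mod_cast (rho_pos (hlt x hx)).ne'

lemma bounded_by_core {β : ℝ} (hβ : 0 < β) (hβ1 : β ≤ 1) : ∃ a : ℝ, 0 ≤ a ∧ a < 1 ∧
    ∀ (h₁ h₂ : ℂ → ℂ) (C M : ℝ),
    (∀ x : ℝ, |x| < 1 → ‖h₁ x‖ ≤ C * rho x) → (∀ x : ℝ, |x| < 1 → ‖h₂ x‖ ≤ C * rho x) →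
    (∀ x : ℝ, |x| < 1 → h₁ x = transfer β h₂ x) → (∀ x : ℝ, |x| < 1 → h₂ x = transfer β h₁ x) →
    (∀ x : ℝ, |x| ≤ a → ‖ratio h₁ x‖ ≤ M) → (∀ x : ℝ, |x| ≤ a → ‖ratio h₂ x‖ ≤ M) →
    ∀ x : ℝ, |x| < 1 → ‖ratio h₁ x‖ ≤ M ∧ ‖ratio h₂ x‖ ≤ M := by
  have hstep : ∀ (h₁ h₂ : ℂ → ℂ) (C : ℝ), (∀ x : ℝ, |x| < 1 → ‖h₂ x‖ ≤ C * rho x) →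
      (∀ x : ℝ, |x| < 1 → h₁ x = transfer β h₂ x) → ∀ x : ℝ, |x| < 1 →
      Summable (fun j : NZ => wt β j x * ‖ratio h₂ (rbranch β j x)‖) ∧
      ‖ratio h₁ x‖ ≤ ∑' j : NZ, wt β j x * ‖ratio h₂ (rbranch β j x)‖ := by
    intro h₁ h₂ C hC h x hx
    rw [show ratio h₁ x = ratio (transfer β h₂) x by rw [ratio, ratio, h x hx]]
    exact norm_ratio_transfer_le hβ hβ1 hC hx
  rcases hβ1.lt_or_eq with hlt | rfl
  · refine ⟨β, hβ.le, hlt, fun h₁ h₂ C M h1 h2 e1 e2 m1 m2 => ?_⟩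
    have hM : 0 ≤ M := (norm_nonneg _).trans (m1 0 (by simpa using hβ.le))
    have aux : ∀ (h₁ h₂ : ℂ → ℂ), (∀ x : ℝ, |x| < 1 → ‖h₂ x‖ ≤ C * rho x) →
        (∀ x : ℝ, |x| < 1 → h₁ x = transfer β h₂ x) → (∀ x : ℝ, |x| ≤ β → ‖ratio h₂ x‖ ≤ M) →
        ∀ x : ℝ, |x| < 1 → ‖ratio h₁ x‖ ≤ M := by
      intro h₁ h₂ h2 e1 m2 x hx
      obtain ⟨hs, hle⟩ := hstep h₁ h₂ C h2 e1 x hx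
      obtain ⟨hw, hw1⟩ := wt_hasSum hβ hβ1 hx
      refine hle.trans ?_
      have : ∑' j : NZ, wt β j x * ‖ratio h₂ (rbranch β j x)‖ ≤ ∑' j : NZ, wt β j x * M := by
        refine hs.tsum_le_tsum (fun j => ?_) (hw.mul_right M)
        refine mul_le_mul_of_nonneg_left (m2 _ ?_) (wt_pos hβ hβ1 hx j).le
        have h0 := one_lt_sq_add hx j
        rw [one_lt_sq_iff_one_lt_abs] at h0
        rw [rbranch, abs_div, abs_neg, abs_of_pos hβ]
        exact div_le_self hβ.le h0.le
      refine this.trans ?_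
      rw [tsum_mul_right]
      nlinarith
    exact fun x hx => ⟨aux h₁ h₂ h2 e1 m2 x hx, aux h₂ h₁ h1 e2 m1 x hx⟩
  · refine ⟨1 / 2, by norm_num, by norm_num, fun h₁ h₂ C M h1 h2 e1 e2 m1 m2 x hx => ?_⟩
    have hM : 0 ≤ M := (norm_nonneg _).trans (m1 0 (by norm_num))
    exact le_of_le_half (r := fun x => ‖ratio h₁ x‖) (s := fun x => ‖ratio h₂ x‖) hM
      (fun x hx => norm_ratio_le hx (h1 x hx)) (fun x hx => norm_ratio_le hx (h2 x hx)) m1 m2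
      (hstep h₁ h₂ C h2 e1) (hstep h₂ h₁ C h1 e2) hx

lemma norm_le_of_ratio {h : ℂ → ℂ} {x M : ℝ} (hx : |x| < 1) (hM : ‖ratio h x‖ ≤ M) :
    ‖h x‖ ≤ M * rho x := by
  have := rho_pos hx
  rw [eq_ratio_mul h hx, norm_mul, Complex.norm_real, Real.norm_of_nonneg this.le]
  exact mul_le_mul_of_nonneg_right hM this.le

/-- A pair of holomorphic functions exchanged by the transfer operator and dominated by the
invariant density is a multiple of the invariant density. -/
lemma eq_density_of_exchange {β : ℝ} (hβ : 0 < β) (hβ1 : β ≤ 1) {h₁ h₂ : ℂ → ℂ} {C : ℝ}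
    (d₁ : DifferentiableOn ℂ h₁ (Metric.ball 0 1)) (d₂ : DifferentiableOn ℂ h₂ (Metric.ball 0 1))
    (b₁ : ∀ x : ℝ, |x| < 1 → ‖h₁ x‖ ≤ C * rho x) (b₂ : ∀ x : ℝ, |x| < 1 → ‖h₂ x‖ ≤ C * rho x)
    (e₁ : ∀ x : ℝ, |x| < 1 → h₁ x = transfer β h₂ x)
    (e₂ : ∀ x : ℝ, |x| < 1 → h₂ x = transfer β h₁ x) :
    ∃ c : ℂ, ∀ z : ℂ, ‖z‖ < 1 → h₁ z = c * (2 / (1 - z ^ 2)) := by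
  obtain ⟨a, ha0, ha1, hcore⟩ := bounded_by_core hβ hβ1
  have hne : (Icc (-a) a).Nonempty := ⟨0, by simp [ha0]⟩
  obtain ⟨x₁, hx₁, hm₁⟩ := isCompact_Icc.exists_isMaxOn hne (continuousOn_norm_ratio d₁ ha1)
  obtain ⟨x₂, hx₂, hm₂⟩ := isCompact_Icc.exists_isMaxOn hne (continuousOn_norm_ratio d₂ ha1)
  have hm₁' : ∀ x : ℝ, |x| ≤ a → ‖ratio h₁ x‖ ≤ ‖ratio h₁ x₁‖ := fun x hx => hm₁ (abs_le.1 hx)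
  have hm₂' : ∀ x : ℝ, |x| ≤ a → ‖ratio h₂ x‖ ≤ ‖ratio h₂ x₂‖ := fun x hx => hm₂ (abs_le.1 hx)
  have hx₁' : |x₁| < 1 := (abs_le.2 hx₁).trans_lt ha1
  have hx₂' : |x₂| < 1 := (abs_le.2 hx₂).trans_lt ha1
  have aux : ∀ (h₁ h₂ : ℂ → ℂ) (x : ℝ), DifferentiableOn ℂ h₁ (Metric.ball 0 1) →
      DifferentiableOn ℂ h₂ (Metric.ball 0 1) →
      (∀ x : ℝ, |x| < 1 → h₁ x = transfer β h₂ x) →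
      (∀ x : ℝ, |x| < 1 → h₂ x = transfer β h₁ x) → |x| < 1 →
      (∀ y : ℝ, |y| < 1 → ‖ratio h₁ y‖ ≤ ‖ratio h₁ x‖ ∧ ‖ratio h₂ y‖ ≤ ‖ratio h₁ x‖) →
      ∀ z : ℂ, ‖z‖ < 1 → h₁ z = ratio h₁ x * (2 / (1 - z ^ 2)) ∧
        h₂ z = ratio h₁ x * (2 / (1 - z ^ 2)) := by
    intro h₁ h₂ x d₁ d₂ e₁ e₂ hx hb
    have k₂ : ∀ z : ℂ, ‖z‖ < 1 → h₂ z = ratio h₁ x * (2 / (1 - z ^ 2)) := fun z hz =>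
      eq_density_of_max hβ hβ1 d₂ (fun y hy => norm_le_of_ratio hy (hb y hy).2) hx
        (by rw [ratio, ratio, e₁ x hx]) hz
    refine fun z hz => ⟨eq_density_of_max hβ hβ1 d₁
      (fun y hy => norm_le_of_ratio hy (hb y hy).1) hx ?_ hz, k₂ z hz⟩
    have : ((rho x : ℝ) : ℂ) ≠ 0 := by exact_mod_cast (rho_pos hx).ne'
    rw [ratio, ← e₂ x hx, k₂ x (norm_ofReal_lt hx), div_eq_iff this, rho]
    push_cast
    rfl
  rcases le_total ‖ratio h₁ x₁‖ ‖ratio h₂ x₂‖ with hle | hle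
  · have := hcore h₁ h₂ C ‖ratio h₂ x₂‖ b₁ b₂ e₁ e₂ (fun x hx => (hm₁' x hx).trans hle) hm₂'
    exact ⟨_, fun z hz => (aux h₂ h₁ x₂ d₂ d₁ e₂ e₁ hx₂' (fun y hy => (this y hy).symm) z hz).2⟩
  · have := hcore h₁ h₂ C ‖ratio h₁ x₁‖ b₁ b₂ e₁ e₂ hm₁' (fun x hx => (hm₂' x hx).trans hle)
    exact ⟨_, fun z hz => (aux h₁ h₂ x₁ d₁ d₂ e₁ e₂ hx₁' this z hz).1⟩

lemma norm_cauchy_le {g : ℝ → ℂ} (hg : Integrable g) (p : ℝ → ℝ) {w : ℂ} {η : ℝ} (hη : 0 < η)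
    (hw : w.im ≤ -η) : ‖cauchy g p w‖ ≤ 1 / η * ∫ t, ‖g t‖ :=
  norm_integral_mul_le hg fun t => norm_one_div_sub_le (p t) hη hw

lemma summable_transfer_cauchy {β : ℝ} (hβ : 0 < β) (hβ1 : β ≤ 1) {g : ℝ → ℂ}
    (hg : Integrable g) (p : ℝ → ℝ) {z : ℂ} (hz : ‖z‖ < 1) (hi : z.im < 0) {ε : ℝ} (hε : 0 < ε) :
    Summable (fun j : NZ => β / (z + 2 * (j : ℤ)) ^ 2 *
      cauchy g p (branch β j z - ε * Complex.I)) := by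
  refine Summable.of_norm_bounded (summable_inv_sq_nonzero.mul_right (1 / ε * ∫ t, ‖g t‖))
    fun j => ?_
  rw [norm_mul]
  gcongr
  · exact norm_weight_le hβ hβ1 hz j
  · refine norm_cauchy_le hg p hε ?_
    have := branch_im_neg hβ hz hi j
    simp
    linarith

/-- Applying the transfer operator to an identity between Cauchy integrals on the lower half of
the unit disc. -/
lemma transfer_cauchy_identity {β : ℝ} (hβ : 0 < β) (hβ1 : β ≤ 1) {g₁ g₂ : ℝ → ℂ}
    (hg₁ : Integrable g₁) (hg₂ : Integrable g₂) {p₁ p₂ : ℝ → ℝ} (hp₁ : Measurable p₁)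
    (hp₂ : Measurable p₂) (h₁ : ∀ᵐ t, g₁ t = 0 ∨ p₁ t ≠ 0) (h₂ : ∀ᵐ t, g₂ t = 0 ∨ p₂ t ≠ 0)
    {H : ℂ → ℂ} (hH : ContinuousOn H (Metric.ball 0 1)) {c : ℂ}
    (heq : ∀ z : ℂ, ‖z‖ < 1 → z.im < 0 → cauchy g₁ p₁ z + H z = c * cauchy g₂ p₂ z)
    {z : ℂ} (hz : ‖z‖ < 1) (hi : z.im < 0) :
    (∫ t, g₁ t * polar ((-β / p₁ t : ℝ) : ℂ) z) + transfer β H z =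
      c * ∫ t, g₂ t * polar ((-β / p₂ t : ℝ) : ℂ) z := by
  have l₁ := tendsto_transfer_cauchy hβ hβ1 hg₁ hp₁ h₁ hz hi
  have l₂ := (tendsto_transfer_cauchy hβ hβ1 hg₂ hp₂ h₂ hz hi).const_mul c
  have hδ : Tendsto (fun ε : ℝ => (ε : ℂ) * Complex.I) (𝓝[>] 0) (𝓝 0) := by
    have : Continuous (fun ε : ℝ => (ε : ℂ) * Complex.I) := by fun_prop
    have h := this.tendsto 0
    simp only [Complex.ofReal_zero, zero_mul] at h
    exact h.mono_left nhdsWithin_le_nhds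
  have l₃ := tendsto_transfer hβ hβ1 hH (l := 𝓝[>] (0 : ℝ)) (u := fun _ => z)
    (δ := fun ε : ℝ => (ε : ℂ) * Complex.I) hz tendsto_const_nhds hδ
  refine tendsto_nhds_unique ((l₁.add l₃).congr' ?_) l₂
  have h3 : 0 < 1 - 1 / (2 - ‖z‖) := by
    have : 1 / (2 - ‖z‖) < 1 := by rw [div_lt_one] <;> linarith
    linarith
  filter_upwards [Ioo_mem_nhdsGT h3] with ε hε
  have hw : ∀ j : NZ, ‖branch β j z - ε * Complex.I‖ < 1 ∧
      (branch β j z - ε * Complex.I).im < 0 := by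
    intro j
    constructor
    · have h4 := norm_branch_le hβ hβ1 hz j
      have h5 := norm_sub_le (branch β j z) (ε * Complex.I)
      rw [norm_mul, Complex.norm_I, Complex.norm_real, Real.norm_of_nonneg hε.1.le] at h5
      linarith [hε.2]
    · have := branch_im_neg hβ hz hi j
      have := hε.1
      simp
      linarith
  have s₁ := summable_transfer_cauchy hβ hβ1 hg₁ p₁ hz hi hε.1
  have s₂ := summable_transfer_cauchy hβ hβ1 hg₂ p₂ hz hi hε.1
  have e : ∀ j : NZ, (β : ℂ) / (z + 2 * (j : ℤ)) ^ 2 * H (branch β j z - ε * Complex.I) =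
      c * (β / (z + 2 * (j : ℤ)) ^ 2 * cauchy g₂ p₂ (branch β j z - ε * Complex.I)) -
      β / (z + 2 * (j : ℤ)) ^ 2 * cauchy g₁ p₁ (branch β j z - ε * Complex.I) := by
    intro j
    have := heq _ (hw j).1 (hw j).2
    linear_combination (β : ℂ) / (z + 2 * (j : ℤ)) ^ 2 * this
  simp only [e]
  rw [(s₂.mul_left c).tsum_sub s₁, tsum_mul_left]
  ring

/-- The orbit of a point under the Gauss-type map. -/
noncomputable def orb (β : ℝ) (n : ℕ) (t : ℝ) : ℝ := (tau β)^[n] t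

/-- The indicator of the points whose first `n` iterates remain in `(-β, β)`. -/
noncomputable def alive (β : ℝ) : ℕ → ℝ → ℝ
  | 0, t => if -1 ≤ t ∧ t < 1 then 1 else 0
  | n + 1, t => alive β n t * (if |orb β n t| < β then 1 else 0)

/-- The densities produced by iterating the transfer operator on a Cauchy kernel. -/
noncomputable def ker (β : ℝ) : ℕ → ℝ → ℝ → ℝ
  | 0, t, y => -((1 - alive β 0 t) * seg (-β / t) y)
  | n + 1, t, y => alive β n t * corr β (orb β n t) y +
      (if |tau β y| < β then ker β n t (tau β y) else 0)

/-- Integration of a kernel in its first variable. -/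
noncomputable def smear (f : ℝ → ℂ) (k : ℝ → ℝ → ℝ) (y : ℝ) : ℂ := ∫ t, f t * (k t y : ℝ)

@[fun_prop]
lemma measurable_orb (β : ℝ) (n : ℕ) : Measurable (orb β n) := (measurable_tau β).iterate n

lemma measurable_alive (β : ℝ) (n : ℕ) : Measurable (alive β n) := by
  induction n with
  | zero => exact Measurable.ite measurableSet_Ico measurable_const measurable_const
  | succ n ih =>
    refine ih.mul (Measurable.ite ?_ measurable_const measurable_const)
    exact measurableSet_lt (by fun_prop) measurable_const

lemma alive_eq (β : ℝ) (n : ℕ) (t : ℝ) : alive β n t = 0 ∨ alive β n t = 1 := by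
  induction n with
  | zero => unfold alive; split_ifs <;> simp
  | succ n ih =>
    unfold alive
    rcases ih with h | h <;> rw [h] <;> split_ifs <;> simp

lemma alive_nonneg (β : ℝ) (n : ℕ) (t : ℝ) : 0 ≤ alive β n t := by
  rcases alive_eq β n t with h | h <;> simp [h]

lemma alive_le_one (β : ℝ) (n : ℕ) (t : ℝ) : alive β n t ≤ 1 := by
  rcases alive_eq β n t with h | h <;> simp [h]

lemma norm_alive_le (β : ℝ) (n : ℕ) (t : ℝ) : ‖((alive β n t : ℝ) : ℂ)‖ ≤ 1 := by
  rw [Complex.norm_real, Real.norm_of_nonneg (alive_nonneg β n t)]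
  exact alive_le_one β n t

lemma measurable_seg_comp {X : Type*} [MeasurableSpace X] {u v : X → ℝ} (hu : Measurable u)
    (hv : Measurable v) : Measurable (fun x => seg (u x) (v x)) := by
  unfold seg
  exact (Measurable.ite (measurableSet_lt hv hu) measurable_const measurable_const).sub
    (Measurable.ite (measurableSet_lt hv measurable_const) measurable_const measurable_const)

lemma measurable_corr_comp {X : Type*} [MeasurableSpace X] {β : ℝ} {u v : X → ℝ}
    (hu : Measurable u) (hv : Measurable v) : Measurable (fun x => corr β (u x) (v x)) := by
  unfold corr
  refine (Measurable.ite (measurableSet_lt hu.abs measurable_const)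
    (measurable_seg_comp hu hv) measurable_const).sub (measurable_seg_comp ?_ ?_)
  · exact (measurable_tau β).comp hu
  · exact (measurable_tau β).comp hv

lemma measurable_ker_comp {X : Type*} [MeasurableSpace X] {β : ℝ} (n : ℕ) {u v : X → ℝ}
    (hu : Measurable u) (hv : Measurable v) : Measurable (fun x => ker β n (u x) (v x)) := by
  induction n generalizing v with
  | zero =>
    unfold ker
    refine (((measurable_const.sub ((measurable_alive β 0).comp hu))).mul
      (measurable_seg_comp ?_ hv)).neg
    exact measurable_const.div hu
  | succ n ih =>
    unfold ker
    have hv' : Measurable (fun x => tau β (v x)) := (measurable_tau β).comp hv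
    refine (((measurable_alive β n).comp hu).mul
      (measurable_corr_comp ((measurable_orb β n).comp hu) hv)).add ?_
    exact Measurable.ite (measurableSet_lt hv'.abs measurable_const) (ih hv') measurable_const

lemma abs_corr_le (β t y : ℝ) : |corr β t y| ≤ 2 := by
  unfold corr
  have h1 := abs_seg_le t y
  have h2 := abs_seg_le (tau β t) (tau β y)
  split_ifs
  · exact (abs_sub _ _).trans (by linarith)
  · rw [zero_sub, abs_neg]; linarith

lemma abs_alive_mul_corr_le (β : ℝ) (n : ℕ) (t y : ℝ) :
    |alive β n t * corr β (orb β n t) y| ≤ 2 := by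
  rw [abs_mul, abs_of_nonneg (alive_nonneg β n t)]
  have := alive_le_one β n t
  have := alive_nonneg β n t
  have := abs_corr_le β (orb β n t) y
  nlinarith [abs_nonneg (corr β (orb β n t) y)]

lemma abs_ker_le (β : ℝ) (n : ℕ) (t y : ℝ) : |ker β n t y| ≤ 2 * n + 1 := by
  induction n generalizing y with
  | zero =>
    unfold ker
    rw [abs_neg, abs_mul]
    have h1 := abs_seg_le (-β / t) y
    have h2 := alive_le_one β 0 t
    have h3 := alive_nonneg β 0 t
    rw [abs_of_nonneg (by linarith)]
    push_cast
    nlinarith [abs_nonneg (seg (-β / t) y)]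
  | succ n ih =>
    unfold ker
    refine (abs_add_le _ _).trans ?_
    have h1 := abs_alive_mul_corr_le β n t y
    have h2 : |if |tau β y| < β then ker β n t (tau β y) else 0| ≤ 2 * n + 1 := by
      split_ifs
      · exact ih _
      · simp; positivity
    push_cast
    linarith

lemma integrable_mul_ofReal {f : ℝ → ℂ} (hf : Integrable f) {k : ℝ → ℝ} (hk : Measurable k) {B : ℝ}
    (hB : ∀ t, |k t| ≤ B) : Integrable (fun t => f t * (k t : ℝ)) :=
  integrable_mul_bounded hf (Complex.measurable_ofReal.comp hk) (B := B)
    fun t => by rw [Complex.norm_real]; exact hB t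

lemma measurable_smear {f : ℝ → ℂ} (hf : Integrable f) {k : ℝ → ℝ → ℝ}
    (hk : Measurable (Function.uncurry k)) : Measurable (smear f k) := by
  have e : smear f k = smear (hf.1.mk f) k := by
    funext y
    refine integral_congr_ae ?_
    filter_upwards [hf.1.ae_eq_mk] with t ht
    rw [ht]
  rw [e]
  have hm : StronglyMeasurable (fun p : ℝ × ℝ => hf.1.mk f p.2 * (k p.2 p.1 : ℝ)) := by
    refine StronglyMeasurable.mul (hf.1.stronglyMeasurable_mk.comp_measurable measurable_snd) ?_
    exact (Complex.measurable_ofReal.comp (hk.comp measurable_swap)).stronglyMeasurable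
  exact hm.integral_prod_right.measurable

lemma norm_smear_le {f : ℝ → ℂ} (hf : Integrable f) {k : ℝ → ℝ → ℝ} {B : ℝ}
    (hB : ∀ t y, |k t y| ≤ B) (y : ℝ) : ‖smear f k y‖ ≤ B * ∫ t, ‖f t‖ :=
  norm_integral_mul_le hf fun t => by rw [Complex.norm_real]; exact hB t y

lemma integral_mul_disk {β : ℝ} (hβ : 0 < β) {f : ℝ → ℂ} (hf : Integrable f) {k : ℝ → ℝ → ℝ}
    (hk : Measurable (Function.uncurry k)) {B : ℝ} (hB : ∀ t y, |k t y| ≤ B) {z : ℂ}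
    (hz : ‖z‖ < 1) :
    Integrable (fun t => f t * disk β (fun y => (k t y : ℝ)) z) ∧
    ∫ t, f t * disk β (fun y => (k t y : ℝ)) z = disk β (smear f k) z := by
  have h1 := integrableOn_disk hβ (θ := fun _ => 1) measurable_const (R := 1) (by simp) hz
  have h2 : Integrable (fun p : ℝ × ℝ => (k p.1 p.2 : ℂ) *
      (f p.1 * (1 * ((β : ℂ) / (β + p.2 * z) ^ 2))))
      (volume.prod (volume.restrict (Ioo (-β) β))) := by
    refine (hf.mul_prod h1).bdd_mul (c := B) ?_ (Eventually.of_forall fun p => ?_)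
    · exact (Complex.measurable_ofReal.comp hk).aestronglyMeasurable
    · rw [Complex.norm_real]; exact hB _ _
  have e : ∀ t, f t * disk β (fun y => (k t y : ℝ)) z = ∫ y in Ioo (-β) β, (k t y : ℂ) *
      (f t * (1 * ((β : ℂ) / (β + y * z) ^ 2))) := by
    intro t
    rw [disk, ← integral_const_mul]
    refine integral_congr_ae (Eventually.of_forall fun y => ?_)
    simp only
    ring
  simp only [e]
  refine ⟨h2.integral_prod_left, ?_⟩
  rw [integral_integral_swap h2, disk]
  refine integral_congr_ae (Eventually.of_forall fun y => ?_)
  simp only [smear]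
  rw [← integral_mul_const]
  refine integral_congr_ae (Eventually.of_forall fun t => ?_)
  simp only
  ring

lemma disk_add {β : ℝ} (hβ : 0 < β) {θ φ : ℝ → ℂ} (hθ : Measurable θ) (hφ : Measurable φ)
    {R S : ℝ} (hR : ∀ y, ‖θ y‖ ≤ R) (hS : ∀ y, ‖φ y‖ ≤ S) {z : ℂ} (hz : ‖z‖ < 1) :
    disk β (fun y => θ y + φ y) z = disk β θ z + disk β φ z := by
  unfold disk
  rw [← integral_add (integrableOn_disk hβ hθ hR hz) (integrableOn_disk hβ hφ hS hz)]
  simp only [add_mul]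

lemma countable_preimage_tau {β : ℝ} (hβ : 0 < β) {s : Set ℝ} (hs : s.Countable) :
    (tau β ⁻¹' s).Countable := by
  refine Countable.mono ?_ (hs.biUnion fun a _ => countable_range fun k : ℤ => -β / (a + 2 * k))
  intro t ht
  refine mem_biUnion ht ⟨⌊(-β / t + 1) / 2⌋, ?_⟩
  simp only [tau, red, sub_add_cancel]
  rcases eq_or_ne t 0 with rfl | h
  · simp
  have := hβ.ne'
  field_simp

lemma countable_preimage_orb {β : ℝ} (hβ : 0 < β) (n : ℕ) {s : Set ℝ} (hs : s.Countable) :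
    (orb β n ⁻¹' s).Countable := by
  induction n generalizing s with
  | zero => exact hs
  | succ n ih =>
    have : orb β (n + 1) ⁻¹' s = orb β n ⁻¹' (tau β ⁻¹' s) := by
      ext t
      simp [orb, Function.iterate_succ_apply']
    rw [this]
    exact ih (countable_preimage_tau hβ hs)

lemma ae_orb_notMem {β : ℝ} (hβ : 0 < β) (n : ℕ) {s : Set ℝ} (hs : s.Countable) : ∀ᵐ t, orb β n t ∉ s :=
  (countable_preimage_orb hβ n hs).ae_notMem volume

lemma integrable_mul_alive (β : ℝ) {f : ℝ → ℂ} (hf : Integrable f) (n : ℕ) :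
    Integrable (fun t => f t * (alive β n t : ℝ)) :=
  integrable_mul_bounded hf (Complex.measurable_ofReal.comp (measurable_alive β n))
    (norm_alive_le β n)

lemma cauchy_add_disk_zero {β : ℝ} (hβ : 0 < β) {f : ℝ → ℂ} (hf : Integrable f) {z : ℂ}
    (hz : ‖z‖ < 1) (hi : z.im < 0) :
    cauchy (fun t => f t * (alive β 0 t : ℝ)) (orb β 0) z + disk β (smear f (ker β 0)) z =
      cauchy f id z := by
  obtain ⟨h_int, he⟩ := integral_mul_disk hβ hf (k := ker β 0)
    (measurable_ker_comp 0 measurable_fst measurable_snd) (abs_ker_le β 0) hz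
  rw [← he]
  unfold cauchy
  have hη : 0 < -z.im := by linarith
  rw [← integral_add _ h_int]
  · refine integral_congr_ae (Eventually.of_forall fun t => ?_)
    simp only [ker, id]
    by_cases ht : -1 ≤ t ∧ t < 1
    · simp [alive, ht, orb, disk]
    · have ht1 : 1 ≤ |t| := by
        by_contra h
        rw [not_le, abs_lt] at h
        exact ht ⟨h.1.le, h.2⟩
      have ht0 : t ≠ 0 := by rintro rfl; norm_num at ht1
      have hs : |-β / t| ≤ β := by
        rw [abs_div, abs_neg, abs_of_pos hβ]
        exact div_le_self hβ.le ht1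
      have e := disk_seg hβ hs hz
      have e2 : disk β (fun y => ((-((1 - alive β 0 t) * seg (-β / t) y) : ℝ) : ℂ)) z =
          -disk β (fun y => (seg (-β / t) y : ℝ)) z := by
        simp only [alive, ht, if_false, disk, sub_zero, one_mul]
        rw [← integral_neg]
        refine integral_congr_ae (Eventually.of_forall fun y => ?_)
        push_cast
        ring
      rw [e2, e]
      simp only [alive, ht, if_false]
      have h1 : (t : ℂ) - z ≠ 0 := by
        intro h
        have := congrArg Complex.im h
        simp at this
        linarith
      have h2 : (t : ℂ) ≠ 0 := by exact_mod_cast ht0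
      have h3 : (β : ℂ) ≠ 0 := by exact_mod_cast hβ.ne'
      push_cast
      have h4 : (β : ℂ) + -β / t * z = β * (t - z) / t := by field_simp; ring
      rw [h4]
      field_simp
      ring
  · refine integrable_mul_bounded (integrable_mul_alive β hf 0) ?_ (B := 1 / (-z.im))
      fun t => norm_one_div_sub_le _ hη (by linarith)
    fun_prop

lemma smear_ker_succ {β : ℝ} {f : ℝ → ℂ} (hf : Integrable f) (n : ℕ) (y : ℝ) :
    smear f (ker β (n + 1)) y =
      smear f (fun t y => alive β n t * corr β (orb β n t) y) y +
        koop β (smear f (ker β n)) y := by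
  unfold koop
  have h1 : Integrable (fun t => f t * ((alive β n t * corr β (orb β n t) y : ℝ) : ℂ)) :=
    integrable_mul_ofReal hf ((measurable_alive β n).mul
      (measurable_corr_comp (measurable_orb β n) measurable_const))
      fun t => abs_alive_mul_corr_le β n t y
  split_ifs with h
  · unfold smear
    rw [← integral_add h1]
    · refine integral_congr_ae (Eventually.of_forall fun t => ?_)
      simp only [ker, h, if_true]
      push_cast
      ring
    · exact integrable_mul_ofReal hf (measurable_ker_comp n measurable_id measurable_const)
        fun t => abs_ker_le β n t _
  · simp [smear, ker, h]

lemma cauchy_add_disk_succ {β : ℝ} (hβ : 0 < β) (hβ1 : β ≤ 1) {f F G : ℝ → ℂ}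
    (hf : Integrable f) (hF : Integrable F)
    (hFG : ∀ z : ℂ, z.im < 0 →
      ∫ t, F t * polar ((-β / t : ℝ) : ℂ) z = -cauchy G id z) {c : ℂ} {n : ℕ}
    (hn : ∀ z : ℂ, ‖z‖ < 1 → z.im < 0 →
      cauchy (fun t => f t * (alive β n t : ℝ)) (orb β n) z + disk β (smear f (ker β n)) z =
        c * cauchy F id z) {z : ℂ} (hz : ‖z‖ < 1) (hi : z.im < 0) :
    cauchy (fun t => f t * (alive β (n + 1) t : ℝ)) (orb β (n + 1)) z +
      disk β (smear f (ker β (n + 1))) z = -c * cauchy G id z := by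
  have hfn := integrable_mul_alive β hf n
  have hmk : Measurable (Function.uncurry (ker β n)) :=
    measurable_ker_comp n measurable_fst measurable_snd
  have hms := measurable_smear hf hmk
  have hbs := norm_smear_le hf (abs_ker_le β n)
  have key := transfer_cauchy_identity hβ hβ1 hfn hF (measurable_orb β n) measurable_id
    (by filter_upwards [ae_orb_notMem hβ n (countable_singleton (0 : ℝ))] with t ht
        exact Or.inr ht)
    (by filter_upwards [(countable_singleton (0 : ℝ)).ae_notMem volume] with t ht
        exact Or.inr ht)
    (differentiableOn_disk hβ hms hbs).continuousOn hn hz hi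
  rw [transfer_disk hβ hβ1 hms hbs hz] at key
  simp only [id] at key
  rw [hFG z hi] at key
  have hmc : Measurable (Function.uncurry fun t y => alive β n t * corr β (orb β n t) y) :=
    ((measurable_alive β n).comp measurable_fst).mul
      (measurable_corr_comp ((measurable_orb β n).comp measurable_fst) measurable_snd)
  obtain ⟨h_int, he⟩ := integral_mul_disk hβ hf hmc (abs_alive_mul_corr_le β n) hz
  have e1 : disk β (smear f (ker β (n + 1))) z =
      disk β (smear f fun t y => alive β n t * corr β (orb β n t) y) z +
        disk β (koop β (smear f (ker β n))) z := by
    rw [← disk_add hβ (measurable_smear hf hmc) (measurable_koop hms)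
      (norm_smear_le hf (abs_alive_mul_corr_le β n)) (norm_koop_le hbs) hz]
    congr 1
    funext y
    exact smear_ker_succ hf n y
  have e2 : ∫ t, f t * (alive β n t : ℝ) * polar ((-β / orb β n t : ℝ) : ℂ) z =
      cauchy (fun t => f t * (alive β (n + 1) t : ℝ)) (orb β (n + 1)) z +
        disk β (smear f fun t y => alive β n t * corr β (orb β n t) y) z := by
    rw [← he, cauchy, ← integral_add _ h_int]
    · refine integral_congr_ae ?_
      filter_upwards [ae_orb_notMem hβ n (countable_singleton (0 : ℝ)),
        ae_orb_notMem hβ n (countable_singleton β),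
        ae_orb_notMem hβ n (countable_singleton (-β))] with t h0 h1 h2
      have h3 : |orb β n t| ≠ β := by
        intro h
        rcases (abs_eq hβ.le).1 h with h | h
        · exact h1 h
        · exact h2 h
      rw [polar_eq_add_disk hβ h0 h3 hz hi]
      have e3 : disk β (fun y => ((alive β n t * corr β (orb β n t) y : ℝ) : ℂ)) z =
          alive β n t * disk β (fun y => (corr β (orb β n t) y : ℝ)) z := by
        rw [disk, disk, ← integral_const_mul]
        refine integral_congr_ae (Eventually.of_forall fun y => ?_)
        push_cast
        ring
      have e4 : orb β (n + 1) t = tau β (orb β n t) := Function.iterate_succ_apply' _ _ _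
      rw [e3, e4, alive]
      push_cast
      split_ifs
      · push_cast; ring
      · push_cast; ring
    · have hη : 0 < -z.im := by linarith
      refine integrable_mul_bounded (integrable_mul_alive β hf (n + 1)) ?_ (B := 1 / (-z.im))
        fun t => norm_one_div_sub_le _ hη (by linarith)
      fun_prop
  rw [e2] at key
  rw [e1]
  linear_combination key

lemma cauchy_add_disk {β : ℝ} (hβ : 0 < β) (hβ1 : β ≤ 1) {f g : ℝ → ℂ}
    (hf : Integrable f) (hg : Integrable g)
    (hfg : ∀ z : ℂ, z.im < 0 → ∫ t, f t * polar ((-β / t : ℝ) : ℂ) z = -cauchy g id z)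
    (hgf : ∀ z : ℂ, z.im < 0 → ∫ t, g t * polar ((-β / t : ℝ) : ℂ) z = -cauchy f id z)
    (k : ℕ) {z : ℂ} (hz : ‖z‖ < 1) (hi : z.im < 0) :
    cauchy (fun t => f t * (alive β (2 * k) t : ℝ)) (orb β (2 * k)) z +
      disk β (smear f (ker β (2 * k))) z = cauchy f id z := by
  induction k generalizing z with
  | zero => exact cauchy_add_disk_zero hβ hf hz hi
  | succ k ih =>
    have h1 := fun z (hz : ‖z‖ < 1) hi => cauchy_add_disk_succ hβ hβ1 hf hf hfg (c := 1)
      (n := 2 * k) (fun w hw hj => by rw [one_mul]; exact ih hw hj) (z := z) hz hi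
    have h2 := cauchy_add_disk_succ hβ hβ1 hf hg hgf h1 hz hi
    rw [show 2 * (k + 1) = 2 * k + 1 + 1 by ring, h2]
    ring

lemma sum_sub_two_le {T : ℕ → ℝ} (h0 : ∀ n, 0 ≤ T n) (h1 : ∀ n, T n ≤ 1) (m : ℕ) :
    ∑ k ∈ Finset.range m, (T k - T (k + 2)) ≤ 2 := by
  have : ∑ k ∈ Finset.range m, (T k - T (k + 2)) = T 0 + T 1 - T m - T (m + 1) := by
    induction m with
    | zero => simp
    | succ m ih => rw [Finset.sum_range_succ, ih]; ring
  rw [this]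
  linarith [h1 0, h1 1, h0 m, h0 (m + 1)]

lemma sum_sub_one_le {Y : ℕ → ℝ} (h0 : ∀ n, 0 ≤ Y n) (h1 : ∀ n, Y n ≤ 1) (m : ℕ) :
    ∑ k ∈ Finset.range m, (Y k - Y (k + 1)) ≤ 1 := by
  rw [Finset.sum_range_sub']
  linarith [h1 0, h0 m]

lemma abs_mul_mul_le_one {a b c : ℝ} (ha0 : 0 ≤ a) (ha : a ≤ 1) (hb0 : 0 ≤ b) (hb : b ≤ 1)
    (hc : |c| ≤ 1) : |a * b * c| ≤ 1 := by
  rw [abs_mul, abs_of_nonneg (mul_nonneg ha0 hb0)]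
  have h1 : a * b ≤ 1 := mul_le_one₀ ha hb0 hb
  have h2 := mul_nonneg ha0 hb0
  nlinarith [abs_nonneg c]

lemma abs_diagonal_sub_le {T Y : ℕ → ℝ} {S : ℕ → ℕ → ℝ} (hT0 : ∀ n, 0 ≤ T n) (hT1 : ∀ n, T n ≤ 1)
    (hT : ∀ n, T (n + 1) ≤ T n) (hY0 : ∀ n, 0 ≤ Y n) (hY1 : ∀ n, Y n ≤ 1)
    (hY : ∀ n, Y (n + 1) ≤ Y n) (hS : ∀ i j, |S i j| ≤ 1) (m : ℕ) :
    |∑ p ∈ Finset.HasAntidiagonal.antidiagonal m, (T (p.1 + 1) * Y p.2 * S p.1 p.2 -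
        T p.1 * Y p.2 * S (p.1 + 1) (p.2 + 1)) -
      (∑ p ∈ Finset.HasAntidiagonal.antidiagonal m, T (p.1 + 1) * Y p.2 * S p.1 p.2 -
        ∑ p ∈ Finset.HasAntidiagonal.antidiagonal (m + 2), T (p.1 + 1) * Y p.2 * S p.1 p.2)| ≤ 5 := by
  rw [Finset.Nat.sum_antidiagonal_succ, Finset.Nat.sum_antidiagonal_succ',
    Finset.sum_sub_distrib]
  simp only [zero_add]
  have hsum : |∑ p ∈ Finset.HasAntidiagonal.antidiagonal m, (T (p.1 + 1 + 1) * Y (p.2 + 1) * S (p.1 + 1) (p.2 + 1) -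
      T p.1 * Y p.2 * S (p.1 + 1) (p.2 + 1))| ≤ 3 := by
    have hle : ∀ p ∈ Finset.HasAntidiagonal.antidiagonal m,
        |T (p.1 + 1 + 1) * Y (p.2 + 1) * S (p.1 + 1) (p.2 + 1) -
          T p.1 * Y p.2 * S (p.1 + 1) (p.2 + 1)| ≤
        (T p.1 - T (p.1 + 2)) + (Y p.2 - Y (p.2 + 1)) := by
      intro p _
      rw [← sub_mul, abs_mul]
      have a1 := hT0 (p.1 + 2)
      have a2 := hT1 (p.1)
      have a3 : T (p.1 + 2) ≤ T p.1 := (hT _).trans (hT _)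
      have a4 := hY0 (p.2 + 1)
      have a5 := hY1 p.2
      have a6 := hY p.2
      have a7 := hS (p.1 + 1) (p.2 + 1)
      have a8 : T (p.1 + 1 + 1) = T (p.1 + 2) := rfl
      rw [a8]
      have a9 : |T (p.1 + 2) * Y (p.2 + 1) - T p.1 * Y p.2| ≤
          (T p.1 - T (p.1 + 2)) + (Y p.2 - Y (p.2 + 1)) := by
        rw [abs_sub_comm, abs_of_nonneg (by nlinarith)]
        nlinarith [hY1 (p.2 + 1)]
      nlinarith [abs_nonneg (T (p.1 + 2) * Y (p.2 + 1) - T p.1 * Y p.2)]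
    refine (Finset.abs_sum_le_sum_abs _ _).trans ((Finset.sum_le_sum hle).trans ?_)
    rw [Finset.sum_add_distrib]
    have b1 : ∑ p ∈ Finset.HasAntidiagonal.antidiagonal m, (T p.1 - T (p.1 + 2)) ≤ 2 := by
      rw [Finset.Nat.sum_antidiagonal_eq_sum_range_succ (fun i _ => T i - T (i + 2))]
      exact sum_sub_two_le hT0 hT1 _
    have b2 : ∑ p ∈ Finset.HasAntidiagonal.antidiagonal m, (Y p.2 - Y (p.2 + 1)) ≤ 1 := by
      rw [← Finset.Nat.sum_antidiagonal_swap]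
      simp only [Prod.snd_swap]
      rw [Finset.Nat.sum_antidiagonal_eq_sum_range_succ (fun i _ => Y i - Y (i + 1))]
      exact sum_sub_one_le hY0 hY1 _
    linarith
  rw [Finset.sum_sub_distrib] at hsum
  have c1 := abs_mul_mul_le_one (hT0 1) (hT1 1) (hY0 (m + 1 + 1)) (hY1 (m + 1 + 1))
    (hS 0 (m + 1 + 1))
  have c2 := abs_mul_mul_le_one (hT0 (m + 1 + 1 + 1)) (hT1 (m + 1 + 1 + 1)) (hY0 0) (hY1 0)
    (hS (m + 1 + 1) 0)
  rw [abs_le] at *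
  constructor <;> linarith [hsum.1, hsum.2, c1.1, c1.2, c2.1, c2.2]

lemma abs_sum_diagonal_le {T Y : ℕ → ℝ} {S : ℕ → ℕ → ℝ} (hT0 : ∀ n, 0 ≤ T n) (hT1 : ∀ n, T n ≤ 1)
    (hT : ∀ n, T (n + 1) ≤ T n) (hY0 : ∀ n, 0 ≤ Y n) (hY1 : ∀ n, Y n ≤ 1)
    (hY : ∀ n, Y (n + 1) ≤ Y n) (hS : ∀ i j, |S i j| ≤ 1) (N : ℕ) :
    |∑ k ∈ Finset.range N, ∑ p ∈ Finset.HasAntidiagonal.antidiagonal (2 * k + 1),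
      (T (p.1 + 1) * Y p.2 * S p.1 p.2 - T p.1 * Y p.2 * S (p.1 + 1) (p.2 + 1))| ≤ 7 * N + 4 := by
  set D : ℕ → ℝ := fun m => ∑ p ∈ Finset.HasAntidiagonal.antidiagonal m, T (p.1 + 1) * Y p.2 * S p.1 p.2 with hD
  have hDb : ∀ m, |D m| ≤ m + 1 := by
    intro m
    refine (Finset.abs_sum_le_sum_abs _ _).trans ?_
    refine (Finset.sum_le_sum (g := fun _ => (1 : ℝ)) fun p _ =>
      abs_mul_mul_le_one (hT0 _) (hT1 _) (hY0 _) (hY1 _) (hS _ _)).trans ?_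
    simp
  set L : ℕ → ℝ := fun m => ∑ p ∈ Finset.HasAntidiagonal.antidiagonal m,
      (T (p.1 + 1) * Y p.2 * S p.1 p.2 - T p.1 * Y p.2 * S (p.1 + 1) (p.2 + 1)) with hL
  have hstep : ∀ m, |L m - (D m - D (m + 2))| ≤ 5 :=
    abs_diagonal_sub_le hT0 hT1 hT hY0 hY1 hY hS
  have key : |∑ k ∈ Finset.range N, L (2 * k + 1) - (D 1 - D (2 * N + 1))| ≤ 5 * N := by
    induction N with
    | zero => simp
    | succ N ih =>
      rw [Finset.sum_range_succ]
      have := hstep (2 * N + 1)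
      rw [show 2 * N + 1 + 2 = 2 * (N + 1) + 1 by ring] at this
      push_cast
      rw [abs_le] at *
      constructor <;> linarith [ih.1, ih.2, this.1, this.2]
  have h1 := hDb 1
  have h2 := hDb (2 * N + 1)
  push_cast at h1 h2
  rw [abs_le] at *
  constructor <;> linarith [key.1, key.2, h1.1, h1.2, h2.1, h2.2]

/-- The indicator of the points whose iterates `1, …, n` lie in `(-β, β)`. -/
noncomputable def life (β : ℝ) : ℕ → ℝ → ℝ
  | 0, _ => 1
  | n + 1, y => if |tau β y| < β then life β n (tau β y) else 0

lemma life_nonneg (β : ℝ) (n : ℕ) (y : ℝ) : 0 ≤ life β n y := by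
  induction n generalizing y with
  | zero => simp [life]
  | succ n ih =>
    unfold life
    split_ifs
    · exact ih _
    · exact le_rfl

lemma life_le_one (β : ℝ) (n : ℕ) (y : ℝ) : life β n y ≤ 1 := by
  induction n generalizing y with
  | zero => simp [life]
  | succ n ih =>
    unfold life
    split_ifs
    · exact ih _
    · exact zero_le_one

lemma life_succ_le (β : ℝ) (n : ℕ) (y : ℝ) : life β (n + 1) y ≤ life β n y := by
  induction n generalizing y with
  | zero => exact life_le_one β 1 y
  | succ n ih =>
    show (if |tau β y| < β then life β (n + 1) (tau β y) else 0) ≤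
      if |tau β y| < β then life β n (tau β y) else 0
    split_ifs
    · exact ih _
    · exact le_rfl

lemma alive_succ_le (β : ℝ) (n : ℕ) (t : ℝ) : alive β (n + 1) t ≤ alive β n t := by
  rw [alive]
  have := alive_nonneg β n t
  split_ifs <;> simp [this]

lemma orb_succ' (β : ℝ) (n : ℕ) (t : ℝ) : orb β (n + 1) t = tau β (orb β n t) :=
  Function.iterate_succ_apply' _ _ _

lemma orb_succ (β : ℝ) (n : ℕ) (t : ℝ) : orb β (n + 1) t = orb β n (tau β t) :=
  Function.iterate_succ_apply _ _ _

lemma ker_eq_sum {β t : ℝ} (ht : alive β 0 t = 1) (m : ℕ) (y : ℝ) :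
    ker β (m + 1) t y = ∑ p ∈ Finset.HasAntidiagonal.antidiagonal m,
      (alive β (p.1 + 1) t * life β p.2 y * seg (orb β p.1 t) (orb β p.2 y) -
        alive β p.1 t * life β p.2 y * seg (orb β (p.1 + 1) t) (orb β (p.2 + 1) y)) := by
  have hcorr : ∀ n y, alive β n t * corr β (orb β n t) y =
      alive β (n + 1) t * seg (orb β n t) y - alive β n t * seg (orb β (n + 1) t) (tau β y) := by
    intro n y
    rw [corr, alive, orb_succ']
    split_ifs <;> ring
  induction m generalizing y with
  | zero =>
    have h0 : ∀ y, ker β 0 t y = 0 := fun y => by simp [ker, ht]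
    rw [ker, hcorr]
    simp only [h0, ite_self, Finset.Nat.antidiagonal_zero, Finset.sum_singleton, life, add_zero,
      mul_one, zero_add]
    rfl
  | succ m ih =>
    rw [ker, hcorr, Finset.Nat.sum_antidiagonal_succ']
    simp only [life, mul_one, orb_succ β _ y]
    congr 1
    split_ifs with h
    · rw [ih]
    · simp

lemma abs_ker_le_one {β t : ℝ} (ht : alive β 0 t = 0) (n : ℕ) (y : ℝ) : |ker β n t y| ≤ 1 := by
  have h0 : ∀ n, alive β n t = 0 := by
    intro n
    induction n with
    | zero => exact ht
    | succ n ih => rw [alive, ih, zero_mul]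
  induction n generalizing y with
  | zero => simpa using abs_ker_le β 0 t y
  | succ n ih =>
    rw [ker, h0, zero_mul, zero_add]
    split_ifs
    · exact ih _
    · simp

/-- The partial sums of the even iterated kernels grow at most linearly. -/
lemma abs_sum_ker_le (β : ℝ) (N : ℕ) (t y : ℝ) :
    |∑ k ∈ Finset.range N, ker β (2 * (k + 1)) t y| ≤ 7 * N + 4 := by
  rcases alive_eq β 0 t with h | h
  · refine (Finset.abs_sum_le_sum_abs _ _).trans ?_
    refine (Finset.sum_le_sum (g := fun _ => (1 : ℝ)) fun k _ => abs_ker_le_one h _ y).trans ?_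
    simp
    linarith [Nat.cast_nonneg (α := ℝ) N]
  · have := abs_sum_diagonal_le (T := fun n => alive β n t) (Y := fun n => life β n y)
      (S := fun i j => seg (orb β i t) (orb β j y)) (fun n => alive_nonneg β n t)
      (fun n => alive_le_one β n t) (fun n => alive_succ_le β n t) (fun n => life_nonneg β n y)
      (fun n => life_le_one β n y) (fun n => life_succ_le β n y) (fun i j => abs_seg_le _ _) N
    have e : ∀ k, ker β (2 * (k + 1)) t y = _ := fun k => ker_eq_sum h (2 * k + 1) y
    simp only [e]
    exact this

lemma integrable_of_hasSum {F : NZ → ℝ → ℂ} {G : ℝ → ℂ} {μ : Measure ℝ}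
    (hF : ∀ j, Integrable (F j) μ) (hs : Summable fun j => ∫ x, ‖F j x‖ ∂μ)
    (hG : ∀ᵐ x ∂μ, HasSum (fun j => F j x) (G x)) : Integrable G μ := by
  constructor
  · refine aestronglyMeasurable_of_tendsto_ae (atTop : Filter (Finset NZ))
      (f := fun s x => ∑ j ∈ s, F j x) (fun s => ?_) hG
    exact Finset.aestronglyMeasurable_fun_sum s fun j _ => (hF j).aestronglyMeasurable
  · have h1 : ∫⁻ x, ‖G x‖ₑ ∂μ ≤ ∫⁻ x, ∑' j, ‖F j x‖ₑ ∂μ := by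
      refine lintegral_mono_ae ?_
      filter_upwards [hG] with x hx
      rw [← hx.tsum_eq]
      exact enorm_tsum_le_tsum_enorm
    rw [lintegral_tsum fun j => (hF j).aestronglyMeasurable.enorm] at h1
    have h2 : ∀ j, ∫⁻ x, ‖F j x‖ₑ ∂μ = ENNReal.ofReal (∫ x, ‖F j x‖ ∂μ) := fun j =>
      (ofReal_integral_norm_eq_lintegral_enorm (hF j)).symm
    simp_rw [h2] at h1
    refine h1.trans_lt ?_
    exact hs.tsum_ofReal_lt_top

lemma integrableOn_branch {β : ℝ} (hβ : 0 < β) {φ : ℝ → ℂ} (h : IntegrableOn φ (Ioo (-β) β))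
    (j : NZ) : IntegrableOn (fun x : ℝ =>
      (β / (x + 2 * (j : ℤ)) ^ 2) • φ (-β / (x + 2 * (j : ℤ)))) (Ico (-1) 1) := by
  have h2 : IntegrableOn (fun s => (β / s ^ 2) • φ (-β / s)) (Ico (-1 : ℝ) 1)ᶜ := by
    rw [← integrable_indicator_iff measurableSet_Ico.compl]
    rw [← integrable_indicator_iff measurableSet_Ioo, integrable_neg_div hβ] at h
    exact h.congr (indicator_neg_div_ae hβ φ)
  rw [← iUnion_Ico_nonzero] at h2
  have h3 := h2.mono_set (subset_iUnion _ j)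
  have hm := measurePreserving_add_right (volume : Measure ℝ) (2 * ((j : ℤ) : ℝ))
  have := (hm.integrableOn_comp_preimage (measurableEmbedding_addRight _)).2 h3
  simpa [Function.comp_def] using this

/-- Summation of an integrable function over the branches `x ↦ -β / (x + 2 j)`. -/
lemma integral_hasSum_branches {β : ℝ} (hβ : 0 < β) {φ G : ℝ → ℂ}
    (h : IntegrableOn φ (Ioo (-β) β))
    (hG : ∀ᵐ x ∂volume.restrict (Ico (-1 : ℝ) 1), HasSum (fun j : NZ =>
      (β / (x + 2 * (j : ℤ)) ^ 2) • φ (-β / (x + 2 * (j : ℤ)))) (G x)) :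
    IntegrableOn G (Ico (-1) 1) ∧ ∫ x in Ico (-1 : ℝ) 1, G x = ∫ v in Ioo (-β) β, φ v := by
  have h1 := (hasSum_integral_branches hβ h.norm).summable
  have h2 : Summable fun j : NZ => ∫ x in Ico (-1 : ℝ) 1,
      ‖(β / (x + 2 * (j : ℤ)) ^ 2) • φ (-β / (x + 2 * (j : ℤ)))‖ := by
    refine h1.congr fun j => ?_
    refine setIntegral_congr_fun measurableSet_Ico fun x _ => ?_
    simp only [norm_smul, norm_eq_abs, smul_eq_mul]
    rw [abs_of_nonneg (by positivity)]
  refine ⟨integrable_of_hasSum (integrableOn_branch hβ h) h2 hG, ?_⟩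
  have h3 := hasSum_integral_of_summable_integral_norm (integrableOn_branch hβ h) h2
  rw [← (hasSum_integral_branches hβ h).tsum_eq, h3.tsum_eq]
  refine integral_congr_ae ?_
  filter_upwards [hG] with x hx
  exact hx.tsum_eq.symm

lemma ae_abs_lt_one : ∀ᵐ x ∂volume.restrict (Ico (-1 : ℝ) 1), |x| < 1 ∧ x ∈ Ico (-1 : ℝ) 1 := by
  rw [← restrict_Ioo_eq_restrict_Ico]
  filter_upwards [ae_restrict_mem measurableSet_Ioo] with x hx
  exact ⟨abs_lt.2 hx, hx.1.le, hx.2⟩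

lemma integral_disk_mul_tau {β : ℝ} (hβ : 0 < β) (hβ1 : β ≤ 1) {θ m : ℝ → ℂ} {R B : ℝ}
    (hθ : Measurable θ) (hR : ∀ y, ‖θ y‖ ≤ R) (hm : Measurable m) (hB : ∀ y, ‖m y‖ ≤ B)
    (hi : IntegrableOn (fun x : ℝ => disk β θ x) (Ico (-1) 1)) :
    IntegrableOn (fun x : ℝ => disk β (koop β θ) x * m x) (Ico (-1) 1) ∧
    ∫ x in Ico (-1 : ℝ) 1, disk β (koop β θ) x * m x =
      ∫ t in Ioo (-β) β, disk β θ t * m (tau β t) := by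
  have h1 : Ioo (-β) β ⊆ Ico (-1 : ℝ) 1 := fun x hx => ⟨by linarith [hx.1], by linarith [hx.2]⟩
  refine integral_hasSum_branches hβ ?_ ?_
  · exact (hi.mono_set h1).mul_bdd (c := B) (hm.comp (measurable_tau β)).aestronglyMeasurable
      (Eventually.of_forall fun x => hB _)
  · filter_upwards [ae_abs_lt_one] with x hx
    have h := (hasSum_transfer_disk hβ hβ1 hθ hR (norm_ofReal_lt hx.1)).mul_right (m x)
    refine h.congr_fun fun j => ?_
    rw [tau_branch hβ hx.2, branch_ofReal, rbranch, Complex.real_smul]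
    push_cast
    ring

lemma alive_succ_tau (β : ℝ) (n : ℕ) {t : ℝ} (ht : t ∈ Ico (-1 : ℝ) 1) :
    alive β (n + 1) t = (if |t| < β then 1 else 0) * alive β n (tau β t) := by
  induction n with
  | zero =>
    have h0 : alive β 0 t = 1 := if_pos ht
    have h2 : alive β 0 (tau β t) = 1 := if_pos (tau_mem β t)
    have h3 : alive β (0 + 1) t = alive β 0 t * (if |orb β 0 t| < β then 1 else 0) := rfl
    rw [h3, h2, h0, one_mul, mul_one, show orb β 0 t = t from rfl]
  | succ n ih =>
    rw [alive, ih, alive, orb_succ]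
    ring

lemma integral_disk_iterate {β : ℝ} (hβ : 0 < β) (hβ1 : β ≤ 1) (n : ℕ) {θ ψ : ℝ → ℂ} {R B : ℝ}
    (hθ : Measurable θ) (hR : ∀ y, ‖θ y‖ ≤ R) (hψ : Measurable ψ) (hB : ∀ y, ‖ψ y‖ ≤ B)
    (hi : IntegrableOn (fun x : ℝ => disk β θ x) (Ico (-1) 1)) :
    IntegrableOn (fun x : ℝ => disk β ((koop β)^[n] θ) x) (Ico (-1) 1) ∧
    ∫ x in Ico (-1 : ℝ) 1, disk β ((koop β)^[n] θ) x * ψ x =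
      ∫ x in Ico (-1 : ℝ) 1, disk β θ x * ((alive β n x : ℝ) * ψ (orb β n x)) := by
  induction n generalizing θ with
  | zero =>
    refine ⟨hi, setIntegral_congr_fun measurableSet_Ico fun x hx => ?_⟩
    have h0 : alive β 0 x = 1 := if_pos hx
    simp [h0, orb]
  | succ n ih =>
    have h1 := integral_disk_mul_tau hβ hβ1 hθ hR (m := fun _ => 1) measurable_const (B := 1)
      (by simp) hi
    have h1 : IntegrableOn (fun x : ℝ => disk β (koop β θ) x) (Ico (-1) 1) := by
      simpa using h1.1
    obtain ⟨h2, h3⟩ := ih (measurable_koop hθ) (norm_koop_le hR) h1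
    rw [Function.iterate_succ_apply]
    refine ⟨h2, h3.trans ?_⟩
    have hB0 : 0 ≤ B := (norm_nonneg _).trans (hB 0)
    rw [(integral_disk_mul_tau hβ hβ1 hθ hR (m := fun x => (alive β n x : ℝ) * ψ (orb β n x))
      (B := B) ?_ ?_ hi).2]
    · rw [← integral_indicator measurableSet_Ico, ← integral_indicator measurableSet_Ioo]
      congr 1
      ext x
      by_cases hx : x ∈ Ico (-1 : ℝ) 1
      · rw [indicator_of_mem hx, alive_succ_tau _ _ hx, orb_succ]
        by_cases hx2 : |x| < β
        · rw [indicator_of_mem (s := Ioo (-β) β) (abs_lt.1 hx2), if_pos hx2, one_mul]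
        · rw [indicator_of_notMem (s := Ioo (-β) β) (fun h => hx2 (abs_lt.2 h)), if_neg hx2]
          simp
      · rw [indicator_of_notMem hx, indicator_of_notMem]
        exact fun h => hx ⟨by linarith [h.1], by linarith [h.2]⟩
    · have := measurable_alive β n
      have := measurable_orb β n
      fun_prop
    · intro y
      rw [norm_mul]
      have := norm_alive_le β n y
      have := hB (orb β n y)
      nlinarith [norm_nonneg (ψ (orb β n y)), norm_nonneg ((alive β n y : ℝ) : ℂ)]

/-- Averages of the iterates of `koop`. -/
noncomputable def avg (β : ℝ) (θ : ℝ → ℂ) (N : ℕ) (y : ℝ) : ℂ :=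
  (N : ℂ)⁻¹ * ∑ n ∈ Finset.range N, (koop β)^[n] θ y

lemma measurable_iterate_koop {β : ℝ} {θ : ℝ → ℂ} (hm : Measurable θ) (n : ℕ) :
    Measurable ((koop β)^[n] θ) := by
  induction n with
  | zero => exact hm
  | succ n ih => rw [Function.iterate_succ_apply']; exact measurable_koop ih

lemma norm_iterate_koop_le {β : ℝ} {θ : ℝ → ℂ} {R : ℝ} (hR : ∀ y, ‖θ y‖ ≤ R) (n : ℕ) (y : ℝ) :
    ‖(koop β)^[n] θ y‖ ≤ R := by
  induction n generalizing y with
  | zero => exact hR y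
  | succ n ih => rw [Function.iterate_succ_apply']; exact norm_koop_le ih y

lemma norm_average_le {u : ℕ → ℂ} {R : ℝ} (hR : ∀ n, ‖u n‖ ≤ R) (N : ℕ) :
    ‖(N : ℂ)⁻¹ * ∑ n ∈ Finset.range N, u n‖ ≤ R := by
  have hR0 : 0 ≤ R := (norm_nonneg _).trans (hR 0)
  rcases N.eq_zero_or_pos with rfl | hN
  · simpa using hR0
  rw [norm_mul, norm_inv, Complex.norm_natCast, inv_mul_le_iff₀ (by positivity)]
  refine (norm_sum_le _ _).trans ((Finset.sum_le_sum fun n _ => hR n).trans ?_)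
  simp

lemma disk_average {β : ℝ} (hβ : 0 < β) {θ : ℕ → ℝ → ℂ} (hm : ∀ n, Measurable (θ n)) {R : ℕ → ℝ}
    (hR : ∀ n y, ‖θ n y‖ ≤ R n) (N : ℕ) {z : ℂ} (hz : ‖z‖ < 1) :
    disk β (fun y => (N : ℂ)⁻¹ * ∑ n ∈ Finset.range N, θ n y) z =
      (N : ℂ)⁻¹ * ∑ n ∈ Finset.range N, disk β (θ n) z := by
  unfold disk
  rw [← integral_finsetSum _ fun n _ => integrableOn_disk hβ (hm n) (hR n) hz,
    ← integral_const_mul]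
  simp only [Finset.sum_mul, mul_assoc]

lemma measurable_average {θ : ℕ → ℝ → ℂ} (hm : ∀ n, Measurable (θ n)) (N : ℕ) :
    Measurable (fun y => (N : ℂ)⁻¹ * ∑ n ∈ Finset.range N, θ n y) :=
  (Finset.measurable_fun_sum _ fun n _ => hm n).const_mul _

lemma koop_avg (β : ℝ) (θ : ℝ → ℂ) (N : ℕ) :
    koop β (avg β θ N) = fun y => (N : ℂ)⁻¹ * ∑ n ∈ Finset.range N, (koop β)^[n + 1] θ y := by
  ext y
  simp only [Function.iterate_succ_apply', koop, avg]
  split_ifs <;> simp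

lemma disk_avg {β : ℝ} (hβ : 0 < β) {θ : ℝ → ℂ} {R : ℝ} (hm : Measurable θ)
    (hR : ∀ y, ‖θ y‖ ≤ R) (N : ℕ) {z : ℂ} (hz : ‖z‖ < 1) :
    disk β (avg β θ N) z = (N : ℂ)⁻¹ * ∑ n ∈ Finset.range N, disk β ((koop β)^[n] θ) z :=
  disk_average hβ (measurable_iterate_koop (β := β) hm) (norm_iterate_koop_le hR) N hz

lemma measurable_avg {β : ℝ} {θ : ℝ → ℂ} (hm : Measurable θ) (N : ℕ) : Measurable (avg β θ N) :=
  measurable_average (measurable_iterate_koop hm) N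

lemma norm_avg_le {β : ℝ} {θ : ℝ → ℂ} {R : ℝ} (hR : ∀ y, ‖θ y‖ ≤ R) (N : ℕ) (y : ℝ) :
    ‖avg β θ N y‖ ≤ R :=
  norm_average_le (fun k => norm_iterate_koop_le hR k y) N

lemma norm_disk_koop_avg_sub_le {β : ℝ} (hβ : 0 < β) {θ : ℝ → ℂ} {R : ℝ} (hm : Measurable θ)
    (hR : ∀ y, ‖θ y‖ ≤ R) (N : ℕ) {x : ℝ} (hx : |x| < 1) :
    ‖disk β (koop β (avg β θ N)) x - disk β (avg β θ N) x‖ ≤ (N : ℝ)⁻¹ * (2 * (R * rho x)) := by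
  have e' := disk_average hβ (fun n => measurable_iterate_koop (β := β) hm (n + 1))
    (fun n => norm_iterate_koop_le hR (n + 1)) N (norm_ofReal_lt hx)
  rw [koop_avg, e', disk_avg hβ hm hR N (norm_ofReal_lt hx), ← mul_sub, ← Finset.sum_sub_distrib,
    Finset.sum_range_sub (fun n => disk β ((koop β)^[n] θ) x), norm_mul, norm_inv,
    Complex.norm_natCast]
  gcongr
  refine (norm_sub_le _ _).trans ?_
  have h1 := norm_disk_le hβ (norm_iterate_koop_le (β := β) hR N) hx
  have h2 := norm_disk_le hβ (norm_iterate_koop_le (β := β) hR 0) hx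
  linarith

lemma tendsto_transfer_of_tendsto {β : ℝ} (hβ : 0 < β) (hβ1 : β ≤ 1) {H : ℕ → ℂ → ℂ} {h : ℂ → ℂ}
    {R : ℝ} (hR : ∀ n, ∀ x : ℝ, |x| < 1 → ‖H n x‖ ≤ R * rho x)
    (hH : ∀ z : ℂ, ‖z‖ < 1 → Tendsto (fun n => H n z) atTop (𝓝 (h z))) {x : ℝ} (hx : |x| < 1) :
    Tendsto (fun n => transfer β (H n) x) atTop (𝓝 (transfer β h x)) := by
  unfold transfer
  refine tendsto_tsum_of_dominated_convergence (bound := fun j : NZ => R * rho x * wt β j x)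
    ((wt_hasSum hβ hβ1 hx).1.mul_left _) (fun j => ?_) (Eventually.of_forall fun n j => ?_)
  · rw [branch_ofReal]
    exact (hH _ (norm_ofReal_lt (abs_rbranch_lt hβ hβ1 hx j))).const_mul _
  · rw [branch_ofReal, norm_mul]
    have h1 := hR n _ (abs_rbranch_lt hβ hβ1 hx j)
    have h2 : ‖(β : ℂ) / (x + 2 * (j : ℤ)) ^ 2‖ = β / (x + 2 * (j : ℤ)) ^ 2 := by
      rw [show (β : ℂ) / (x + 2 * (j : ℤ)) ^ 2 = ((β / (x + 2 * (j : ℤ)) ^ 2 : ℝ) : ℂ) by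
        push_cast; ring, Complex.norm_real, norm_of_nonneg (by positivity)]
    rw [h2]
    calc _ ≤ β / (x + 2 * (j : ℤ)) ^ 2 * (R * rho (rbranch β j x)) := by gcongr
      _ = R * (β / (x + 2 * (j : ℤ)) ^ 2 * rho (rbranch β j x)) := by ring
      _ = _ := by rw [weight_mul_rho hβ hβ1 hx]; ring

/-- Limits of averages of iterates are multiples of the invariant density. -/
lemma exists_subseq_avg {β : ℝ} (hβ : 0 < β) (hβ1 : β ≤ 1) {θ : ℝ → ℂ} {R : ℝ} (hm : Measurable θ)
    (hR : ∀ y, ‖θ y‖ ≤ R) {ns : ℕ → ℕ} (hns : Tendsto ns atTop atTop) :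
    ∃ (c : ℂ) (φ : ℕ → ℕ), StrictMono φ ∧ ∀ x : ℝ, |x| < 1 →
      Tendsto (fun k => disk β (avg β θ (ns (φ k))) x) atTop (𝓝 (c * rho x)) := by
  have hma := measurable_avg (β := β) hm
  have hRa := norm_avg_le (β := β) hR
  obtain ⟨h, φ, hφ, hd, hlim⟩ := exists_subseq_disk hβ (fun n => hma (ns n)) (fun n => hRa (ns n))
  have hN : Tendsto (fun k => ns (φ k)) atTop atTop := hns.comp hφ.tendsto_atTop
  have hb : ∀ x : ℝ, |x| < 1 → ‖h x‖ ≤ R * rho x := fun x hx =>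
    le_of_tendsto (hlim _ (norm_ofReal_lt hx)).norm
      (Eventually.of_forall fun k => norm_disk_le hβ (hRa _) hx)
  have he : ∀ x : ℝ, |x| < 1 → h x = transfer β h x := by
    intro x hx
    have h1 := tendsto_transfer_of_tendsto hβ hβ1
      (H := fun k => disk β (avg β θ (ns (φ k)))) (fun k x hx => norm_disk_le hβ (hRa _) hx)
      hlim hx
    have h2 : Tendsto (fun k => ((ns (φ k) : ℕ) : ℝ)⁻¹ * (2 * (R * rho x))) atTop (𝓝 0) := by
      simpa using ((tendsto_inv_atTop_zero.comp
        tendsto_natCast_atTop_atTop).comp hN).mul_const (2 * (R * rho x))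
    have h3 := squeeze_zero_norm (fun k => norm_disk_koop_avg_sub_le hβ hm hR (ns (φ k)) hx) h2
    have h4 := h3.add (hlim _ (norm_ofReal_lt hx))
    simp only [sub_add_cancel, zero_add] at h4
    refine tendsto_nhds_unique h4 (h1.congr fun k => ?_)
    exact transfer_disk hβ hβ1 (hma _) (hRa _) (norm_ofReal_lt hx)
  obtain ⟨c, hc⟩ := eq_density_of_exchange hβ hβ1 hd hd hb hb he he
  refine ⟨c, φ, hφ, fun x hx => ?_⟩
  have := hlim _ (norm_ofReal_lt hx)
  rw [hc _ (norm_ofReal_lt hx)] at this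
  simpa [rho] using this

lemma integral_disk_avg {β : ℝ} (hβ : 0 < β) (hβ1 : β ≤ 1) (N : ℕ) {θ ψ : ℝ → ℂ} {R B : ℝ}
    (hθ : Measurable θ) (hR : ∀ y, ‖θ y‖ ≤ R) (hψ : Measurable ψ) (hB : ∀ y, ‖ψ y‖ ≤ B)
    (hi : IntegrableOn (fun x : ℝ => disk β θ x) (Ico (-1) 1)) :
    ∫ x in Ico (-1 : ℝ) 1, disk β (avg β θ N) x * ψ x =
      ∫ x in Ico (-1 : ℝ) 1, disk β θ x *
        ((N : ℂ)⁻¹ * ∑ n ∈ Finset.range N, (alive β n x : ℝ) * ψ (orb β n x)) := by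
  have h1 : ∫ x in Ico (-1 : ℝ) 1, disk β (avg β θ N) x * ψ x = ∫ x in Ico (-1 : ℝ) 1,
      (N : ℂ)⁻¹ * ∑ n ∈ Finset.range N, disk β ((koop β)^[n] θ) x * ψ x := by
    refine integral_congr_ae ?_
    filter_upwards [ae_abs_lt_one] with x hx
    rw [disk_avg hβ hθ hR N (norm_ofReal_lt hx.1), Finset.mul_sum, Finset.mul_sum, Finset.sum_mul]
    simp only [mul_assoc]
  have h2 : ∀ n, IntegrableOn (fun x : ℝ => disk β ((koop β)^[n] θ) x * ψ x) (Ico (-1) 1) :=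
    fun n => (integral_disk_iterate hβ hβ1 n hθ hR hψ hB hi).1.mul_bdd (c := B)
      hψ.aestronglyMeasurable (Eventually.of_forall hB)
  have hB0 : 0 ≤ B := (norm_nonneg _).trans (hB 0)
  have h3 : ∀ n, IntegrableOn (fun x : ℝ => disk β θ x * ((alive β n x : ℝ) * ψ (orb β n x)))
      (Ico (-1) 1) := by
    intro n
    refine hi.mul_bdd (c := B) ?_ (Eventually.of_forall fun y => ?_)
    · have := measurable_alive β n
      have := measurable_orb β n
      exact (by fun_prop : Measurable _).aestronglyMeasurable
    · rw [norm_mul]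
      have := norm_alive_le β n y
      have := hB (orb β n y)
      nlinarith [norm_nonneg (ψ (orb β n y)), norm_nonneg ((alive β n y : ℝ) : ℂ)]
  rw [h1, integral_const_mul, integral_finsetSum _ fun n _ => h2 n]
  simp_rw [fun n => (integral_disk_iterate hβ hβ1 n hθ hR hψ hB hi).2]
  rw [← integral_finsetSum _ fun n _ => h3 n, ← integral_const_mul]
  congr 1
  ext x
  rw [← Finset.mul_sum]
  ring

lemma integral_rho {r : ℝ} (hr0 : 0 ≤ r) (hr : r < 1) :
    ∫ x in Icc (-r) r, rho x = 2 * (log (1 + r) - log (1 - r)) := by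
  rw [integral_Icc_eq_integral_Ioc, ← intervalIntegral.integral_of_le (by linarith)]
  have h1 : ∀ x ∈ uIcc (-r) r, |x| < 1 := by
    intro x hx
    rw [uIcc_of_le (by linarith)] at hx
    exact (abs_le.2 hx).trans_lt hr
  rw [intervalIntegral.integral_eq_sub_of_hasDerivAt (f := fun x => log (1 + x) - log (1 - x))]
  · rw [← sub_eq_add_neg, sub_neg_eq_add]; ring
  · intro x hx
    have h := abs_lt.1 (h1 x hx)
    have a1 : 1 + x ≠ 0 := by linarith
    have a2 : 1 - x ≠ 0 := by linarith
    have a3 := (one_sub_sq_pos (h1 x hx)).ne'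
    have d1 := ((hasDerivAt_id x).const_add 1).log a1
    have d2 := ((hasDerivAt_id x).const_sub 1).log a2
    refine (d1.sub d2).congr_deriv ?_
    simp only [rho, id]
    field_simp
    ring
  · refine ContinuousOn.intervalIntegrable fun x hx => ?_
    have a3 := (one_sub_sq_pos (h1 x hx)).ne'
    unfold rho
    exact (by fun_prop (disch := assumption) : ContinuousAt _ x).continuousWithinAt

lemma measurable_disk_ae {β : ℝ} (hβ : 0 < β) {θ : ℝ → ℂ} {R : ℝ}
    (hθ : Measurable θ) (hR : ∀ y, ‖θ y‖ ≤ R) :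
    AEStronglyMeasurable (fun x : ℝ => disk β θ x) (volume.restrict (Ico (-1 : ℝ) 1)) := by
  rw [← restrict_Ioo_eq_restrict_Ico]
  refine ContinuousOn.aestronglyMeasurable ?_ measurableSet_Ioo
  refine (differentiableOn_disk hβ hθ hR).continuousOn.comp Complex.continuous_ofReal.continuousOn
    fun x hx => ?_
  rw [mem_ball_zero_iff]
  exact norm_ofReal_lt (abs_lt.2 hx)

/-- Limits of averages of an integrable density vanish. -/
lemma density_eq_zero {β : ℝ} (hβ : 0 < β) (hβ1 : β ≤ 1) {θ : ℝ → ℂ} {R : ℝ}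
    (hθ : Measurable θ) (hR : ∀ y, ‖θ y‖ ≤ R)
    (hi : IntegrableOn (fun x : ℝ => disk β θ x) (Ico (-1) 1)) {ns : ℕ → ℕ} {c : ℂ}
    (hc : ∀ x : ℝ, |x| < 1 → Tendsto (fun k => disk β (avg β θ (ns k)) x) atTop
      (𝓝 (c * rho x))) : c = 0 := by
  have hR0 : 0 ≤ R := (norm_nonneg _).trans (hR 0)
  set K := ∫ x in Ico (-1 : ℝ) 1, ‖disk β θ x‖ with hK
  have key : ∀ r : ℝ, 0 ≤ r → r < 1 → ‖c‖ * (2 * (log (1 + r) - log (1 - r))) ≤ K := by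
    intro r hr0 hr
    let ψ : ℝ → ℂ := (Icc (-r) r).indicator 1
    have hψ : Measurable ψ := measurable_one.indicator measurableSet_Icc
    have hB : ∀ y, ‖ψ y‖ ≤ 1 := fun y => by
      refine (norm_indicator_le_norm_self _ _).trans ?_
      simp
    have h1 : ∀ N, ‖∫ x in Ico (-1 : ℝ) 1, disk β (avg β θ N) x * ψ x‖ ≤ K := by
      intro N
      rw [integral_disk_avg hβ hβ1 N hθ hR hψ hB hi]
      refine norm_integral_le_of_norm_le hi.norm (Eventually.of_forall fun x => ?_)
      rw [norm_mul]
      refine mul_le_of_le_one_right (norm_nonneg _) (norm_average_le (fun n => ?_) N)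
      rw [norm_mul]
      exact mul_le_one₀ (norm_alive_le β n x) (norm_nonneg _) (hB _)
    have h2 : Tendsto (fun k => ∫ x in Ico (-1 : ℝ) 1, disk β (avg β θ (ns k)) x * ψ x) atTop
        (𝓝 (∫ x in Ico (-1 : ℝ) 1, c * rho x * ψ x)) := by
      refine tendsto_integral_of_dominated_convergence (fun _ => R * (2 / (1 - r ^ 2)))
        (fun k => ?_) ?_ (fun k => ?_) ?_
      · exact (measurable_disk_ae hβ (measurable_avg hθ _) (norm_avg_le hR _)).mul
          hψ.aestronglyMeasurable
      · exact integrableOn_const (by simp)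
      · filter_upwards [ae_abs_lt_one] with x hx
        have hr2 : 0 < 1 - r ^ 2 := one_sub_sq_pos (by rwa [abs_of_nonneg hr0])
        by_cases hxr : x ∈ Icc (-r) r
        · rw [show ψ x = 1 from indicator_of_mem hxr 1, mul_one]
          refine (norm_disk_le hβ (norm_avg_le hR _) hx.1).trans ?_
          refine mul_le_mul_of_nonneg_left ?_ hR0
          have : x ^ 2 ≤ r ^ 2 := sq_le_sq' hxr.1 hxr.2
          exact div_le_div_of_nonneg_left (by norm_num) hr2 (by linarith)
        · rw [show ψ x = 0 from indicator_of_notMem hxr 1, mul_zero, norm_zero]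
          positivity
      · filter_upwards [ae_abs_lt_one] with x hx
        exact (hc x hx.1).mul_const _
    have h3 := le_of_tendsto h2.norm (Eventually.of_forall fun k => h1 (ns k))
    have hsub : Icc (-r) r ⊆ Ico (-1 : ℝ) 1 :=
      fun x hx => ⟨by linarith [hx.1], by linarith [hx.2]⟩
    have h4 : ∫ x in Ico (-1 : ℝ) 1, c * rho x * ψ x = c * ((∫ x in Icc (-r) r, rho x : ℝ) : ℂ) := by
      have : ∀ x : ℝ, c * rho x * ψ x = (Icc (-r) r).indicator (fun x : ℝ => c * (rho x : ℂ)) x := by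
        intro x
        simp only [ψ, indicator]
        split_ifs <;> simp
      simp_rw [this]
      rw [integral_indicator measurableSet_Icc, Measure.restrict_restrict measurableSet_Icc,
        inter_eq_left.2 hsub, integral_const_mul, integral_complex_ofReal]
    rw [h4, integral_rho hr0 hr, norm_mul, Complex.norm_real] at h3
    exact (mul_le_mul_of_nonneg_left (le_abs_self _) (norm_nonneg _)).trans h3
  by_contra hc0
  have hcp : 0 < ‖c‖ := norm_pos_iff.2 hc0
  have hK0 : 0 ≤ K := integral_nonneg fun x => norm_nonneg _
  set M := K / ‖c‖ + 1 with hM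
  have hM0 : 0 < M := by positivity
  have h1 := key (1 - exp (-M)) (by
    have : exp (-M) ≤ 1 := exp_le_one_iff.2 (by linarith)
    linarith) (by linarith [exp_pos (-M)])
  have h2 : 0 ≤ log (1 + (1 - exp (-M))) := log_nonneg (by
    have : exp (-M) ≤ 1 := exp_le_one_iff.2 (by linarith)
    linarith)
  rw [sub_sub_cancel, log_exp] at h1
  have h3 : ‖c‖ * M = K + ‖c‖ := by rw [hM]; field_simp
  nlinarith

/-- The distance from the complement of `(-1, 1)`. -/
noncomputable def gap (x : ℝ) : ℝ := max (1 - |x|) 0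

@[fun_prop]
lemma measurable_gap : Measurable gap := by unfold gap; fun_prop

lemma gap_nonneg (x : ℝ) : 0 ≤ gap x := le_max_right _ _

lemma gap_le_one (x : ℝ) : gap x ≤ 1 := max_le (by linarith [abs_nonneg x]) zero_le_one

lemma rho_mul_gap_le {x : ℝ} (hx : |x| < 1) : rho x * gap x ≤ 2 := by
  rw [gap, max_eq_left (by linarith), rho, div_mul_eq_mul_div, div_le_iff₀ (one_sub_sq_pos hx),
    ← sq_abs]
  nlinarith [abs_nonneg x]

/-- The average distance of an orbit from the endpoints `±1`. -/
noncomputable def dwell (β : ℝ) (N : ℕ) (t : ℝ) : ℝ :=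
  (N : ℝ)⁻¹ * ∑ n ∈ Finset.range N, alive β n t * gap (orb β n t)

lemma measurable_dwell (β : ℝ) (N : ℕ) : Measurable (dwell β N) := by
  refine (Finset.measurable_fun_sum _ fun n _ => ?_).const_mul _
  exact (measurable_alive β n).mul (measurable_gap.comp (measurable_orb β n))

lemma dwell_nonneg (β : ℝ) (N : ℕ) (t : ℝ) : 0 ≤ dwell β N t :=
  mul_nonneg (by positivity) (Finset.sum_nonneg fun n _ =>
    mul_nonneg (alive_nonneg β n t) (gap_nonneg _))

lemma ofReal_dwell (β : ℝ) (N : ℕ) (t : ℝ) : ((dwell β N t : ℝ) : ℂ) =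
    (N : ℂ)⁻¹ * ∑ n ∈ Finset.range N, (alive β n t : ℝ) * ((gap (orb β n t) : ℝ) : ℂ) := by
  unfold dwell
  push_cast
  rfl

lemma dwell_le_one (β : ℝ) (N : ℕ) (t : ℝ) : dwell β N t ≤ 1 := by
  have h : ‖((dwell β N t : ℝ) : ℂ)‖ ≤ 1 := by
    rw [ofReal_dwell]
    refine norm_average_le (fun n => ?_) N
    rw [← Complex.ofReal_mul, Complex.norm_real, norm_of_nonneg
      (mul_nonneg (alive_nonneg β n t) (gap_nonneg _))]
    exact mul_le_one₀ (alive_le_one β n t) (gap_nonneg _) (gap_le_one _)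
  rw [Complex.norm_real] at h
  exact (le_abs_self _).trans h

lemma alive_eq_zero (β : ℝ) (n : ℕ) {t : ℝ} (ht : t ∉ Ico (-1 : ℝ) 1) : alive β n t = 0 := by
  induction n with
  | zero => exact if_neg ht
  | succ n ih => rw [alive, ih, zero_mul]

lemma dwell_eq_zero (β : ℝ) (N : ℕ) {t : ℝ} (ht : t ∉ Ico (-1 : ℝ) 1) : dwell β N t = 0 := by
  simp [dwell, alive_eq_zero β _ ht]

lemma integrableOn_dwell (β : ℝ) (N : ℕ) : IntegrableOn (dwell β N) (Ico (-1) 1) := by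
  refine Integrable.mono' (g := fun _ => 1) (integrableOn_const (by simp))
    (measurable_dwell β N).aestronglyMeasurable (Eventually.of_forall fun t => ?_)
  rw [norm_of_nonneg (dwell_nonneg β N t)]
  exact dwell_le_one β N t

lemma tendsto_integral_disk_gap {β : ℝ} (hβ : 0 < β) (hβ1 : β ≤ 1) {θ : ℝ → ℂ} {R : ℝ}
    (hθ : Measurable θ) (hR : ∀ y, ‖θ y‖ ≤ R)
    (hi : IntegrableOn (fun x : ℝ => disk β θ x) (Ico (-1) 1)) :
    Tendsto (fun N => ∫ x in Ico (-1 : ℝ) 1, disk β (avg β θ N) x * (gap x : ℝ)) atTop (𝓝 0) := by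
  have hR0 : 0 ≤ R := (norm_nonneg _).trans (hR 0)
  refine tendsto_of_subseq_tendsto fun ns hns => ?_
  obtain ⟨c, φ, -, hc⟩ := exists_subseq_avg hβ hβ1 hθ hR hns
  have h0 := density_eq_zero hβ hβ1 hθ hR hi (ns := fun k => ns (φ k)) hc
  refine ⟨φ, ?_⟩
  rw [← integral_zero ℝ ℂ (μ := volume.restrict (Ico (-1 : ℝ) 1))]
  refine tendsto_integral_of_dominated_convergence (fun _ => R * 2) (fun k => ?_) ?_
    (fun k => ?_) ?_
  · exact (measurable_disk_ae hβ (measurable_avg hθ _) (norm_avg_le hR _)).mul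
      (Complex.measurable_ofReal.comp measurable_gap).aestronglyMeasurable
  · exact integrableOn_const (by simp)
  · filter_upwards [ae_abs_lt_one] with x hx
    rw [norm_mul, Complex.norm_real, norm_of_nonneg (gap_nonneg x)]
    calc _ ≤ R * rho x * gap x := mul_le_mul_of_nonneg_right
          (norm_disk_le hβ (norm_avg_le hR _) hx.1) (gap_nonneg x)
      _ = R * (rho x * gap x) := by ring
      _ ≤ R * 2 := mul_le_mul_of_nonneg_left (rho_mul_gap_le hx.1) hR0
  · filter_upwards [ae_abs_lt_one] with x hx
    have := (hc x hx.1).mul_const ((gap x : ℝ) : ℂ)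
    simpa [h0] using this

lemma tendsto_integral_dwell {β : ℝ} (hβ : 0 < β) (hβ1 : β ≤ 1) :
    Tendsto (fun N => ∫ t in Ico (-1 : ℝ) 1, dwell β N t) atTop (𝓝 0) := by
  let θ : ℝ → ℂ := fun y => (seg (β / 2) y : ℝ)
  have hθ : Measurable θ := Complex.measurable_ofReal.comp (measurable_seg _)
  have hR : ∀ y, ‖θ y‖ ≤ 1 := norm_seg_le _
  have hd : ∀ x : ℝ, |x| < 1 → disk β θ x = ((1 / (2 + x) : ℝ) : ℂ) := by
    intro x hx
    have h2 : 2 + x ≠ 0 := by linarith [(abs_lt.1 hx).1]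
    have h2' : (2 + x : ℂ) ≠ 0 := by exact_mod_cast h2
    have h3 : (β : ℂ) ≠ 0 := by exact_mod_cast hβ.ne'
    rw [disk_seg hβ (by rw [abs_of_pos (by positivity)]; linarith) (norm_ofReal_lt hx)]
    push_cast
    have h4 : (β + β / 2 * x : ℂ) = β / 2 * (2 + x) := by ring
    rw [h4]
    field_simp
  have hb : ∀ x : ℝ, |x| < 1 → 1 / (2 + x) ≤ 1 ∧ 1 / 3 ≤ 1 / (2 + x) := by
    intro x hx
    have := abs_lt.1 hx
    constructor
    · rw [div_le_one] <;> linarith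
    · exact one_div_le_one_div_of_le (by linarith) (by linarith)
  have hi : IntegrableOn (fun x : ℝ => disk β θ x) (Ico (-1) 1) := by
    refine Integrable.mono' (g := fun _ => 1) (integrableOn_const (by simp))
      (measurable_disk_ae hβ hθ hR) ?_
    filter_upwards [ae_abs_lt_one] with x hx
    rw [hd x hx.1, Complex.norm_real, norm_of_nonneg (by linarith [(hb x hx.1).2])]
    exact (hb x hx.1).1
  have h1 := tendsto_integral_disk_gap hβ hβ1 hθ hR hi
  have h2 : ∀ N, ∫ x in Ico (-1 : ℝ) 1, disk β (avg β θ N) x * (gap x : ℝ) =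
      ((∫ x in Ico (-1 : ℝ) 1, 1 / (2 + x) * dwell β N x : ℝ) : ℂ) := by
    intro N
    rw [integral_disk_avg hβ hβ1 N hθ hR (ψ := fun x => ((gap x : ℝ) : ℂ)) (B := 1)
      (Complex.measurable_ofReal.comp measurable_gap) (fun y => by
        rw [Complex.norm_real, norm_of_nonneg (gap_nonneg y)]; exact gap_le_one y) hi,
      ← integral_complex_ofReal]
    refine integral_congr_ae ?_
    filter_upwards [ae_abs_lt_one] with x hx
    rw [hd x hx.1, ← ofReal_dwell, ← Complex.ofReal_mul]
  simp_rw [h2] at h1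
  have h3 : Tendsto (fun N => ∫ x in Ico (-1 : ℝ) 1, 1 / (2 + x) * dwell β N x) atTop (𝓝 0) := by
    have := (Complex.continuous_re.tendsto _).comp h1
    simpa only [Function.comp_def, Complex.ofReal_re, Complex.zero_re] using this
  have h4 := h3.const_mul 3
  rw [mul_zero] at h4
  refine squeeze_zero (fun N => integral_nonneg (dwell_nonneg β N)) (fun N => ?_) h4
  rw [← integral_const_mul]
  refine integral_mono_ae (integrableOn_dwell β N) ?_ ?_
  · refine ((integrableOn_dwell β N).bdd_mul (f := fun x : ℝ => 1 / (2 + x)) (c := 1) ?_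
      ?_).const_mul 3
    · exact (by fun_prop : Measurable _).aestronglyMeasurable
    · filter_upwards [ae_abs_lt_one] with x hx
      rw [norm_of_nonneg (by linarith [(hb x hx.1).2])]
      exact (hb x hx.1).1
  · filter_upwards [ae_abs_lt_one] with x hx
    have := (hb x hx.1).2
    have := dwell_nonneg β N x
    nlinarith

/-- Orbits spend most of their time near the endpoints `±1`. -/
lemma tendsto_integral_mul_dwell {β : ℝ} (hβ : 0 < β) (hβ1 : β ≤ 1) {f : ℝ → ℂ}
    (hf : Integrable f) :
    Tendsto (fun N => ∫ t, ‖f t‖ * dwell β N t) atTop (𝓝 0) := by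
  have hw : ∀ N, Integrable (dwell β N) := by
    intro N
    refine IntegrableOn.integrable_of_forall_notMem_eq_zero (integrableOn_dwell β N)
      fun t ht => dwell_eq_zero β N ht
  have hw0 : Tendsto (fun N => ∫ t, dwell β N t) atTop (𝓝 0) := by
    refine (tendsto_integral_dwell hβ hβ1).congr fun N => ?_
    exact setIntegral_eq_integral_of_forall_compl_eq_zero fun t ht => dwell_eq_zero β N ht
  have htail : Tendsto (fun K : ℕ => ∫ t, max (‖f t‖ - K) 0) atTop (𝓝 0) := by
    suffices h : Tendsto (fun K : ℕ => ∫ t, max (‖f t‖ - K) 0) atTop (𝓝 (∫ _ : ℝ, (0 : ℝ))) by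
      rwa [integral_zero] at h
    refine tendsto_integral_of_dominated_convergence (fun t => ‖f t‖) (fun K => ?_) hf.norm
      (fun K => Eventually.of_forall fun t => ?_) (Eventually.of_forall fun t => ?_)
    · exact ((hf.norm.aestronglyMeasurable.sub aestronglyMeasurable_const).sup
        aestronglyMeasurable_const)
    · rw [norm_of_nonneg (le_max_right _ _)]
      exact max_le (by linarith [(Nat.cast_nonneg K : (0 : ℝ) ≤ K)]) (norm_nonneg _)
    · refine tendsto_const_nhds.congr' ?_
      filter_upwards [eventually_ge_atTop ⌈‖f t‖⌉₊] with K hK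
      rw [max_eq_right]
      linarith [Nat.ceil_le.1 hK]
  have hti : ∀ K : ℕ, Integrable fun t => max (‖f t‖ - K) 0 := by
    intro K
    refine hf.norm.mono' ((hf.norm.aestronglyMeasurable.sub aestronglyMeasurable_const).sup
        aestronglyMeasurable_const) (Eventually.of_forall fun t => ?_)
    rw [norm_of_nonneg (le_max_right _ _)]
    exact max_le (by linarith [(Nat.cast_nonneg K : (0 : ℝ) ≤ K)]) (norm_nonneg _)
  have hle : ∀ K N : ℕ, ∫ t, ‖f t‖ * dwell β N t ≤
      K * (∫ t, dwell β N t) + ∫ t, max (‖f t‖ - K) 0 := by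
    intro K N
    rw [← integral_const_mul, ← integral_add ((hw N).const_mul _) (hti K)]
    refine integral_mono_of_nonneg (Eventually.of_forall fun t =>
      mul_nonneg (norm_nonneg _) (dwell_nonneg β N t)) (((hw N).const_mul _).add (hti K))
      (Eventually.of_forall fun t => ?_)
    have h1 := dwell_nonneg β N t
    have h2 := dwell_le_one β N t
    have h3 := le_max_left (‖f t‖ - K) 0
    have h4 := le_max_right (‖f t‖ - K) 0
    simp only
    nlinarith
  rw [Metric.tendsto_atTop]
  intro ε hε
  obtain ⟨K, hK⟩ := (htail.eventually (gt_mem_nhds (half_pos hε))).exists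
  have h5 : Tendsto (fun N => (K : ℝ) * ∫ t, dwell β N t) atTop (𝓝 0) := by
    simpa using hw0.const_mul (K : ℝ)
  obtain ⟨N₀, hN₀⟩ := eventually_atTop.1 (h5.eventually (gt_mem_nhds (half_pos hε)))
  refine ⟨N₀, fun N hN => ?_⟩
  rw [dist_zero_right, norm_of_nonneg (integral_nonneg fun t =>
    mul_nonneg (norm_nonneg _) (dwell_nonneg β N t))]
  linarith [hle K N, hN₀ N hN]

lemma orb_mem {β : ℝ} {n : ℕ} {t : ℝ} (h : alive β n t = 1) : orb β n t ∈ Ico (-1 : ℝ) 1 := by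
  cases n with
  | zero =>
    by_contra h0
    rw [alive_eq_zero β 0 (t := t) h0] at h
    exact zero_ne_one h
  | succ n => rw [orb_succ']; exact tau_mem β _

/-- The indicator function of the nonnegative half line. -/
noncomputable def halfLine (s : ℝ) : ℝ := if 0 ≤ s then 1 else 0

lemma measurable_halfLine : Measurable halfLine :=
  Measurable.ite measurableSet_Ici measurable_const measurable_const

lemma norm_one_div_sub_one_div_le {s e : ℝ} {z : ℂ} (hz : z.im < 0) :
    ‖1 / ((s : ℂ) - z) - 1 / ((e : ℂ) - z)‖ ≤ (z.im ^ 2)⁻¹ * |e - s| := by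
  have hη : 0 < -z.im := by linarith
  have h1 : ∀ r : ℝ, (r : ℂ) - z ≠ 0 := by
    intro r h
    have := congrArg Complex.im h
    simp at this
    linarith
  have e1 : 1 / ((s : ℂ) - z) - 1 / ((e : ℂ) - z) =
      1 / ((s : ℂ) - z) * (1 / ((e : ℂ) - z)) * ((e - s : ℝ) : ℂ) := by
    have := h1 s
    have := h1 e
    push_cast
    field_simp
    ring
  rw [e1, norm_mul, norm_mul, Complex.norm_real, norm_eq_abs]
  refine mul_le_mul_of_nonneg_right ?_ (abs_nonneg _)
  have b1 := norm_one_div_sub_le s hη (w := z) (by linarith)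
  have b2 := norm_one_div_sub_le e hη (w := z) (by linarith)
  calc _ ≤ 1 / (-z.im) * (1 / (-z.im)) := mul_le_mul b1 b2 (norm_nonneg _) (by positivity)
    _ = _ := by field_simp

lemma norm_pole_sub_le {s : ℝ} (hs : s ∈ Ico (-1 : ℝ) 1) {z : ℂ} (hz : z.im < 0) :
    ‖1 / ((s : ℂ) - z) - ((halfLine s : ℝ) * (1 / (1 - z)) +
      ((1 - halfLine s : ℝ) : ℂ) * (1 / (-1 - z)))‖ ≤ (z.im ^ 2)⁻¹ * gap s := by
  have hg : 1 - |s| ≤ gap s := le_max_left _ _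
  have h0 : 0 ≤ (z.im ^ 2)⁻¹ := by positivity
  unfold halfLine
  split_ifs with h
  · have := norm_one_div_sub_one_div_le (s := s) (e := 1) hz
    rw [abs_of_nonneg (by linarith [hs.2])] at this
    rw [abs_of_nonneg h] at hg
    simpa using this.trans (mul_le_mul_of_nonneg_left hg h0)
  · have := norm_one_div_sub_one_div_le (s := s) (e := -1) hz
    rw [abs_of_nonpos (by linarith [hs.1])] at this
    rw [abs_of_neg (not_le.1 h)] at hg
    simpa using this.trans (mul_le_mul_of_nonneg_left (by linarith) h0)

/-- The mass of `f` carried by the orbits that are alive, weighted by a function of the position. -/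
noncomputable def mass (β : ℝ) (f : ℝ → ℂ) (P : ℝ → ℝ) (n : ℕ) : ℂ :=
  ∫ t, f t * (alive β n t * P (orb β n t) : ℝ)

lemma abs_alive_mul_le (β : ℝ) (n : ℕ) {p : ℝ} (hp0 : 0 ≤ p) (hp : p ≤ 1) (t : ℝ) :
    |alive β n t * p| ≤ 1 := by
  rw [abs_of_nonneg (mul_nonneg (alive_nonneg β n t) hp0)]
  exact mul_le_one₀ (alive_le_one β n t) hp0 hp

lemma norm_mass_le {β : ℝ} {f : ℝ → ℂ} (hf : Integrable f) {P : ℝ → ℝ} (hP0 : ∀ s, 0 ≤ P s)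
    (hP : ∀ s, P s ≤ 1) (n : ℕ) : ‖mass β f P n‖ ≤ ∫ t, ‖f t‖ := by
  have := norm_integral_mul_le hf (φ := fun t => ((alive β n t * P (orb β n t) : ℝ) : ℂ)) (B := 1)
    fun t => by rw [Complex.norm_real]; exact abs_alive_mul_le β n (hP0 _) (hP _) t
  rwa [one_mul] at this

lemma integrable_mass {β : ℝ} {f : ℝ → ℂ} (hf : Integrable f) {P : ℝ → ℝ} (hm : Measurable P)
    (hP0 : ∀ s, 0 ≤ P s) (hP : ∀ s, P s ≤ 1) (n : ℕ) :
    Integrable fun t => f t * (alive β n t * P (orb β n t) : ℝ) :=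
  integrable_mul_ofReal hf ((measurable_alive β n).mul (hm.comp (measurable_orb β n)))
    fun t => abs_alive_mul_le β n (hP0 _) (hP _) t

lemma halfLine_nonneg (s : ℝ) : 0 ≤ halfLine s := by unfold halfLine; split_ifs <;> simp

lemma halfLine_le_one (s : ℝ) : halfLine s ≤ 1 := by unfold halfLine; split_ifs <;> simp

lemma integrable_norm_mul_gap {β : ℝ} {f : ℝ → ℂ} (hf : Integrable f) (n : ℕ) :
    Integrable (fun t => ‖f t‖ * (alive β n t * gap (orb β n t))) := by
  have := (integrable_mass (β := β) hf measurable_gap gap_nonneg gap_le_one n).norm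
  refine this.congr (Eventually.of_forall fun t => ?_)
  simp only
  rw [norm_mul, Complex.norm_real,
    norm_of_nonneg (mul_nonneg (alive_nonneg β n t) (gap_nonneg _))]

lemma norm_cauchy_orb_sub_le {β : ℝ} {f : ℝ → ℂ} (hf : Integrable f) (n : ℕ) {z : ℂ}
    (hz : z.im < 0) :
    ‖cauchy (fun t => f t * (alive β n t : ℝ)) (orb β n) z - (mass β f halfLine n * (1 / (1 - z)) +
      mass β f (fun s => 1 - halfLine s) n * (1 / (-1 - z)))‖ ≤
      (z.im ^ 2)⁻¹ * ∫ t, ‖f t‖ * (alive β n t * gap (orb β n t)) := by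
  have hη : 0 < -z.im := by linarith
  have i1 := (integrable_mass (β := β) hf measurable_halfLine halfLine_nonneg
    halfLine_le_one n).mul_const (1 / (1 - z))
  have i2 := (integrable_mass (β := β) hf (measurable_const.sub measurable_halfLine)
    (P := fun s => 1 - halfLine s) (fun s => by linarith [halfLine_le_one s])
    (fun s => by linarith [halfLine_nonneg s]) n).mul_const (1 / (-1 - z))
  have i3 : Integrable (fun t => f t * (alive β n t : ℝ) * (1 / ((orb β n t : ℂ) - z))) := by
    refine integrable_mul_bounded (integrable_mul_alive β hf n) ?_ (B := 1 / -z.im)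
      fun t => norm_one_div_sub_le _ hη (by linarith)
    have := measurable_orb β n
    fun_prop
  have i5 : Integrable (fun t => f t * (alive β n t * halfLine (orb β n t) : ℝ) * (1 / (1 - z)) +
      f t * (alive β n t * (1 - halfLine (orb β n t)) : ℝ) * (1 / (-1 - z))) := i1.add i2
  unfold cauchy mass
  rw [← integral_mul_const, ← integral_mul_const, ← integral_add i1 i2]
  beta_reduce
  rw [← integral_sub i3 i5, ← integral_const_mul]
  refine norm_integral_le_of_norm_le ((integrable_norm_mul_gap hf n).const_mul _) (Eventually.of_forall fun t => ?_)
  rcases alive_eq β n t with h | h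
  · simp [h]
  · have hp := norm_pole_sub_le (orb_mem h) hz
    rw [h]
    have e : f t * ((1 : ℝ) : ℂ) * (1 / ((orb β n t : ℂ) - z)) -
        (f t * ((1 * halfLine (orb β n t) : ℝ) : ℂ) * (1 / (1 - z)) +
          f t * ((1 * (1 - halfLine (orb β n t)) : ℝ) : ℂ) * (1 / (-1 - z))) =
        f t * (1 / ((orb β n t : ℂ) - z) - ((halfLine (orb β n t) : ℝ) * (1 / (1 - z)) +
          ((1 - halfLine (orb β n t) : ℝ) : ℂ) * (1 / (-1 - z)))) := by
      push_cast
      ring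
    rw [e, norm_mul, one_mul]
    calc _ ≤ ‖f t‖ * ((z.im ^ 2)⁻¹ * gap (orb β n t)) := mul_le_mul_of_nonneg_left hp (norm_nonneg _)
      _ = _ := by ring

lemma average_even_le_dwell (β : ℝ) {N : ℕ} (hN : 0 < N) (t : ℝ) :
    (N : ℝ)⁻¹ * ∑ k ∈ Finset.range N, alive β (2 * (k + 1)) t * gap (orb β (2 * (k + 1)) t) ≤
      3 * dwell β (2 * N + 1) t := by
  set a : ℕ → ℝ := fun n => alive β n t * gap (orb β n t) with ha
  have ha0 : ∀ n, 0 ≤ a n := fun n => mul_nonneg (alive_nonneg β n t) (gap_nonneg _)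
  have h1 : ∀ N : ℕ, ∑ k ∈ Finset.range N, a (2 * (k + 1)) ≤ ∑ n ∈ Finset.range (2 * N + 1), a n := by
    intro N
    induction N with
    | zero => simpa using ha0 0
    | succ N ih =>
      rw [Finset.sum_range_succ, show 2 * (N + 1) + 1 = 2 * N + 1 + 1 + 1 by ring,
        Finset.sum_range_succ, Finset.sum_range_succ, show 2 * (N + 1) = 2 * N + 1 + 1 by ring]
      linarith [ha0 (2 * N + 1)]
  have hN' : (1 : ℝ) ≤ N := by exact_mod_cast hN
  have h2 : 0 ≤ ∑ n ∈ Finset.range (2 * N + 1), a n := Finset.sum_nonneg fun n _ => ha0 n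
  have h3 : (N : ℝ)⁻¹ ≤ 3 * ((2 * N + 1 : ℕ) : ℝ)⁻¹ := by
    push_cast
    rw [← div_eq_mul_inv, inv_eq_one_div, div_le_div_iff₀ (by positivity) (by positivity)]
    linarith
  calc _ ≤ (N : ℝ)⁻¹ * ∑ n ∈ Finset.range (2 * N + 1), a n :=
        mul_le_mul_of_nonneg_left (h1 N) (by positivity)
    _ ≤ 3 * ((2 * N + 1 : ℕ) : ℝ)⁻¹ * ∑ n ∈ Finset.range (2 * N + 1), a n :=
        mul_le_mul_of_nonneg_right h3 h2
    _ = _ := by rw [dwell, mul_assoc]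

/-- Average over the first `N` even positive times. -/
noncomputable def evenAvg (u : ℕ → ℂ) (N : ℕ) : ℂ :=
  (N : ℂ)⁻¹ * ∑ k ∈ Finset.range N, u (2 * (k + 1))

lemma tendsto_evenAvg_cauchy {β : ℝ} (hβ : 0 < β) (hβ1 : β ≤ 1) {f : ℝ → ℂ} (hf : Integrable f)
    {z : ℂ} (hz : z.im < 0) :
    Tendsto (fun N => evenAvg (fun n => cauchy (fun t => f t * (alive β n t : ℝ)) (orb β n) z) N -
      (evenAvg (mass β f halfLine) N * (1 / (1 - z)) +
        evenAvg (mass β f (fun s => 1 - halfLine s)) N * (1 / (-1 - z)))) atTop (𝓝 0) := by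
  have h1 := (tendsto_integral_mul_dwell hβ hβ1 hf).comp
    (tendsto_atTop_mono (fun N : ℕ => (by omega : N ≤ 2 * N + 1)) tendsto_id)
  have h2 := (h1.const_mul 3).const_mul (z.im ^ 2)⁻¹
  simp only [mul_zero] at h2
  refine squeeze_zero_norm' ?_ h2
  filter_upwards [eventually_gt_atTop 0] with N hN
  have ig := integrable_norm_mul_gap (β := β) hf
  have id : Integrable (fun t => ‖f t‖ * dwell β (2 * N + 1) t) := by
    refine hf.norm.mul_bdd (c := 1) (measurable_dwell _ _).aestronglyMeasurable
      (Eventually.of_forall fun t => ?_)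
    rw [norm_of_nonneg (dwell_nonneg _ _ _)]
    exact dwell_le_one _ _ _
  have e : evenAvg (fun n => cauchy (fun t => f t * (alive β n t : ℝ)) (orb β n) z) N -
      (evenAvg (mass β f halfLine) N * (1 / (1 - z)) +
        evenAvg (mass β f (fun s => 1 - halfLine s)) N * (1 / (-1 - z))) =
      evenAvg (fun n => cauchy (fun t => f t * (alive β n t : ℝ)) (orb β n) z -
        (mass β f halfLine n * (1 / (1 - z)) +
          mass β f (fun s => 1 - halfLine s) n * (1 / (-1 - z)))) N := by
    simp only [evenAvg, Finset.sum_sub_distrib, Finset.sum_add_distrib, ← Finset.sum_mul]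
    ring
  rw [e, evenAvg, norm_mul, norm_inv, Complex.norm_natCast]
  have h0 : (0 : ℝ) ≤ (N : ℝ)⁻¹ := by positivity
  calc _ ≤ (N : ℝ)⁻¹ * ∑ k ∈ Finset.range N, (z.im ^ 2)⁻¹ *
          ∫ t, ‖f t‖ * (alive β (2 * (k + 1)) t * gap (orb β (2 * (k + 1)) t)) :=
        mul_le_mul_of_nonneg_left ((norm_sum_le _ _).trans (Finset.sum_le_sum fun k _ =>
          norm_cauchy_orb_sub_le hf _ hz)) h0
    _ = (z.im ^ 2)⁻¹ * ((N : ℝ)⁻¹ * ∑ k ∈ Finset.range N,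
          ∫ t, ‖f t‖ * (alive β (2 * (k + 1)) t * gap (orb β (2 * (k + 1)) t))) := by
        rw [← Finset.mul_sum]; ring
    _ ≤ (z.im ^ 2)⁻¹ * (3 * ∫ t, ‖f t‖ * dwell β (2 * N + 1) t) := by
        refine mul_le_mul_of_nonneg_left ?_ (by positivity)
        rw [← integral_finsetSum _ fun k _ => ig _, ← integral_const_mul, ← integral_const_mul]
        refine integral_mono ((integrable_finsetSum _ fun k _ => ig _).const_mul _)
          (id.const_mul _) fun t => ?_
        simp only
        have := mul_le_mul_of_nonneg_left (average_even_le_dwell β hN t) (norm_nonneg (f t))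
        rw [← Finset.mul_sum]
        linarith
    _ = _ := rfl

lemma norm_evenAvg_le {u : ℕ → ℂ} {R : ℝ} (hR : ∀ n, ‖u n‖ ≤ R) (N : ℕ) : ‖evenAvg u N‖ ≤ R :=
  norm_average_le (fun k => hR (2 * (k + 1))) N

lemma measurable_smear_ker {β : ℝ} {f : ℝ → ℂ} (hf : Integrable f) (n : ℕ) :
    Measurable (smear f (ker β n)) :=
  measurable_smear hf (measurable_ker_comp n measurable_fst measurable_snd)

lemma norm_evenAvg_smear_le {β : ℝ} {f : ℝ → ℂ} (hf : Integrable f) (N : ℕ) (y : ℝ) :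
    ‖evenAvg (fun n => smear f (ker β n) y) N‖ ≤ 11 * ∫ t, ‖f t‖ := by
  have h0 : 0 ≤ ∫ t, ‖f t‖ := integral_nonneg fun t => norm_nonneg _
  rcases N.eq_zero_or_pos with rfl | hN
  · simp only [evenAvg, Finset.range_zero, Finset.sum_empty, mul_zero, norm_zero]
    positivity
  have hN' : (1 : ℝ) ≤ N := by exact_mod_cast hN
  have hi : ∀ n, Integrable (fun t => f t * (ker β n t y : ℝ)) := fun n =>
    integrable_mul_ofReal hf (measurable_ker_comp n measurable_id measurable_const)
      fun t => abs_ker_le β n t y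
  have e : ∑ k ∈ Finset.range N, smear f (ker β (2 * (k + 1))) y =
      ∫ t, f t * ((∑ k ∈ Finset.range N, ker β (2 * (k + 1)) t y : ℝ) : ℂ) := by
    unfold smear
    rw [← integral_finsetSum _ fun k _ => hi _]
    push_cast
    simp only [Finset.mul_sum]
  rw [evenAvg, e, norm_mul, norm_inv, Complex.norm_natCast, inv_mul_le_iff₀ (by positivity)]
  refine (norm_integral_mul_le hf (B := 7 * N + 4) fun t => ?_).trans ?_
  · rw [Complex.norm_real]
    exact abs_sum_ker_le β N t y
  · nlinarith

lemma one_sub_ne_zero_of_norm_lt {z : ℂ} (hz : ‖z‖ < 1) : 1 - z ≠ 0 ∧ -1 - z ≠ 0 := by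
  constructor
  · intro h
    rw [← sub_eq_zero.1 h] at hz
    simp at hz
  · intro h
    rw [← sub_eq_zero.1 h] at hz
    simp at hz

lemma norm_poles_le_rho {x : ℝ} (hx : |x| < 1) :
    ‖(1 : ℂ) / (1 - x)‖ ≤ rho x ∧ ‖(1 : ℂ) / (-1 - x)‖ ≤ rho x := by
  have h := abs_lt.1 hx
  have h1 := one_sub_sq_pos hx
  have e1 : (1 : ℂ) / (1 - x) = ((1 / (1 - x) : ℝ) : ℂ) := by push_cast; rfl
  have e2 : (1 : ℂ) / (-1 - x) = ((1 / (-1 - x) : ℝ) : ℂ) := by push_cast; rfl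
  rw [e1, e2, Complex.norm_real, Complex.norm_real, norm_eq_abs, norm_eq_abs, abs_div, abs_div,
    abs_one, abs_of_pos (by linarith : 0 < 1 - x), abs_of_neg (by linarith : -1 - x < 0), rho]
  constructor <;> rw [div_le_div_iff₀ (by linarith) h1] <;> nlinarith

/-- The Cauchy transform of `f` on the lower half disc extends holomorphically to the disc. -/
lemma exists_extension {β : ℝ} (hβ : 0 < β) (hβ1 : β ≤ 1) {f g : ℝ → ℂ}
    (hf : Integrable f) (hg : Integrable g)
    (hfg : ∀ z : ℂ, z.im < 0 → ∫ t, f t * polar ((-β / t : ℝ) : ℂ) z = -cauchy g id z)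
    (hgf : ∀ z : ℂ, z.im < 0 → ∫ t, g t * polar ((-β / t : ℝ) : ℂ) z = -cauchy f id z) :
    ∃ (H : ℂ → ℂ) (C : ℝ), DifferentiableOn ℂ H (Metric.ball 0 1) ∧
      (∀ x : ℝ, |x| < 1 → ‖H x‖ ≤ C * rho x) ∧
      ∀ z : ℂ, ‖z‖ < 1 → z.im < 0 → H z = cauchy f id z := by
  set L := ∫ t, ‖f t‖ with hL
  have ha : ∀ N, evenAvg (mass β f halfLine) N ∈ Metric.closedBall (0 : ℂ) L := fun N => by
    rw [mem_closedBall_zero_iff]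
    exact norm_evenAvg_le (norm_mass_le hf halfLine_nonneg halfLine_le_one) N
  have hb : ∀ N, evenAvg (mass β f fun s => 1 - halfLine s) N ∈ Metric.closedBall (0 : ℂ) L :=
    fun N => by
      rw [mem_closedBall_zero_iff]
      exact norm_evenAvg_le (norm_mass_le hf (fun s => by linarith [halfLine_le_one s])
        (fun s => by linarith [halfLine_nonneg s])) N
  obtain ⟨a, ha', φ₁, hφ₁, la⟩ := (isCompact_closedBall (0 : ℂ) L).tendsto_subseq ha
  obtain ⟨b, hb', φ₂, hφ₂, lb⟩ := (isCompact_closedBall (0 : ℂ) L).tendsto_subseq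
    fun N => hb (φ₁ N)
  have hms : ∀ N, Measurable fun y => evenAvg (fun n => smear f (ker β n) y) N := fun N =>
    measurable_average (fun k => measurable_smear_ker hf (2 * (k + 1))) N
  have hbs := norm_evenAvg_smear_le (β := β) hf
  obtain ⟨h, φ₃, hφ₃, hd, lh⟩ := exists_subseq_disk hβ
    (θ := fun N y => evenAvg (fun n => smear f (ker β n) y) (φ₁ (φ₂ N)))
    (fun N => hms _) (fun N => hbs _)
  let φ : ℕ → ℕ := fun N => φ₁ (φ₂ (φ₃ N))
  have hφ : Tendsto φ atTop atTop :=
    hφ₁.tendsto_atTop.comp (hφ₂.tendsto_atTop.comp hφ₃.tendsto_atTop)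
  have la' : Tendsto (fun N => evenAvg (mass β f halfLine) (φ N)) atTop (𝓝 a) :=
    la.comp (hφ₂.tendsto_atTop.comp hφ₃.tendsto_atTop)
  have lb' : Tendsto (fun N => evenAvg (mass β f fun s => 1 - halfLine s) (φ N)) atTop (𝓝 b) :=
    lb.comp hφ₃.tendsto_atTop
  refine ⟨fun z => a * (1 / (1 - z)) + b * (1 / (-1 - z)) + h z, L + L + 11 * L, ?_, ?_, ?_⟩
  · refine DifferentiableOn.add (fun z hz => ?_) hd
    obtain ⟨h1, h2⟩ := one_sub_ne_zero_of_norm_lt (mem_ball_zero_iff.1 hz)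
    exact (by fun_prop (disch := assumption) : DifferentiableAt ℂ _ z).differentiableWithinAt
  · intro x hx
    obtain ⟨h1, h2⟩ := norm_poles_le_rho hx
    have h3 : ‖h x‖ ≤ 11 * L * rho x := le_of_tendsto (lh _ (norm_ofReal_lt hx)).norm
      (Eventually.of_forall fun k => norm_disk_le hβ (hbs _) hx)
    have hL0 : 0 ≤ L := integral_nonneg fun t => norm_nonneg _
    rw [mem_closedBall_zero_iff] at ha' hb'
    refine (norm_add₃_le).trans ?_
    rw [norm_mul, norm_mul]
    have h4 := mul_le_mul ha' h1 (norm_nonneg _) hL0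
    have h5 := mul_le_mul hb' h2 (norm_nonneg _) hL0
    linarith
  · intro z hz hi
    have l1 := (tendsto_evenAvg_cauchy hβ hβ1 hf hi).comp hφ
    have l2 := ((la'.mul_const (1 / (1 - z))).add (lb'.mul_const (1 / (-1 - z)))).add (lh z hz)
    have l3 := l1.add l2
    rw [zero_add] at l3
    refine tendsto_nhds_unique l3 (tendsto_const_nhds.congr' ?_)
    filter_upwards [hφ.eventually_gt_atTop 0] with N hN
    have hN0 : ((φ N : ℕ) : ℂ) ≠ 0 := by exact_mod_cast hN.ne'
    have e1 : disk β (fun y => evenAvg (fun n => smear f (ker β n) y) (φ N)) z =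
        evenAvg (fun n => disk β (smear f (ker β n)) z) (φ N) :=
      disk_average hβ (fun k => measurable_smear_ker hf (2 * (k + 1)))
        (fun k => norm_smear_le hf (abs_ker_le β (2 * (k + 1)))) _ hz
    have e2 : evenAvg (fun n => cauchy (fun t => f t * (alive β n t : ℝ)) (orb β n) z) (φ N) +
        evenAvg (fun n => disk β (smear f (ker β n)) z) (φ N) = cauchy f id z := by
      rw [evenAvg, evenAvg, ← mul_add, ← Finset.sum_add_distrib]
      simp_rw [cauchy_add_disk hβ hβ1 hf hg hfg hgf _ hz hi]
      rw [Finset.sum_const, Finset.card_range, nsmul_eq_mul, inv_mul_cancel_left₀ hN0]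
    rw [← e2, ← e1]
    simp only [Function.comp, φ]
    ring

/-- Both Cauchy transforms extend to multiples of the invariant density. -/
lemma cauchy_eq_density {β : ℝ} (hβ : 0 < β) (hβ1 : β ≤ 1) {f g : ℝ → ℂ}
    (hf : Integrable f) (hg : Integrable g)
    (hfg : ∀ z : ℂ, z.im < 0 → ∫ t, f t * polar ((-β / t : ℝ) : ℂ) z = -cauchy g id z)
    (hgf : ∀ z : ℂ, z.im < 0 → ∫ t, g t * polar ((-β / t : ℝ) : ℂ) z = -cauchy f id z) :
    ∃ c : ℂ, ∀ z : ℂ, ‖z‖ < 1 → z.im < 0 → cauchy f id z = c * (2 / (1 - z ^ 2)) := by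
  obtain ⟨F, C, dF, bF, eF⟩ := exists_extension hβ hβ1 hf hg hfg hgf
  obtain ⟨G, D, dG, bG, eG⟩ := exists_extension hβ hβ1 hg hf hgf hfg
  have exchange : ∀ {f g : ℝ → ℂ} {F G : ℂ → ℂ}, Integrable f →
      (∀ z : ℂ, z.im < 0 → ∫ t, f t * polar ((-β / t : ℝ) : ℂ) z = -cauchy g id z) →
      DifferentiableOn ℂ F (Metric.ball 0 1) → DifferentiableOn ℂ G (Metric.ball 0 1) →
      (∀ z : ℂ, ‖z‖ < 1 → z.im < 0 → F z = cauchy f id z) →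
      (∀ z : ℂ, ‖z‖ < 1 → z.im < 0 → G z = cauchy g id z) →
      ∀ x : ℝ, |x| < 1 → transfer β F x = -G x := by
    intro f g F G hf hfg dF dG eF eG x hx
    have key : ∀ z : ℂ, ‖z‖ < 1 → z.im < 0 → transfer β F z = -G z := by
      intro z hz hi
      have h := transfer_cauchy_identity hβ hβ1 (integrable_zero ℝ ℂ volume) hf measurable_id
        measurable_id (Eventually.of_forall fun t => Or.inl rfl)
        (by
          filter_upwards [Measure.ae_ne volume (0 : ℝ)] with t ht
          exact Or.inr ht)
        dF.continuousOn (c := 1) (fun w hw hj => by simp [cauchy, eF w hw hj]) hz hi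
      rw [eG z hz hi, ← hfg z hi]
      simpa using h
    have hx' := norm_ofReal_lt hx
    have l1 := (continuousAt_transfer hβ hβ1 dF.continuousOn hx').tendsto
    have l2 := ((dG.continuousOn.continuousAt
      (Metric.isOpen_ball.mem_nhds (mem_ball_zero_iff.2 hx'))).neg).tendsto
    let u : ℝ → ℂ := fun ε => x - ε * Complex.I
    have hu : Tendsto u (𝓝[>] 0) (𝓝 (x : ℂ)) := by
      have : Continuous u := by fun_prop
      have h := this.tendsto 0
      simp only [u, Complex.ofReal_zero, zero_mul, sub_zero] at h
      exact h.mono_left nhdsWithin_le_nhds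
    refine tendsto_nhds_unique (l1.comp hu) ((l2.comp hu).congr' ?_)
    have h1 : ∀ᶠ ε in 𝓝[>] (0 : ℝ), ‖u ε‖ < 1 := hu.norm.eventually (gt_mem_nhds hx')
    filter_upwards [h1, self_mem_nhdsWithin] with ε h2 h3
    exact (key _ h2 (by simpa [u] using h3)).symm
  have t1 := exchange hf hfg dF dG eF eG
  have t2 := exchange hg hgf dG dF eG eF
  have hneg : ∀ (h : ℂ → ℂ) (z : ℂ), transfer β (fun w => -h w) z = -transfer β h z := by
    intro h z
    simp only [transfer, mul_neg, tsum_neg]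
  have hr : ∀ x : ℝ, |x| < 1 → 0 ≤ rho x := fun x hx => (rho_pos hx).le
  obtain ⟨c, hc⟩ := eq_density_of_exchange hβ hβ1 (h₁ := F) (h₂ := fun w => -G w)
    (C := max C D) dF dG.neg
    (fun x hx => (bF x hx).trans (mul_le_mul_of_nonneg_right (le_max_left _ _) (hr x hx)))
    (fun x hx => by
      rw [norm_neg]
      exact (bG x hx).trans (mul_le_mul_of_nonneg_right (le_max_right _ _) (hr x hx)))
    (fun x hx => by rw [hneg, t2 x hx, neg_neg]) (fun x hx => (t1 x hx).symm)
  exact ⟨c, fun z hz hi => by rw [← eF z hz hi, hc z hz]⟩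

lemma neg_div_neg_div {β : ℝ} (hβ : 0 < β) (s : ℝ) : -β / (-β / s) = s := by
  rcases eq_or_ne s 0 with rfl | h
  · simp
  · have := hβ.ne'
    field_simp

lemma integral_mul_comp_neg_div {β : ℝ} (hβ : 0 < β) (f φ : ℝ → ℂ) :
    ∫ t, f t * φ (-β / t) = ∫ s, (β / s ^ 2) • f (-β / s) * φ s := by
  rw [integral_neg_div hβ]
  simp only [neg_div_neg_div hβ, smul_mul_assoc]

lemma integral_inversion_mul {β : ℝ} (hβ : 0 < β) (f φ : ℝ → ℂ) :
    ∫ s, (β / s ^ 2) • f (-β / s) * φ (-β / s) = ∫ t, f t * φ t := by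
  rw [integral_neg_div hβ (fun t => f t * φ t)]
  simp only [smul_mul_assoc]

lemma measurable_one_div_ofReal_sub (z : ℂ) : Measurable fun t : ℝ => 1 / ((t : ℂ) - z) := by
  fun_prop

lemma isOpen_lowerHalfPlane : IsOpen {z : ℂ | z.im < 0} :=
  isOpen_lt Complex.continuous_im continuous_const

lemma isPreconnected_lowerHalfPlane : IsPreconnected {z : ℂ | z.im < 0} :=
  (convex_halfSpace_im_lt 0).isPreconnected

lemma differentiableOn_cauchy {f : ℝ → ℂ} (hf : Integrable f) :
    DifferentiableOn ℂ (cauchy f id) {z : ℂ | z.im < 0} := by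
  intro z hz
  have hz : z.im < 0 := hz
  set η := -z.im / 2 with hη
  have hη0 : 0 < η := by rw [hη]; linarith
  have hs : {w : ℂ | w.im < -η} ∈ 𝓝 z :=
    (isOpen_lt Complex.continuous_im continuous_const).mem_nhds (by
      change z.im < -η
      rw [hη]; linarith)
  have hne : ∀ (t : ℝ) (w : ℂ), w.im < 0 → (t : ℂ) - w ≠ 0 := by
    intro t w hw h
    have := congrArg Complex.im h
    simp at this
    exact hw.ne this
  have := hasDerivAt_integral_of_dominated_loc_of_deriv_le (μ := volume)
    (F := fun (w : ℂ) (t : ℝ) => f t * (1 / ((t : ℂ) - w)))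
    (F' := fun (w : ℂ) (t : ℝ) => f t * ((1 / ((t : ℂ) - w)) * (1 / ((t : ℂ) - w))))
    (bound := fun t => ‖f t‖ * (1 / η * (1 / η))) hs
    (Eventually.of_forall fun w =>
      hf.aestronglyMeasurable.mul (measurable_one_div_ofReal_sub w).aestronglyMeasurable)
    (integrable_mul_bounded hf (measurable_one_div_ofReal_sub z) (B := 1 / (-z.im))
      fun t => norm_one_div_sub_le t (by linarith) (by linarith))
    (hf.aestronglyMeasurable.mul ((measurable_one_div_ofReal_sub z).mul
      (measurable_one_div_ofReal_sub z)).aestronglyMeasurable)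
    (Eventually.of_forall fun t w hw => by
      have hb := norm_one_div_sub_le t hη0 (le_of_lt hw : w.im ≤ -η)
      rw [norm_mul, norm_mul]
      gcongr)
    (hf.norm.mul_const _)
    (Eventually.of_forall fun t w hw => by
      have hw' : w.im < 0 := lt_trans hw (by linarith)
      have h0 := hne t w hw'
      have h1 := ((hasDerivAt_id w).const_sub (t : ℂ)).inv h0
      have h2 := h1.const_mul (f t)
      refine (h2.congr_deriv ?_).congr_of_eventuallyEq (Eventually.of_forall fun w => ?_)
      · simp only [id]
        field_simp
      · simp)
  exact this.2.differentiableAt.differentiableWithinAt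

lemma tendsto_mul_cauchy {f : ℝ → ℂ} (hf : Integrable f) :
    Tendsto (fun δ : ℝ => (δ : ℂ) * cauchy f id (1 - δ - δ * Complex.I)) (𝓝[>] 0) (𝓝 0) := by
  have h : Tendsto (fun δ : ℝ => ∫ t : ℝ, f t * ((δ : ℂ) * (1 / ((t : ℂ) - (1 - δ - δ * Complex.I)))))
      (𝓝[>] 0) (𝓝 (∫ _ : ℝ, (0 : ℂ))) := by
    refine tendsto_integral_filter_of_dominated_convergence (fun t => ‖f t‖)
      (Eventually.of_forall fun δ => hf.aestronglyMeasurable.mul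
        ((measurable_one_div_ofReal_sub _).const_mul _).aestronglyMeasurable) ?_ hf.norm ?_
    · filter_upwards [self_mem_nhdsWithin] with δ hδ
      have hδ : 0 < δ := hδ
      refine Eventually.of_forall fun t => ?_
      have := norm_one_div_sub_le t (w := 1 - δ - δ * Complex.I) hδ (by simp)
      rw [norm_mul, norm_mul, Complex.norm_real, norm_eq_abs, abs_of_pos hδ]
      refine mul_le_of_le_one_right (norm_nonneg _) ?_
      calc δ * _ ≤ δ * (1 / δ) := by gcongr
        _ = 1 := by field_simp
    · filter_upwards [Measure.ae_ne volume (1 : ℝ)] with t ht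
      have h0 : (t : ℂ) - 1 ≠ 0 := by
        intro h
        exact ht (by exact_mod_cast sub_eq_zero.1 h)
      have hc : ContinuousAt (fun δ : ℝ =>
          f t * ((δ : ℂ) * (1 / ((t : ℂ) - (1 - δ - δ * Complex.I))))) 0 := by
        refine continuousAt_const.mul (ContinuousAt.mul (by fun_prop)
          (continuousAt_const.div (by fun_prop) ?_))
        simpa using h0
      have := hc.tendsto
      simp only [Complex.ofReal_zero, zero_mul, mul_zero] at this
      exact this.mono_left nhdsWithin_le_nhds
  rw [integral_zero] at h
  refine h.congr fun δ => ?_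
  rw [cauchy, ← integral_const_mul]
  congr 1
  ext t
  simp only [id]
  ring

/-- The integrability of `f` excludes a nonzero multiple of the invariant density. -/
lemma density_coeff_eq_zero {f : ℝ → ℂ} (hf : Integrable f) {c : ℂ}
    (h : ∀ z : ℂ, ‖z‖ < 1 → z.im < 0 → cauchy f id z = c * (2 / (1 - z ^ 2))) : c = 0 := by
  have l1 : Tendsto (fun δ : ℝ => ((1 + Complex.I) * (2 - δ - δ * Complex.I)) *
      ((δ : ℂ) * cauchy f id (1 - δ - δ * Complex.I))) (𝓝[>] 0)
      (𝓝 (((1 + Complex.I) * (2 - (0 : ℝ) - (0 : ℝ) * Complex.I)) * 0)) := by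
    refine Tendsto.mul ?_ (tendsto_mul_cauchy hf)
    have : Continuous (fun δ : ℝ => (1 + Complex.I) * (2 - (δ : ℂ) - δ * Complex.I)) := by fun_prop
    exact (this.tendsto 0).mono_left nhdsWithin_le_nhds
  rw [mul_zero] at l1
  have l2 : Tendsto (fun _ : ℝ => 2 * c) (𝓝[>] 0) (𝓝 0) := by
    refine l1.congr' ?_
    filter_upwards [Ioo_mem_nhdsGT (zero_lt_one' ℝ)] with δ hδ
    obtain ⟨h0, h1⟩ := hδ
    set z : ℂ := 1 - δ - δ * Complex.I with hz
    have hre : z.re = 1 - δ := by simp [hz]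
    have him : z.im = -δ := by simp [hz]
    have hn : ‖z‖ < 1 := by
      have : ‖z‖ ^ 2 < 1 := by
        rw [Complex.sq_norm, Complex.normSq_apply, hre, him]
        nlinarith
      nlinarith [norm_nonneg z]
    rw [h z hn (by rw [him]; linarith)]
    have e : 1 - z ^ 2 = δ * ((1 + Complex.I) * (2 - δ - δ * Complex.I)) := by
      rw [hz]; ring
    have hne : 1 - z ^ 2 ≠ 0 := by
      intro h'
      have h2 : ‖z‖ ^ 2 = 1 := by rw [← norm_pow, ← sub_eq_zero.1 h', norm_one]
      nlinarith [norm_nonneg z]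
    rw [mul_left_comm, ← mul_assoc, ← e]
    field_simp
  have := tendsto_nhds_unique l2 tendsto_const_nhds
  simpa using this.symm

/-- If all the exponential moments vanish, so does the Cauchy transform below the real axis. -/
lemma cauchy_eq_zero {β : ℝ} (hβ : 0 < β) (hβ1 : β ≤ 1) {f : ℝ → ℂ} (hf : Integrable f)
    (h1 : ∀ n : ℕ, ∫ t : ℝ, f t * Complex.exp (Complex.I * π * n * t) = 0)
    (h2 : ∀ n : ℕ, ∫ t : ℝ, f t * Complex.exp (Complex.I * π * n * (-β / t : ℝ)) = 0)
    {z : ℂ} (hz : z.im < 0) : cauchy f id z = 0 := by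
  have hm : Measurable fun t : ℝ => -β / t := by fun_prop
  set g : ℝ → ℂ := fun s => (β / s ^ 2) • f (-β / s) with hg
  have ig : Integrable g := (integrable_neg_div hβ f).1 hf
  obtain ⟨c, hc⟩ := cauchy_eq_density hβ hβ1 hf ig
    (fun w hw => by
      rw [integral_mul_polar hf hm h2 hw, cauchy, cauchy]
      exact congrArg _ (integral_mul_comp_neg_div hβ f fun s => 1 / ((s : ℂ) - w)))
    (fun w hw => by
      rw [integral_mul_polar ig hm (fun n => (integral_inversion_mul hβ f
        fun t => Complex.exp (Complex.I * π * n * t)).trans (h1 n)) hw, cauchy, cauchy]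
      exact congrArg _ (integral_inversion_mul hβ f fun s => 1 / ((s : ℂ) - w)))
  have hc0 : c = 0 := density_coeff_eq_zero hf hc
  have han := (differentiableOn_cauchy hf).analyticOnNhd isOpen_lowerHalfPlane
  have h0 : (-(Complex.I / 2)) ∈ {z : ℂ | z.im < 0} := by simp
  refine han.eqOn_zero_of_preconnected_of_eventuallyEq_zero isPreconnected_lowerHalfPlane h0 ?_ hz
  filter_upwards [isOpen_lowerHalfPlane.mem_nhds h0,
    Metric.isOpen_ball.mem_nhds (show -(Complex.I / 2) ∈ Metric.ball (0 : ℂ) 1 by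
      simp; norm_num)] with w hw hw'
  rw [hc w (mem_ball_zero_iff.1 hw') hw, hc0]
  simp

lemma integrable_laplace {f : ℝ → ℂ} (hf : Integrable f) (w : ℝ) :
    Integrable (fun p : ℝ × ℝ => f p.2 *
      Complex.exp (Complex.I * (p.2 - ((2 * π * w : ℝ) - Complex.I)) * p.1))
      ((volume.restrict (Ioi 0)).prod volume) := by
  have h1 : Integrable (fun y : ℝ => Complex.exp ((-1 : ℂ) * y)) (volume.restrict (Ioi 0)) :=
    integrableOn_exp_mul_complex_Ioi (by simp) 0
  have h2 := h1.mul_prod hf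
  have h3 := h2.bdd_mul (c := 1) (f := fun p : ℝ × ℝ =>
    Complex.exp (((p.2 - 2 * π * w) * p.1 : ℝ) * Complex.I)) (by fun_prop)
    (Eventually.of_forall fun p => (Complex.norm_exp_ofReal_mul_I _).le)
  refine h3.congr (Eventually.of_forall fun p => ?_)
  simp only
  rw [← mul_assoc, ← Complex.exp_add, mul_comm]
  congr 2
  push_cast
  linear_combination -(p.1 : ℂ) * Complex.I_sq

/-- The Laplace transform of `y ↦ ∫ f(t) exp(iyt) dt` is a multiple of the Cauchy transform. -/
lemma integral_laplace {f : ℝ → ℂ} (hf : Integrable f) (w : ℝ) :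
    ∫ y in Ioi (0 : ℝ), ∫ t : ℝ, f t *
      Complex.exp (Complex.I * (t - ((2 * π * w : ℝ) - Complex.I)) * y) =
      Complex.I * cauchy f id ((2 * π * w : ℝ) - Complex.I) := by
  rw [integral_integral_swap (integrable_laplace hf w), cauchy, ← integral_const_mul]
  congr 1
  ext t
  rw [integral_const_mul, integral_exp_mul_complex_Ioi (by simp)]
  have : (t : ℂ) - ((2 * π * w : ℝ) - Complex.I) ≠ 0 := by
    intro h
    have := congrArg Complex.im h
    simp at this
  simp only [Complex.ofReal_zero, mul_zero, Complex.exp_zero, id]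
  have hI := Complex.I_ne_zero
  field_simp
  rw [Complex.I_sq]
  ring

lemma continuous_integral_mul_exp {f : ℝ → ℂ} (hf : Integrable f) :
    Continuous fun y : ℝ => ∫ t : ℝ, f t * Complex.exp (Complex.I * y * t) := by
  refine continuous_of_dominated (bound := fun t => ‖f t‖)
    (fun y => hf.aestronglyMeasurable.mul (by fun_prop))
    (fun y => Eventually.of_forall fun t => ?_) hf.norm (Eventually.of_forall fun t => by fun_prop)
  have e : Complex.I * y * t = (y * t : ℝ) * Complex.I := by push_cast; ring
  rw [norm_mul, e, Complex.norm_exp_ofReal_mul_I, mul_one]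

lemma integral_exp_eq_zero_of_cauchy {f : ℝ → ℂ} (hf : Integrable f)
    (h : ∀ z : ℂ, z.im < 0 → cauchy f id z = 0) {y : ℝ} (hy : 0 < y) :
    ∫ t : ℝ, f t * Complex.exp (Complex.I * y * t) = 0 := by
  set U : ℝ → ℂ := fun y => ∫ t : ℝ, f t * Complex.exp (Complex.I * y * t) with hU
  set H : ℝ → ℂ := (Ioi (0 : ℝ)).indicator fun y => Complex.exp (-y) * U y with hH
  have e : ∀ w y : ℝ, Complex.exp (↑(-2 * π * y * w) * Complex.I) * (Complex.exp (-y) * U y) =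
      ∫ t : ℝ, f t * Complex.exp (Complex.I * (t - ((2 * π * w : ℝ) - Complex.I)) * y) := by
    intro w y
    rw [hU, ← mul_assoc, ← integral_const_mul]
    congr 1
    ext t
    rw [mul_left_comm, ← Complex.exp_add, ← Complex.exp_add]
    congr 2
    push_cast
    linear_combination -(y : ℂ) * Complex.I_sq
  have hi : Integrable H := by
    rw [hH, integrable_indicator_iff measurableSet_Ioi]
    refine (integrable_laplace hf 0).integral_prod_left.congr (Eventually.of_forall fun y => ?_)
    have := e 0 y
    simp only [mul_zero, Complex.ofReal_zero, zero_mul, Complex.exp_zero, one_mul] at this ⊢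
    exact this.symm
  have hF : 𝓕 H = fun _ => 0 := by
    ext w
    rw [fourier_real_eq_integral_exp_smul]
    have e2 : (fun v : ℝ => Complex.exp (↑(-2 * π * v * w) * Complex.I) • H v) =
        (Ioi (0 : ℝ)).indicator fun y => ∫ t : ℝ, f t *
          Complex.exp (Complex.I * (t - ((2 * π * w : ℝ) - Complex.I)) * y) := by
      ext v
      by_cases hv : v ∈ Ioi (0 : ℝ)
      · rw [hH, indicator_of_mem hv, indicator_of_mem hv, smul_eq_mul, e]
      · rw [hH, indicator_of_notMem hv, indicator_of_notMem hv, smul_zero]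
    rw [e2, integral_indicator measurableSet_Ioi, integral_laplace hf, h _ (by simp), mul_zero]
  have hc : ContinuousAt H y := by
    have : Continuous fun y : ℝ => Complex.exp (-y) * U y :=
      (by fun_prop : Continuous fun y : ℝ => Complex.exp (-y)).mul (continuous_integral_mul_exp hf)
    refine this.continuousAt.congr ?_
    filter_upwards [Ioi_mem_nhds hy] with v hv
    rw [hH, indicator_of_mem hv]
  have key := hi.fourierInv_fourier_eq (by rw [hF]; exact integrable_zero _ _ _) hc
  rw [hF, hH, indicator_of_mem (show y ∈ Ioi 0 from hy)] at key
  have hz : 𝓕⁻ (fun _ : ℝ => (0 : ℂ)) y = 0 := by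
    rw [fourierInv_eq']
    simp
  rw [hz] at key
  exact (mul_eq_zero.1 key.symm).resolve_left (Complex.exp_ne_zero _)

/-- The difference of the Cauchy kernels with poles `1 + i η` and `-1 + i η`. -/
noncomputable def twoPole (η t : ℝ) : ℂ :=
  1 / ((t : ℂ) - (1 + η * Complex.I)) - 1 / ((t : ℂ) - (-1 + η * Complex.I))

/-- The function on the half line whose Fourier transform is a multiple of `twoPole`. -/
noncomputable def twoExp (η y : ℝ) : ℂ :=
  Complex.exp (Complex.I * (1 + η * Complex.I) * y) - Complex.exp (Complex.I * (-1 + η * Complex.I) * y)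

lemma ofReal_sub_pole_ne_zero {η : ℝ} (hη : 0 < η) (t a : ℝ) : (t : ℂ) - (a + η * Complex.I) ≠ 0 := by
  intro h
  have := congrArg Complex.im h
  simp at this
  exact hη.ne' this

lemma integrable_inv_normSq_sub_pole {η : ℝ} (hη : 0 < η) (a : ℝ) :
    Integrable fun t : ℝ => (‖(t : ℂ) - (a + η * Complex.I)‖ ^ 2)⁻¹ := by
  have h := ((integrable_inv_one_add_sq.comp_div hη.ne').comp_sub_right a).const_mul (η ^ 2)⁻¹
  refine h.congr (Eventually.of_forall fun t => ?_)
  simp only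
  rw [Complex.sq_norm, Complex.normSq_apply, ← mul_inv]
  congr 1
  simp
  field_simp
  ring

lemma integrable_twoPole {η : ℝ} (hη : 0 < η) : Integrable (twoPole η) := by
  have h1 := integrable_inv_normSq_sub_pole hη 1
  have h2 := integrable_inv_normSq_sub_pole hη (-1)
  refine (h1.add h2).mono' ?_ (Eventually.of_forall fun t => ?_)
  · unfold twoPole
    exact (((measurable_one_div_ofReal_sub _)).sub
      (measurable_one_div_ofReal_sub _)).aestronglyMeasurable
  · have n1 := ofReal_sub_pole_ne_zero hη t 1
    have n2 := ofReal_sub_pole_ne_zero hη t (-1)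
    have e : twoPole η t = 2 * (((t : ℂ) - ((1 : ℝ) + η * Complex.I))⁻¹ *
        ((t : ℂ) - ((-1 : ℝ) + η * Complex.I))⁻¹) := by
      unfold twoPole
      push_cast at n1 n2 ⊢
      field_simp
      ring
    rw [e, norm_mul, norm_mul, norm_inv, norm_inv, Complex.norm_ofNat, Pi.add_apply]
    rw [← inv_pow, ← inv_pow]
    nlinarith [sq_nonneg (‖(t : ℂ) - ((1 : ℝ) + η * Complex.I)‖⁻¹ -
      ‖(t : ℂ) - ((-1 : ℝ) + η * Complex.I)‖⁻¹)]

lemma integrableOn_twoExp {η : ℝ} (hη : 0 < η) : IntegrableOn (twoExp η) (Ioi 0) :=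
  (integrableOn_exp_mul_complex_Ioi (by simpa using hη) 0).sub
    (integrableOn_exp_mul_complex_Ioi (by simpa using hη) 0)

lemma fourier_twoExp {η : ℝ} (hη : 0 < η) (w : ℝ) :
    𝓕 ((Ioi 0).indicator (twoExp η)) w = -Complex.I * twoPole η (2 * π * w) := by
  have e : ∀ a : ℝ, (Complex.I * (a - 2 * π * w + η * Complex.I)).re < 0 := by
    intro a
    simpa using hη
  have e2 : (fun v : ℝ => Complex.exp (↑(-2 * π * v * w) * Complex.I) •
        (Ioi (0 : ℝ)).indicator (twoExp η) v) =
      (Ioi (0 : ℝ)).indicator fun y : ℝ =>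
        Complex.exp (Complex.I * ((1 : ℝ) - 2 * π * w + η * Complex.I) * y) -
        Complex.exp (Complex.I * ((-1 : ℝ) - 2 * π * w + η * Complex.I) * y) := by
    ext v
    by_cases hv : v ∈ Ioi (0 : ℝ)
    · rw [indicator_of_mem hv, indicator_of_mem hv, smul_eq_mul, twoExp, mul_sub,
        ← Complex.exp_add, ← Complex.exp_add]
      congr 2 <;> push_cast <;> ring
    · rw [indicator_of_notMem hv, indicator_of_notMem hv, smul_zero]
  rw [fourier_real_eq_integral_exp_smul, e2, integral_indicator measurableSet_Ioi,
    integral_sub (integrableOn_exp_mul_complex_Ioi (e 1) 0)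
      (integrableOn_exp_mul_complex_Ioi (e (-1)) 0),
    integral_exp_mul_complex_Ioi (e 1), integral_exp_mul_complex_Ioi (e (-1)), twoPole]
  have n1 := ofReal_sub_pole_ne_zero hη (2 * π * w) 1
  have n2 := ofReal_sub_pole_ne_zero hη (2 * π * w) (-1)
  have a1 : ∀ a : ℝ, Complex.I * (a - 2 * π * w + η * Complex.I) =
      -Complex.I * (((2 * π * w : ℝ) : ℂ) - (a + η * Complex.I)) := by
    intro a
    push_cast
    ring
  have hI := Complex.I_ne_zero
  rw [a1, a1]
  simp only [Complex.ofReal_zero, mul_zero, Complex.exp_zero]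
  rw [Complex.ofReal_one] at n1 ⊢
  rw [Complex.ofReal_neg, Complex.ofReal_one] at n2 ⊢
  generalize ((2 * π * w : ℝ) : ℂ) - (1 + η * Complex.I) = p at *
  generalize ((2 * π * w : ℝ) : ℂ) - (-1 + η * Complex.I) = q at *
  field_simp
  rw [Complex.I_sq]
  ring

lemma continuous_indicator_twoExp (η : ℝ) : Continuous ((Ioi 0).indicator (twoExp η)) := by
  have e : (Ioi 0).indicator (twoExp η) = fun y => twoExp η (max y 0) := by
    ext y
    by_cases hy : y ∈ Ioi (0 : ℝ)
    · rw [indicator_of_mem hy, max_eq_left (le_of_lt hy)]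
    · rw [indicator_of_notMem hy, max_eq_right (not_lt.1 hy)]
      simp [twoExp]
  rw [e]
  unfold twoExp
  fun_prop

lemma integral_twoPole_mul_exp {η : ℝ} (hη : 0 < η) {y : ℝ} (hy : 0 ≤ y) :
    ∫ t, twoPole η t * Complex.exp (Complex.I * y * t) = 2 * π * Complex.I * twoExp η y := by
  have hF : 𝓕 ((Ioi 0).indicator (twoExp η)) = fun w => -Complex.I * twoPole η (2 * π * w) :=
    funext (fourier_twoExp hη)
  have hp : (2 * π : ℝ) ≠ 0 := by positivity
  have key := ((integrable_indicator_iff measurableSet_Ioi).2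
    (integrableOn_twoExp hη)).fourierInv_fourier_eq
    (by rw [hF]; exact ((integrable_twoPole hη).comp_mul_left' hp).const_mul _)
    (continuous_indicator_twoExp η).continuousAt (v := y)
  have hv : (Ioi 0).indicator (twoExp η) y = twoExp η y := by
    rcases hy.eq_or_lt with rfl | h
    · simp [twoExp]
    · exact indicator_of_mem (s := Ioi 0) h _
  rw [hF, hv, fourierInv_eq'] at key
  have sub := Measure.integral_comp_mul_left
    (fun t : ℝ => twoPole η t * Complex.exp (Complex.I * y * t)) (2 * π)
  have e : (∫ v : ℝ, Complex.exp (↑(2 * π * inner ℝ v y) * Complex.I) •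
      (-Complex.I * twoPole η (2 * π * v))) = -Complex.I *
      ∫ x : ℝ, twoPole η (2 * π * x) * Complex.exp (Complex.I * y * (2 * π * x : ℝ)) := by
    rw [← integral_const_mul]
    congr 1
    ext v
    rw [smul_eq_mul, mul_comm, mul_assoc]
    congr 3
    simp
    ring
  rw [e, sub, abs_of_pos (by positivity), Complex.real_smul] at key
  rw [← key]
  have hpi : (π : ℂ) ≠ 0 := by exact_mod_cast Real.pi_ne_zero
  push_cast
  field_simp
  rw [Complex.I_sq]
  ring

lemma twoExp_pi_mul_nat (η : ℝ) (n : ℕ) : twoExp η (π * n) = 0 := by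
  rw [twoExp, sub_eq_zero, Complex.exp_eq_exp_iff_exists_int]
  refine ⟨n, ?_⟩
  push_cast
  ring

lemma twoExp_one_ne_zero (η : ℝ) : twoExp η 1 ≠ 0 := by
  rw [twoExp, sub_ne_zero, Ne, Complex.exp_eq_exp_iff_exists_int]
  rintro ⟨n, hn⟩
  have h := congrArg Complex.im hn
  simp at h
  have h' : (1 : ℝ) = n * π := by linarith
  have hp := Real.pi_gt_three
  have n0 : (0 : ℝ) < n := by
    by_contra hneg
    nlinarith
  have n1 : (1 : ℝ) ≤ n := by
    have : 0 < n := by exact_mod_cast n0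
    exact_mod_cast this
  nlinarith

lemma twoPole_neg_div {η : ℝ} (hη : 0 < η) {s : ℝ} (hs : s ≠ 0) :
    ((1 + η ^ 2) / s ^ 2 : ℝ) • twoPole η (-(1 + η ^ 2) / s) = -twoPole η s := by
  have n1 := ofReal_sub_pole_ne_zero hη s 1
  have n2 := ofReal_sub_pole_ne_zero hη s (-1)
  have m1 := ofReal_sub_pole_ne_zero hη (-(1 + η ^ 2) / s) 1
  have m2 := ofReal_sub_pole_ne_zero hη (-(1 + η ^ 2) / s) (-1)
  have e : ∀ t : ℝ, twoPole η t = 2 * (((t : ℂ) ^ 2 - 2 * η * t * Complex.I) - (1 + η ^ 2))⁻¹ := by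
    intro t
    have n1 := ofReal_sub_pole_ne_zero hη t 1
    have n2 := ofReal_sub_pole_ne_zero hη t (-1)
    have : ((t : ℂ) ^ 2 - 2 * η * t * Complex.I) - (1 + η ^ 2) =
        ((t : ℂ) - ((1 : ℝ) + η * Complex.I)) * ((t : ℂ) - ((-1 : ℝ) + η * Complex.I)) := by
      push_cast
      linear_combination (-(η : ℂ) ^ 2) * Complex.I_sq
    rw [this, twoPole]
    push_cast at n1 n2 ⊢
    field_simp
    ring
  have hs' : (s : ℂ) ≠ 0 := by exact_mod_cast hs
  have hb : (1 + (η : ℂ) ^ 2) ≠ 0 := by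
    have : (1 + η ^ 2 : ℝ) ≠ 0 := by positivity
    exact_mod_cast this
  rw [e, e, Complex.real_smul]
  have : (((-(1 + η ^ 2) / s : ℝ) : ℂ) ^ 2 - 2 * η * (-(1 + η ^ 2) / s : ℝ) * Complex.I) -
      (1 + η ^ 2) = -((1 + (η : ℂ) ^ 2) / s ^ 2) * ((s : ℂ) ^ 2 - 2 * η * s * Complex.I -
        (1 + η ^ 2)) := by
    push_cast
    field_simp
    ring
  rw [this, mul_inv]
  push_cast
  field_simp

/-- For `β > 1` the exponential moments do not determine membership in the Hardy space. -/
lemma exists_counterexample {β : ℝ} (hβ : 1 < β) : ∃ f : ℝ → ℂ, Integrable f ∧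
    (∀ n : ℕ, ∫ t : ℝ, f t * Complex.exp (Complex.I * π * n * t) = 0) ∧
    (∀ n : ℕ, ∫ t : ℝ, f t * Complex.exp (Complex.I * π * n * (-β / t : ℝ)) = 0) ∧
    ∫ t : ℝ, f t * Complex.exp (Complex.I * (1 : ℝ) * t) ≠ 0 := by
  set η := √(β - 1) with hη
  have hη0 : 0 < η := Real.sqrt_pos.2 (by linarith)
  have hb : β = 1 + η ^ 2 := by rw [hη, Real.sq_sqrt (by linarith)]; ring
  have h1 : ∀ n : ℕ, ∫ t : ℝ, twoPole η t * Complex.exp (Complex.I * π * n * t) = 0 := by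
    intro n
    have := integral_twoPole_mul_exp hη0 (y := π * n) (by positivity)
    rw [twoExp_pi_mul_nat, mul_zero] at this
    rw [← this]
    push_cast
    simp only [mul_assoc]
  refine ⟨twoPole η, integrable_twoPole hη0, h1, fun n => ?_, ?_⟩
  · rw [integral_mul_comp_neg_div (by linarith) (twoPole η)
      fun s : ℝ => Complex.exp (Complex.I * π * n * s)]
    rw [← neg_eq_zero, ← integral_neg, ← h1 n]
    refine integral_congr_ae ?_
    filter_upwards [Measure.ae_ne volume (0 : ℝ)] with s hs
    rw [hb, twoPole_neg_div hη0 hs]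
    ring
  · rw [integral_twoPole_mul_exp hη0 zero_le_one]
    refine mul_ne_zero ?_ (twoExp_one_ne_zero η)
    simp [Real.pi_ne_zero]

lemma integral_comp_mul_eq_zero_iff {α : ℝ} (hα : 0 < α) (φ : ℝ → ℂ) :
    ∫ t, φ (α * t) = 0 ↔ ∫ t, φ t = 0 := by
  rw [Measure.integral_comp_mul_left, smul_eq_zero, or_iff_right]
  positivity

lemma scaled_moment_iff {α : ℝ} (hα : 0 < α) (f : ℝ → ℂ) (m : ℕ) :
    ∫ t : ℝ, Complex.exp (Complex.I * π * α * m * t) * f (α * t) = 0 ↔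
      ∫ t : ℝ, f t * Complex.exp (Complex.I * π * m * t) = 0 := by
  rw [← integral_comp_mul_eq_zero_iff hα fun t : ℝ => f t * Complex.exp (Complex.I * π * m * t)]
  refine Eq.congr_left (integral_congr_ae (Eventually.of_forall fun t => ?_))
  simp only
  rw [mul_comm]
  congr 2
  push_cast
  ring

lemma scaled_inverse_moment_iff {α : ℝ} (hα : 0 < α) (f : ℝ → ℂ) (β : ℝ) (n : ℕ) :
    ∫ t : ℝ, Complex.exp (-(Complex.I * π * β * n) / t) * f (α * t) = 0 ↔
      ∫ t : ℝ, f t * Complex.exp (Complex.I * π * n * (-(α * β) / t : ℝ)) = 0 := by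
  rw [← integral_comp_mul_eq_zero_iff hα fun t : ℝ => f t * Complex.exp (Complex.I * π * n * (-(α * β) / t : ℝ))]
  refine Eq.congr_left (integral_congr_ae (Eventually.of_forall fun t => ?_))
  have hα' : (α : ℂ) ≠ 0 := by exact_mod_cast hα.ne'
  simp only
  rw [mul_comm]
  congr 2
  push_cast
  rcases eq_or_ne t 0 with rfl | ht
  · simp
  · have ht' : (t : ℂ) ≠ 0 := by exact_mod_cast ht
    field_simp

lemma scaled_fourier_iff {α : ℝ} (hα : 0 < α) (f : ℝ → ℂ) (y : ℝ) :
    ∫ t : ℝ, Complex.exp (Complex.I * (α * y : ℝ) * t) * f (α * t) = 0 ↔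
      ∫ t : ℝ, f t * Complex.exp (Complex.I * y * t) = 0 := by
  rw [← integral_comp_mul_eq_zero_iff hα fun t : ℝ => f t * Complex.exp (Complex.I * y * t)]
  refine Eq.congr_left (integral_congr_ae (Eventually.of_forall fun t => ?_))
  simp only
  rw [mul_comm]
  congr 2
  push_cast
  ring

end KleinGordon

/-- The holomorphic counterpart: the functions `e^{iπαmt}`, `e^{-iπβn/t}`
(`m, n ≥ 0`) span a weak-star dense subspace of `H^∞₊(ℝ)` iff `αβ ≤ 1`;
dually, every annihilating `f ∈ L¹(ℝ)` lies in `H¹₊(ℝ)` iff `αβ ≤ 1`. -/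
theorem stmt_8 (α β : ℝ) (hα : 0 < α) (hβ : 0 < β) :
    α * β ≤ 1 ↔
      ∀ f : ℝ → ℂ, Integrable f →
        (∀ m : ℕ, ∫ t : ℝ, Complex.exp (Complex.I * π * α * m * t) * f t = 0) →
        (∀ n : ℕ, ∫ t : ℝ, Complex.exp (-(Complex.I * π * β * n) / t) * f t = 0) →
        ∀ y : ℝ, 0 ≤ y → ∫ t : ℝ, Complex.exp (Complex.I * y * t) * f t = 0 := by
  have hαβ : 0 < α * β := mul_pos hα hβ
  constructor
  · intro h f hf h1 h2 y hy
    obtain ⟨g, rfl⟩ : ∃ g : ℝ → ℂ, f = fun t => g (α * t) :=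
      ⟨fun t => f (α⁻¹ * t), by ext t; simp [hα.ne']⟩
    have hg : Integrable g := (integrable_comp_mul_left_iff g hα.ne').1 hf
    have k1 := fun m => (KleinGordon.scaled_moment_iff hα g m).1 (h1 m)
    have k2 := fun n => (KleinGordon.scaled_inverse_moment_iff hα g β n).1 (h2 n)
    obtain ⟨x, rfl⟩ : ∃ x, y = α * x := ⟨α⁻¹ * y, by field_simp⟩
    rw [KleinGordon.scaled_fourier_iff hα]
    rcases (nonneg_of_mul_nonneg_right hy hα).eq_or_lt with rfl | hx
    · simpa using k1 0
    · exact KleinGordon.integral_exp_eq_zero_of_cauchy hg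
        (fun z hz => KleinGordon.cauchy_eq_zero hαβ h hg k1 k2 hz) hx
  · intro h
    by_contra! hlt
    obtain ⟨f, hf, h1, h2, h3⟩ := KleinGordon.exists_counterexample hlt
    refine h3 ((KleinGordon.scaled_fourier_iff hα f 1).1 ?_)
    exact h _ (hf.comp_mul_left' hα.ne')
      (fun m => (KleinGordon.scaled_moment_iff hα f m).2 (h1 m))
      (fun n => (KleinGordon.scaled_inverse_moment_iff hα f β n).2 (h2 n)) _ (by positivity)
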